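/- Let ℓ be an odd prime, r ≥ 1, let F be a finite field with ℓ^r elements, and let Q be any nondegenerate quadratic form on F^n. Then H_d(O(Q); F_ℓ) = 0 for all d with 0 < 2d < n − 1, where F_ℓ is the ℓ-element field with trivial action. -/

import Mathlib

/-! # Group homology via the inhomogeneous bar complex (trivial coefficients) -/

namespace GroupHomologyBar

variable (G : Type) [Group G] (A : Type) [AddCommGroup A]

/-- Inhomogeneous `n`-chains of `G` with coefficients in `A`. -/
abbrev chains (n : ℕ) : Type := (Fin n → G) →₀ A

/-- The differential of the inhomogeneous bar complex with trivial `G`-action on the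
coefficients, sending `[g₁|…|g_{n+1}] ⊗ a` to
`[g₂|…|g_{n+1}] ⊗ a + ∑ⱼ (-1)^{j+1} [g₁|…|gⱼg_{j+1}|…|g_{n+1}] ⊗ a`
(the last summand of the sum being `(-1)^{n+1} [g₁|…|g_n] ⊗ a`). -/
noncomputable def d (n : ℕ) : chains G A (n + 1) →ₗ[ℤ] chains G A n :=
  Finsupp.lsum ℤ fun g =>
    (Finsupp.lsingle (Fin.tail g) : A →ₗ[ℤ] chains G A n)
      + ∑ j : Fin (n + 1),
          ((-1 : ℤ) ^ ((j : ℕ) + 1)) • Finsupp.lsingle (Fin.contractNth j (· * ·) g)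

/-- The `n`-cycles. -/
noncomputable def cycles : (n : ℕ) → Submodule ℤ (chains G A n)
  | 0 => ⊤
  | (n + 1) => LinearMap.ker (d G A n)

/-- The `n`-boundaries, viewed as a submodule of the `n`-cycles. -/
noncomputable def boundaries (n : ℕ) : Submodule ℤ (cycles G A n) :=
  Submodule.comap (cycles G A n).subtype (LinearMap.range (d G A n))

/-- The group homology `H_n(G; A)` of `G` with trivial coefficients in `A`. -/
abbrev Homology (n : ℕ) : Type := cycles G A n ⧸ boundaries G A n

variable {G}
variable {G' : Type} [Group G']

/-- The map on chains induced by a group homomorphism. -/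
noncomputable def chainsMap (φ : G →* G') (n : ℕ) : chains G A n →ₗ[ℤ] chains G' A n :=
  Finsupp.lmapDomain A ℤ fun v => φ ∘ v

lemma chainsMap_single (φ : G →* G') {n : ℕ} (v : Fin n → G) (a : A) :
    chainsMap A φ n (Finsupp.single v a) = Finsupp.single (φ ∘ v) a := by
  simp [chainsMap, Finsupp.mapDomain_single]

lemma d_single {n : ℕ} (g : Fin (n + 1) → G) (a : A) :
    d G A n (Finsupp.single g a)
      = Finsupp.single (Fin.tail g) a
        + ∑ j : Fin (n + 1),
            ((-1 : ℤ) ^ ((j : ℕ) + 1)) • Finsupp.single (Fin.contractNth j (· * ·) g) a := by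
  simp [d, Finsupp.lsum_single]

lemma d_chainsMap (φ : G →* G') (n : ℕ) :
    (d G' A n).comp (chainsMap A φ (n + 1)) = (chainsMap A φ n).comp (d G A n) := by
  apply Finsupp.lhom_ext
  intro g a
  have hc : ∀ j : Fin (n + 1),
      φ ∘ Fin.contractNth j (· * ·) g = Fin.contractNth j (· * ·) (φ ∘ g) := by
    intro j
    funext k
    simp only [Function.comp_apply, Fin.contractNth]
    split_ifs <;> simp
  simp only [LinearMap.comp_apply, chainsMap_single, d_single, map_add, map_sum, map_smul,
    chainsMap_single, Fin.comp_tail, hc]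

lemma chainsMap_mem_cycles (φ : G →* G') (n : ℕ) :
    ∀ x ∈ cycles G A n, chainsMap A φ n x ∈ cycles G' A n := by
  intro x hx
  cases n with
  | zero => trivial
  | succ n =>
    simp only [cycles, LinearMap.mem_ker] at hx ⊢
    have := congrArg (fun L : chains G A (n + 1) →ₗ[ℤ] chains G' A n => L x) (d_chainsMap A φ n)
    simp only [LinearMap.comp_apply] at this
    rw [this, hx, map_zero]

/-- The map on cycles induced by a group homomorphism. -/
noncomputable def cyclesMap (φ : G →* G') (n : ℕ) : cycles G A n →ₗ[ℤ] cycles G' A n :=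
  (chainsMap A φ n).restrict (chainsMap_mem_cycles A φ n)

/-- The map `H_n(G; A) → H_n(G'; A)` on group homology induced by a group
homomorphism `φ : G →* G'`. -/
noncomputable def inducedMap (φ : G →* G') (n : ℕ) :
    Homology G A n →ₗ[ℤ] Homology G' A n :=
  Submodule.mapQ _ _ (cyclesMap A φ n) (by
    rintro ⟨x, hx⟩ hmem
    simp only [boundaries, Submodule.mem_comap, Submodule.subtype_apply,
      LinearMap.mem_range] at hmem ⊢
    obtain ⟨y, hy⟩ := hmem
    refine ⟨chainsMap A φ (n + 1) y, ?_⟩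
    have := congrArg (fun L : chains G A (n + 1) →ₗ[ℤ] chains G' A n => L y) (d_chainsMap A φ n)
    simp only [LinearMap.comp_apply] at this
    rw [this, hy]
    rfl)

end GroupHomologyBar

section Isometries

variable (F : Type) [Field F] {W : Type} [AddCommGroup W] [Module F W]

/-- The group of linear automorphisms of a vector space `V` preserving a
function `Q : V → F` (e.g. a quadratic form). -/
def quadIsoms {V : Type} [AddCommGroup V] [Module F V] (Q : V → F) :
    Subgroup (V ≃ₗ[F] V) where
  carrier := {g | ∀ v, Q (g v) = Q v}
  one_mem' := fun _ => rfl
  mul_mem' := fun {a b} ha hb v => by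
    rw [show (a * b) v = a (b v) from rfl, ha, hb]
  inv_mem' := fun {a} ha v => by
    rw [show (a⁻¹ : V ≃ₗ[F] V) v = a.symm v from rfl, ← ha (a.symm v), a.apply_symm_apply]

/-- The group of linear automorphisms of a vector space `V` preserving a
pairing `ω : V → V → F` (e.g. a bilinear or sesquilinear form). -/
def bilinIsoms {V : Type} [AddCommGroup V] [Module F V] (ω : V → V → F) :
    Subgroup (V ≃ₗ[F] V) where
  carrier := {g | ∀ v w, ω (g v) (g w) = ω v w}
  one_mem' := fun _ _ => rfl
  mul_mem' := fun {a b} ha hb v w => by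
    rw [show (a * b) v = a (b v) from rfl, show (a * b) w = a (b w) from rfl, ha, hb]
  inv_mem' := fun {a} ha v w => by
    rw [show (a⁻¹ : V ≃ₗ[F] V) v = a.symm v from rfl,
      show (a⁻¹ : V ≃ₗ[F] V) w = a.symm w from rfl,
      ← ha (a.symm v) (a.symm w), a.apply_symm_apply, a.apply_symm_apply]

/-- The "orthogonal sum" form `x ↦ ∑ i, q (x i)` on `W^n`. -/
def sumForm (q : W → F) (n : ℕ) (x : Fin n → W) : F := ∑ i, q (x i)

/-- The "orthogonal sum" pairing `(x, y) ↦ ∑ i, β (x i) (y i)` on `W^n`. -/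
def pairForm (β : W → W → F) (n : ℕ) (x y : Fin n → W) : F := ∑ i, β (x i) (y i)

/-- The linear equivalence `W^{n+1} ≃ W^n × W` splitting off the last coordinate. -/
def lastSplit (n : ℕ) : (Fin (n + 1) → W) ≃ₗ[F] (Fin n → W) × W where
  toLinearMap := (LinearMap.funLeft F W Fin.castSucc).prod (LinearMap.proj (Fin.last n))
  invFun p := Fin.snoc p.1 p.2
  left_inv x := Fin.snoc_init_self x
  right_inv p := by
    refine Prod.ext (funext fun i => ?_) ?_
    · exact @Fin.snoc_castSucc n (fun _ => W) p.2 p.1 i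
    · exact @Fin.snoc_last n (fun _ => W) p.2 p.1

lemma lastSplit_symm_apply (n : ℕ) (p : Fin n → W) (w : W) :
    (lastSplit F n).symm (p, w) = Fin.snoc p w := rfl

/-- Extension of an automorphism of `W^n` to `W^{n+1}` by the identity on the
added last coordinate. -/
def stabAut (n : ℕ) (g : (Fin n → W) ≃ₗ[F] (Fin n → W)) :
    (Fin (n + 1) → W) ≃ₗ[F] (Fin (n + 1) → W) :=
  (lastSplit F n).trans ((g.prodCongr (LinearEquiv.refl F W)).trans (lastSplit F n).symm)

lemma stabAut_symm_apply (n : ℕ) (g : (Fin n → W) ≃ₗ[F] (Fin n → W))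
    (p : Fin n → W) (w : W) :
    stabAut F n g ((lastSplit F n).symm (p, w)) = (lastSplit F n).symm (g p, w) := by
  simp [stabAut, LinearEquiv.trans_apply, LinearEquiv.apply_symm_apply, LinearEquiv.prodCongr_apply]

lemma sumForm_snoc (q : W → F) (n : ℕ) (p : Fin n → W) (w : W) :
    sumForm F q (n + 1) ((lastSplit F n).symm (p, w)) = sumForm F q n p + q w := by
  simp [sumForm, lastSplit_symm_apply, Fin.sum_univ_castSucc, Fin.snoc_castSucc, Fin.snoc_last]

lemma pairForm_snoc (β : W → W → F) (n : ℕ) (p p' : Fin n → W) (w w' : W) :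
    pairForm F β (n + 1) ((lastSplit F n).symm (p, w)) ((lastSplit F n).symm (p', w'))
      = pairForm F β n p p' + β w w' := by
  simp [pairForm, lastSplit_symm_apply, Fin.sum_univ_castSucc, Fin.snoc_castSucc, Fin.snoc_last]

/-- The stabilization homomorphism on the isometry group of the form `sumForm q n`,
extending an isometry by the identity on the added summand. -/
def quadStab (q : W → F) (n : ℕ) :
    quadIsoms F (sumForm F q n) →* quadIsoms F (sumForm F q (n + 1)) where
  toFun g := ⟨stabAut F n g.1, by
    intro v
    obtain ⟨⟨p, w⟩, rfl⟩ : ∃ x, (lastSplit F n).symm x = v :=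
      ⟨lastSplit F n v, (lastSplit F n).symm_apply_apply v⟩
    rw [stabAut_symm_apply, sumForm_snoc, sumForm_snoc, g.2 p]⟩
  map_one' := by
    refine Subtype.ext (LinearEquiv.ext fun v => ?_)
    show stabAut F n 1 v = v
    obtain ⟨⟨p, w⟩, rfl⟩ : ∃ x, (lastSplit F n).symm x = v :=
      ⟨lastSplit F n v, (lastSplit F n).symm_apply_apply v⟩
    rw [stabAut_symm_apply]
    rfl
  map_mul' g h := by
    refine Subtype.ext (LinearEquiv.ext fun v => ?_)
    show stabAut F n (g.1 * h.1) v = stabAut F n g.1 (stabAut F n h.1 v)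
    obtain ⟨⟨p, w⟩, rfl⟩ : ∃ x, (lastSplit F n).symm x = v :=
      ⟨lastSplit F n v, (lastSplit F n).symm_apply_apply v⟩
    rw [stabAut_symm_apply, stabAut_symm_apply, stabAut_symm_apply]
    rfl

/-- The stabilization homomorphism on the isometry group of the pairing `pairForm β n`,
extending an isometry by the identity on the added summand. -/
def bilinStab (β : W → W → F) (n : ℕ) :
    bilinIsoms F (pairForm F β n) →* bilinIsoms F (pairForm F β (n + 1)) where
  toFun g := ⟨stabAut F n g.1, by
    intro v v'
    obtain ⟨⟨p, w⟩, rfl⟩ : ∃ x, (lastSplit F n).symm x = v :=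
      ⟨lastSplit F n v, (lastSplit F n).symm_apply_apply v⟩
    obtain ⟨⟨p', w'⟩, rfl⟩ : ∃ x, (lastSplit F n).symm x = v' :=
      ⟨lastSplit F n v', (lastSplit F n).symm_apply_apply v'⟩
    rw [stabAut_symm_apply, stabAut_symm_apply, pairForm_snoc, pairForm_snoc, g.2 p p']⟩
  map_one' := by
    refine Subtype.ext (LinearEquiv.ext fun v => ?_)
    show stabAut F n 1 v = v
    obtain ⟨⟨p, w⟩, rfl⟩ : ∃ x, (lastSplit F n).symm x = v :=
      ⟨lastSplit F n v, (lastSplit F n).symm_apply_apply v⟩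
    rw [stabAut_symm_apply]
    rfl
  map_mul' g h := by
    refine Subtype.ext (LinearEquiv.ext fun v => ?_)
    show stabAut F n (g.1 * h.1) v = stabAut F n g.1 (stabAut F n h.1 v)
    obtain ⟨⟨p, w⟩, rfl⟩ : ∃ x, (lastSplit F n).symm x = v :=
      ⟨lastSplit F n v, (lastSplit F n).symm_apply_apply v⟩
    rw [stabAut_symm_apply, stabAut_symm_apply, stabAut_symm_apply]
    rfl

end Isometries


open CategoryTheory

/-! ## Part A -/

section

set_option linter.unusedSectionVars false
namespace GH
variable {k : Type} [Field k]

/-- group homology as a plain type -/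
def H {G M : Type} [Group G] [AddCommGroup M] [Module k M] (j : ℕ) (ρ : Representation k G M) :
    Type := groupHomology (Rep.of ρ) j

section
variable {G G' G'' M M' M'' : Type} [Group G] [Group G'] [Group G''] [AddCommGroup M] [Module k M]
  [AddCommGroup M'] [Module k M'] [AddCommGroup M''] [Module k M'']
  (ρ : Representation k G M) (ρ' : Representation k G' M') (ρ'' : Representation k G'' M'')

noncomputable instance (j : ℕ) : AddCommGroup (H j ρ) :=
  inferInstanceAs (AddCommGroup (groupHomology (Rep.of ρ) j))
noncomputable instance (j : ℕ) : Module k (H j ρ) :=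
  inferInstanceAs (Module k (groupHomology (Rep.of ρ) j))

/-- a linear map compatible with a group homomorphism -/
def Compat (φ : G →* G') (f : M →ₗ[k] M') : Prop := ∀ g m, f (ρ g m) = ρ' (φ g) (f m)

variable {ρ ρ' ρ''}
/-- morphism in Rep attached to a compatible pair -/
noncomputable def toHom {φ : G →* G'} {f : M →ₗ[k] M'} (h : Compat ρ ρ' φ f) :
    Rep.of ρ ⟶ Rep.res φ (Rep.of ρ') :=
  Rep.ofHom (LinearMap.intertwiningMap_of_isIntertwiningMap ρ (ρ'.comp φ) f h)

/-- functoriality of group homology -/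
noncomputable def Hmap {φ : G →* G'} {f : M →ₗ[k] M'} (h : Compat ρ ρ' φ f) (j : ℕ) :
    H j ρ →ₗ[k] H j ρ' :=
  (groupHomology.map φ (toHom h) j).hom

theorem Compat.id : Compat ρ ρ (MonoidHom.id G) LinearMap.id := fun _ _ => rfl
theorem Compat.comp {φ : G →* G'} {f : M →ₗ[k] M'} {φ' : G' →* G''} {f' : M' →ₗ[k] M''}
    (h' : Compat ρ' ρ'' φ' f') (h : Compat ρ ρ' φ f) :
    Compat ρ ρ'' (φ'.comp φ) (f' ∘ₗ f) := fun g m => by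
  simp [h g m, h' _ _]

theorem Hmap_id' (h : Compat ρ ρ (MonoidHom.id G) LinearMap.id) (j : ℕ) :
    Hmap h j = LinearMap.id := by
  have := groupHomology.map_id (A := Rep.of ρ) (n := j)
  exact congrArg ModuleCat.Hom.hom this

theorem Hmap_congr {φ ψ : G →* G'} {f g : M →ₗ[k] M'} (h : Compat ρ ρ' φ f)
    (h' : Compat ρ ρ' ψ g) (e : φ = ψ) (e' : f = g) (j : ℕ) : Hmap h j = Hmap h' j := by
  subst e e'; rfl

theorem Hmap_comp {φ : G →* G'} {f : M →ₗ[k] M'} {φ' : G' →* G''} {f' : M' →ₗ[k] M''}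
    (h' : Compat ρ' ρ'' φ' f') (h : Compat ρ ρ' φ f) (j : ℕ) :
    Hmap h' j ∘ₗ Hmap h j = Hmap (h'.comp h) j := by
  have := groupHomology.map_comp φ φ' (toHom h) (toHom h') j
  have := congrArg ModuleCat.Hom.hom this
  exact this.symm

theorem Hmap_comp_apply {φ : G →* G'} {f : M →ₗ[k] M'} {φ' : G' →* G''} {f' : M' →ₗ[k] M''}
    (h' : Compat ρ' ρ'' φ' f') (h : Compat ρ ρ' φ f) (j : ℕ) (x : H j ρ) :
    Hmap h' j (Hmap h j x) = Hmap (h'.comp h) j x := by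
  rw [← Hmap_comp]; rfl

theorem Hmap_id_apply {φ : G →* G} {f : M →ₗ[k] M} (h : Compat ρ ρ φ f) (e : φ = MonoidHom.id G)
    (e' : f = LinearMap.id) (j : ℕ) (x : H j ρ) : Hmap h j x = x := by
  subst e e'
  rw [Hmap_id']; rfl

/-- `Hmap` is determined by its restriction to cycles; linear in `f`. -/
theorem Hmap_add {φ : G →* G'} {f g : M →ₗ[k] M'} (h : Compat ρ ρ' φ f)
    (h' : Compat ρ ρ' φ g) (h'' : Compat ρ ρ' φ (f + g)) (j : ℕ) :
    Hmap h'' j = Hmap h j + Hmap h' j := by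
  have e : groupHomology.chainsMap φ (toHom h'') =
      groupHomology.chainsMap φ (toHom h) + groupHomology.chainsMap φ (toHom h') := by
    refine HomologicalComplex.hom_ext _ _ fun i => ModuleCat.hom_ext <| Finsupp.lhom_ext fun x a => ?_
    rw [HomologicalComplex.add_f_apply, ModuleCat.hom_add, LinearMap.add_apply]
    erw [groupHomology.chainsMap_f_single, groupHomology.chainsMap_f_single,
      groupHomology.chainsMap_f_single]
    exact Finsupp.single_add _ _ _
  have e2 : groupHomology.map φ (toHom h'') j =
      groupHomology.map φ (toHom h) j + groupHomology.map φ (toHom h') j := by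
    unfold groupHomology.map
    rw [e, HomologicalComplex.homologyMap_add]
    rfl
  exact congrArg ModuleCat.Hom.hom e2

theorem Hmap_zero {φ : G →* G'} (h : Compat ρ ρ' φ 0) (j : ℕ) : Hmap h j = 0 := by
  have := Hmap_add h h (by intro g m; simp) j
  have e : Hmap (ρ := ρ) (ρ' := ρ') (φ := φ) (f := 0 + 0) (by intro g m; simp) j = Hmap h j :=
    Hmap_congr _ _ rfl (by simp) j
  rw [e] at this
  exact left_eq_add.1 this

theorem homologyMap_smul_id (K : ChainComplex (ModuleCat.{0} k) ℕ) (c : k) (j : ℕ) :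
    HomologicalComplex.homologyMap (c • 𝟙 K) j = c • 𝟙 (K.homology j) := by
  have h1 : (HomologicalComplex.shortComplexFunctor (ModuleCat.{0} k) (ComplexShape.down ℕ) j).map
      (c • 𝟙 K) = c • 𝟙 (K.sc j) := by
    ext <;> rfl
  have : HomologicalComplex.homologyMap (c • 𝟙 K) j =
    ShortComplex.homologyMap (c • 𝟙 (K.sc j)) := by
    rw [← h1]; rfl
  rw [this, ShortComplex.homologyMap_smul, ShortComplex.homologyMap_id]
  rfl

theorem Hmap_smul {φ : G →* G'} {f : M →ₗ[k] M'} (c : k) (h : Compat ρ ρ' φ f)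
    (h'' : Compat ρ ρ' φ (c • f)) (j : ℕ) :
    Hmap h'' j = c • Hmap h j := by
  have hc : Compat ρ' ρ' (MonoidHom.id G') (c • LinearMap.id) := fun g m => by simp
  have e : groupHomology.chainsMap (MonoidHom.id G') (toHom hc) =
      c • 𝟙 (groupHomology.inhomogeneousChains (Rep.of ρ')) := by
    refine HomologicalComplex.hom_ext _ _ fun i => ModuleCat.hom_ext <| Finsupp.lhom_ext fun x a => ?_
    rw [HomologicalComplex.smul_f_apply, ModuleCat.hom_smul, LinearMap.smul_apply]
    erw [groupHomology.chainsMap_f_single]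
    exact (Finsupp.smul_single _ _ _).symm
  have e2 : groupHomology.map (MonoidHom.id G') (toHom hc) j =
      c • 𝟙 (groupHomology (Rep.of ρ') j) := by
    unfold groupHomology.map
    rw [e]
    exact homologyMap_smul_id _ c j
  have e3 : Hmap hc j = c • LinearMap.id := congrArg ModuleCat.Hom.hom e2
  have : Hmap h'' j = Hmap hc j ∘ₗ Hmap h j := by
    rw [Hmap_comp]
  rw [this, e3]; rfl

end

section SES
variable {G A B C : Type} [Group G] [AddCommGroup A] [Module k A]
  [AddCommGroup B] [Module k B] [AddCommGroup C] [Module k C]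
  {a : Representation k G A} {b : Representation k G B} {c : Representation k G C}

/-- short exact sequences of representations -/
structure SES (a : Representation k G A) (b : Representation k G B) (c : Representation k G C)
    (f : A →ₗ[k] B) (g : B →ₗ[k] C) : Prop where
  hf : Compat a b (MonoidHom.id G) f
  hg : Compat b c (MonoidHom.id G) g
  inj : Function.Injective f
  surj : Function.Surjective g
  exact : Function.Exact f g

/-- associated short complex -/
noncomputable def SES.X {f : A →ₗ[k] B} {g : B →ₗ[k] C} (S : SES a b c f g) :
    ShortComplex (Rep k G) where
  X₁ := Rep.of a
  X₂ := Rep.of b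
  X₃ := Rep.of c
  f := toHom S.hf
  g := toHom S.hg
  zero := by
    refine Rep.hom_ext ?_
    ext x
    exact S.exact.apply_apply_eq_zero x

theorem SES.shortExact {f : A →ₗ[k] B} {g : B →ₗ[k] C} (S : SES a b c f g) : S.X.ShortExact where
  exact := by
    rw [← ShortComplex.exact_map_iff_of_faithful S.X (forget₂ (Rep k G) (ModuleCat k)),
      ShortComplex.moduleCat_exact_iff]
    intro x hx
    exact (S.exact x).1 hx
  mono_f := (Rep.mono_iff_injective _).2 S.inj
  epi_g := (Rep.epi_iff_surjective _).2 S.surj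

/-- connecting homomorphism -/
noncomputable def SES.δ {f : A →ₗ[k] B} {g : B →ₗ[k] C} (S : SES a b c f g) (j : ℕ) :
    H (j + 1) c →ₗ[k] H j a := (groupHomology.δ S.shortExact (j + 1) j rfl).hom

variable {f : A →ₗ[k] B} {g : B →ₗ[k] C}

theorem SES.exact₂ (S : SES a b c f g) (j : ℕ) : Function.Exact (Hmap S.hf j) (Hmap S.hg j) :=
  (ShortComplex.ShortExact.moduleCat_exact_iff_function_exact _).1
    (groupHomology.mapShortComplex₂_exact S.shortExact j)

theorem SES.exact₁ (S : SES a b c f g) (j : ℕ) : Function.Exact (S.δ j) (Hmap S.hf j) :=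
  (ShortComplex.ShortExact.moduleCat_exact_iff_function_exact _).1
    (groupHomology.mapShortComplex₁_exact S.shortExact (i := j+1) (j := j) rfl)

theorem SES.exact₃ (S : SES a b c f g) (j : ℕ) : Function.Exact (Hmap S.hg (j + 1)) (S.δ j) :=
  (ShortComplex.ShortExact.moduleCat_exact_iff_function_exact _).1
    (groupHomology.mapShortComplex₃_exact S.shortExact (i := j+1) (j := j) rfl)

variable {G' A' B' C' : Type} [Group G'] [AddCommGroup A'] [Module k A']
  [AddCommGroup B'] [Module k B'] [AddCommGroup C'] [Module k C']
  {a' : Representation k G' A'} {b' : Representation k G' B'} {c' : Representation k G' C'}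
  {f' : A' →ₗ[k] B'} {g' : B' →ₗ[k] C'}

theorem SES.δ_nat (S : SES a b c f g) (S' : SES a' b' c' f' g') {φ : G →* G'}
    {u : A →ₗ[k] A'} {v : B →ₗ[k] B'} {w : C →ₗ[k] C'}
    (hu : Compat a a' φ u) (hv : Compat b b' φ v) (hw : Compat c c' φ w)
    (e1 : v ∘ₗ f = f' ∘ₗ u) (e2 : w ∘ₗ g = g' ∘ₗ v) (j : ℕ) (x : H (j + 1) c) :
    S'.δ j (Hmap hw (j + 1) x) = Hmap hu j (S.δ j x) := by
  let T : S.X.map (groupHomology.chainsFunctor k G) ⟶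
      S'.X.map (groupHomology.chainsFunctor k G') :=
    { τ₁ := groupHomology.chainsMap φ (toHom hu)
      τ₂ := groupHomology.chainsMap φ (toHom hv)
      τ₃ := groupHomology.chainsMap φ (toHom hw)
      comm₁₂ := by
        refine (groupHomology.chainsMap_comp φ (MonoidHom.id G') (toHom hu) (toHom S'.hf)).symm.trans
          (Eq.trans ?_
            (groupHomology.chainsMap_comp (MonoidHom.id G) φ (toHom S.hf) (toHom hv)))
        exact groupHomology.chainsMap_congr rfl e1.symm
      comm₂₃ := by
        refine (groupHomology.chainsMap_comp φ (MonoidHom.id G') (toHom hv) (toHom S'.hg)).symm.trans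
          (Eq.trans ?_
            (groupHomology.chainsMap_comp (MonoidHom.id G) φ (toHom S.hg) (toHom hw)))
        exact groupHomology.chainsMap_congr rfl e2.symm }
  have := HomologicalComplex.HomologySequence.δ_naturality T
    (groupHomology.map_chainsFunctor_shortExact S.shortExact)
    (groupHomology.map_chainsFunctor_shortExact S'.shortExact) (j + 1) j rfl
  have := congrArg (fun t => ModuleCat.Hom.hom t x) this
  exact this.symm

end SES

section H0
variable {G G' M M' : Type} [Group G] [Group G'] [AddCommGroup M] [Module k M]
  [AddCommGroup M'] [Module k M']

/-- the projection to coinvariants -/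
noncomputable def h0 (ρ : Representation k G M) : M →ₗ[k] H 0 ρ := (groupHomology.H0π (Rep.of ρ)).hom

theorem h0_surj (ρ : Representation k G M) : Function.Surjective (h0 ρ) := by
  intro x
  induction x using groupHomology.H0_induction_on with
  | h x => exact ⟨x, rfl⟩

variable {ρ : Representation k G M} {ρ' : Representation k G' M'}

theorem h0_ker (ρ : Representation k G M) :
    LinearMap.ker (h0 ρ) = Representation.Coinvariants.ker ρ := by
  have h := congrArg ModuleCat.Hom.hom (groupHomology.H0π_comp_H0Iso_hom (Rep.of ρ))
  have hi : Function.Injective (groupHomology.H0Iso (Rep.of ρ)).hom.hom :=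
    (ModuleCat.mono_iff_injective _).1 inferInstance
  ext x
  rw [LinearMap.mem_ker, ← Representation.Coinvariants.mk_eq_zero]
  have h2 : (groupHomology.H0Iso (Rep.of ρ)).hom.hom (h0 ρ x) =
    Representation.Coinvariants.mk ρ x := congrArg (fun t => t x) h
  rw [← h2]
  constructor
  · intro h; exact (congrArg _ h).trans (map_zero (groupHomology.H0Iso (Rep.of ρ)).hom.hom)
  · intro h; exact hi (h.trans (map_zero _).symm)

theorem h0_mem {N : Type} [AddCommGroup N] [Module k N] (f : M →ₗ[k] N)
    (h : ∀ g m, f (ρ g m) = f m) {x : M} (hx : h0 ρ x = 0) : f x = 0 := by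
  have hx : x ∈ Representation.Coinvariants.ker ρ := by rw [← h0_ker]; exact hx
  have : Representation.Coinvariants.ker ρ ≤ LinearMap.ker f := by
    rw [Representation.Coinvariants.ker, Submodule.span_le]
    rintro _ ⟨⟨g, m⟩, rfl⟩
    simp [h]
  exact this hx

theorem h0_rho (g : G) (m : M) : h0 ρ (ρ g m) = h0 ρ m := by
  have : ρ g m - m ∈ LinearMap.ker (h0 ρ) := by
    rw [h0_ker]; exact Representation.Coinvariants.sub_mem_ker g m
  rw [LinearMap.mem_ker, map_sub] at this
  exact sub_eq_zero.1 this

theorem Hmap_h0 {φ : G →* G'} {f : M →ₗ[k] M'} (h : Compat ρ ρ' φ f) (m : M) :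
    Hmap h 0 (h0 ρ m) = h0 ρ' (f m) := by
  have := congrArg ModuleCat.Hom.hom (groupHomology.H0π_comp_map φ (toHom h))
  exact congrArg (fun t => t m) this

/-- lift from coinvariants -/
theorem h0_lift {N : Type} [AddCommGroup N] [Module k N] (ρ : Representation k G M)
    (f : M →ₗ[k] N)
    (h : ∀ g m, f (ρ g m) = f m) : ∃ F : H 0 ρ →ₗ[k] N, ∀ m, F (h0 ρ m) = f m := by
  refine ⟨(LinearMap.ker (h0 ρ)).liftQ f (fun x hx => h0_mem f h hx) ∘ₗ
    ((h0 ρ).quotKerEquivOfSurjective (h0_surj ρ)).symm.toLinearMap, fun m => ?_⟩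
  have : ((h0 ρ).quotKerEquivOfSurjective (h0_surj ρ)).symm (h0 ρ m) = Submodule.Quotient.mk m := by
    rw [LinearEquiv.symm_apply_eq]; rfl
  simp only [LinearMap.comp_apply, LinearEquiv.coe_coe, this]
  rfl

theorem Hmap_surj0 {φ : G →* G'} {f : M →ₗ[k] M'} (h : Compat ρ ρ' φ f)
    (hf : Function.Surjective f) : Function.Surjective (Hmap h 0) := by
  intro y
  obtain ⟨y, rfl⟩ := h0_surj _ y
  obtain ⟨m, rfl⟩ := hf y
  exact ⟨h0 ρ m, Hmap_h0 h m⟩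
end H0

section acyclic
variable {G M : Type} [Group G] [AddCommGroup M] [Module k M]

theorem H_succ_of_subsingleton [Subsingleton G] (ρ : Representation k G M) (j : ℕ) :
    Subsingleton (H (j + 1) ρ) :=
  ModuleCat.subsingleton_of_isZero (isZero_groupHomology_succ_of_subsingleton (Rep.of ρ) j)

open Classical in
theorem acyclic_of_section [Fintype G] (ρ : Representation k G M) (s : M →ₗ[k] M)
    (hs : ∀ m, ∑ g : G, ρ g (s (ρ g⁻¹ m)) = m) (j : ℕ) : Subsingleton (H (j + 1) ρ) := by
  let S : Subgroup G := ⊥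
  let A : Rep k S := Rep.res S.subtype (Rep.of ρ)
  have hz : Limits.IsZero (groupHomology (Rep.ind S.subtype A) (j + 1)) :=
    (isZero_groupHomology_succ_of_subsingleton A j).of_iso (groupHomology.indIso S A (j + 1))
  have : Subsingleton (H (j + 1) (A.ρ.ind S.subtype)) := ModuleCat.subsingleton_of_isZero hz
  let u : M →ₗ[k] Representation.IndV S.subtype A.ρ :=
    ∑ g : G, (Representation.IndV.mk S.subtype A.ρ g⁻¹) ∘ₗ s ∘ₗ ρ g⁻¹
  have hu : Compat ρ (A.ρ.ind S.subtype) (MonoidHom.id G) u := by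
    intro g m
    simp only [u, LinearMap.sum_apply, map_sum]
    rw [← Equiv.sum_comp (Equiv.mulLeft g)]
    refine Finset.sum_congr rfl fun x _ => ?_
    simp only [LinearMap.comp_apply, MonoidHom.id_apply]
    erw [Representation.ind_mk]
    simp [Equiv.coe_mulLeft, mul_inv_rev, ← Module.End.mul_apply, ← map_mul]
  let v := (Rep.indResHomEquiv S.subtype A (Rep.of ρ)).symm (𝟙 A)
  let w : Representation.IndV S.subtype A.ρ →ₗ[k] M := v.hom.toLinearMap
  have hw : Compat (A.ρ.ind S.subtype) ρ (MonoidHom.id G) w := by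
    intro g m
    exact Rep.hom_comm_apply v g m
  have hwm : ∀ g m, w (Representation.IndV.mk S.subtype A.ρ g m) = ρ g⁻¹ m := by
    intro g m
    simp [w, v]
  have hwu : w ∘ₗ u = LinearMap.id := by
    ext m
    simp only [u, LinearMap.comp_apply, LinearMap.sum_apply, map_sum]
    refine Eq.trans (Finset.sum_congr rfl fun g _ => ?_) (hs m)
    exact (hwm g⁻¹ _).trans (by rw [inv_inv])
  refine ⟨fun x y => ?_⟩
  rw [← Hmap_id_apply (hw.comp hu) rfl hwu (j+1) x, ← Hmap_id_apply (hw.comp hu) rfl hwu (j+1) y,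
    ← Hmap_comp_apply hw hu, ← Hmap_comp_apply hw hu, Subsingleton.elim (Hmap hu (j+1) x) (Hmap hu (j+1) y)]

end acyclic

section cover
variable {G G' G'' M M' M'' : Type} [AddCommGroup M] [Module k M]
  [AddCommGroup M'] [Module k M'] [AddCommGroup M''] [Module k M'']

theorem SES.δ_inj {G A B C : Type} [Group G] [AddCommGroup A] [Module k A]
    [AddCommGroup B] [Module k B] [AddCommGroup C] [Module k C]
    {a : Representation k G A} {b : Representation k G B} {c : Representation k G C}
    {f : A →ₗ[k] B} {g : B →ₗ[k] C} (S : SES a b c f g) (j : ℕ)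
    (h : Subsingleton (H (j + 1) b)) : Function.Injective (S.δ j) := by
  rw [← LinearMap.ker_eq_bot, LinearMap.ker_eq_bot']
  intro x hx
  obtain ⟨y, rfl⟩ := (S.exact₃ j x).1 hx
  rw [Subsingleton.elim y 0, map_zero]

theorem SES.δ_surj {G A B C : Type} [Group G] [AddCommGroup A] [Module k A]
    [AddCommGroup B] [Module k B] [AddCommGroup C] [Module k C]
    {a : Representation k G A} {b : Representation k G B} {c : Representation k G C}
    {f : A →ₗ[k] B} {g : B →ₗ[k] C} (S : SES a b c f g) (j : ℕ)
    (h : Subsingleton (H j b)) : Function.Surjective (S.δ j) := by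
  intro x
  exact (S.exact₁ j x).1 (Subsingleton.elim _ _)

/-- push-forward of finitely supported functions along a pair -/
noncomputable def Pmap (φ : G → G') (f : M →ₗ[k] M') : (G →₀ M) →ₗ[k] (G' →₀ M') :=
  Finsupp.lmapDomain M' k φ ∘ₗ Finsupp.mapRange.linearMap f

@[simp] theorem Pmap_single (φ : G → G') (f : M →ₗ[k] M') (g : G) (m : M) :
    Pmap φ f (Finsupp.single g m) = Finsupp.single (φ g) (f m) := by
  simp [Pmap]

theorem Pmap_comp (φ : G → G') (f : M →ₗ[k] M') (φ' : G' → G'') (f' : M' →ₗ[k] M'') :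
    Pmap φ' f' ∘ₗ Pmap φ f = Pmap (φ' ∘ φ) (f' ∘ₗ f) := by
  ext; simp

theorem Pmap_comp_apply (φ : G → G') (f : M →ₗ[k] M') (φ' : G' → G'') (f' : M' →ₗ[k] M'') (x) :
    Pmap φ' f' (Pmap φ f x) = Pmap (φ' ∘ φ) (f' ∘ₗ f) x := by
  rw [← Pmap_comp]; rfl

/-- augmentation -/
noncomputable def aug (k : Type) [Field k] (G M : Type) [AddCommGroup M] [Module k M] :
    (G →₀ M) →ₗ[k] M :=
  Finsupp.lsum k fun _ => LinearMap.id

@[simp] theorem aug_single (g : G) (m : M) : aug k G M (Finsupp.single g m) = m := by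
  simp [aug]

theorem aug_Pmap (φ : G → G') (f : M →ₗ[k] M') (x) :
    aug k G' M' (Pmap φ f x) = f (aug k G M x) := by
  have : aug k G' M' ∘ₗ Pmap φ f = f ∘ₗ aug k G M := by ext; simp
  exact congrArg (fun t => t x) this

/-- kernel of the augmentation -/
abbrev AK (k : Type) [Field k] (G M : Type) [AddCommGroup M] [Module k M] : Type :=
  LinearMap.ker (aug k G M)

/-- induced map on kernels -/
noncomputable def Kmap (φ : G → G') (f : M →ₗ[k] M') : AK k G M →ₗ[k] AK k G' M' :=
  (Pmap φ f).restrict (fun x hx => by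
    rw [LinearMap.mem_ker] at hx ⊢
    rw [aug_Pmap, hx, map_zero])

@[simp] theorem Kmap_coe (φ : G → G') (f : M →ₗ[k] M') (x : AK k G M) :
    (Kmap φ f x : G' →₀ M') = Pmap φ f x := rfl

theorem Kmap_comp_apply (φ : G → G') (f : M →ₗ[k] M') (φ' : G' → G'') (f' : M' →ₗ[k] M'') (x) :
    Kmap φ' f' (Kmap φ f x) = Kmap (φ' ∘ φ) (f' ∘ₗ f) x :=
  Subtype.ext (Pmap_comp_apply _ _ _ _ _)

theorem Pmap_id : Pmap (k := k) (id : G → G) (LinearMap.id : M →ₗ[k] M) = LinearMap.id := by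
  ext; simp

/-- an action by functions -/
structure Act (Q G : Type) [Monoid Q] where
  f : Q → G → G
  one : f 1 = id
  mul : ∀ x y, f (x * y) = f x ∘ f y

variable [Group G] [Group G'] [Group G'']

/-- a monoid acting on `G` by endomorphisms and on `M` acts on `G →₀ M`; general version:
a family of pairs -/
noncomputable def Prep {Q : Type} [Monoid Q] (a : Act Q G) (q : Representation k Q M) :
    Representation k Q (G →₀ M) where
  toFun x := Pmap (a.f x) (q x)
  map_one' := by rw [a.one, map_one]; exact Pmap_id
  map_mul' x y := by rw [a.mul, map_mul]; exact (Pmap_comp _ _ _ _).symm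

noncomputable def Krep {Q : Type} [Monoid Q] (a : Act Q G) (q : Representation k Q M) :
    Representation k Q (AK k G M) where
  toFun x := Kmap (a.f x) (q x)
  map_one' := by
    ext1 x; apply Subtype.ext; rw [Kmap_coe, a.one, map_one]
    exact congrArg (fun t : (G →₀ M) →ₗ[k] (G →₀ M) => t x.1) Pmap_id
  map_mul' x y := by
    ext1 t; rw [a.mul, map_mul]; exact (Kmap_comp_apply _ _ _ _ _).symm

theorem Prep_apply {Q : Type} [Monoid Q] (a : Act Q G) (q : Representation k Q M) (x) :
    Prep a q x = Pmap (a.f x) (q x) := rfl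
theorem Krep_apply {Q : Type} [Monoid Q] (a : Act Q G) (q : Representation k Q M) (x) :
    Krep a q x = Kmap (a.f x) (q x) := rfl

/-- left multiplication -/
def lm (G : Type) [Group G] : Act G G := ⟨fun g x => g * x, funext one_mul, fun x y => funext (mul_assoc x y)⟩

theorem lm_apply (g x : G) : (lm G).f g x = g * x := rfl

theorem covSES {N : Type} [Group N] (ρ : Representation k N M) (a : Act N G) :
    SES (Krep a ρ) (Prep a ρ) ρ (LinearMap.ker (aug k G M)).subtype (aug k G M) where
  hf := fun g m => rfl
  hg := fun g m => aug_Pmap _ _ _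
  inj := Subtype.val_injective
  surj := fun m => ⟨Finsupp.single 1 m, aug_single _ _⟩
  exact := fun x => by
    rw [Submodule.coe_subtype, Subtype.range_coe]; exact LinearMap.mem_ker.symm

/-- compatibility of the cover -/
theorem Kmap_compat {Q Q' : Type} [Group Q] [Group Q'] {a : Act Q G}
    {a' : Act Q' G'}
    {q : Representation k Q M} {q' : Representation k Q' M'} {φ : Q →* Q'} {f : M →ₗ[k] M'}
    (h : Compat q q' φ f) (ψ : G → G') (hψ : ∀ x g, ψ (a.f x g) = a'.f (φ x) (ψ g)) :
    Compat (Krep a q) (Krep a' q') φ (Kmap ψ f) := by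
  intro g m
  rw [Krep_apply, Krep_apply, Kmap_comp_apply, Kmap_comp_apply]
  congr 2
  · funext x; exact hψ g x
  · ext x; exact h g x

theorem Pmap_compat {Q Q' : Type} [Group Q] [Group Q'] {a : Act Q G}
    {a' : Act Q' G'}
    {q : Representation k Q M} {q' : Representation k Q' M'} {φ : Q →* Q'} {f : M →ₗ[k] M'}
    (h : Compat q q' φ f) (ψ : G → G') (hψ : ∀ x g, ψ (a.f x g) = a'.f (φ x) (ψ g)) :
    Compat (Prep a q) (Prep a' q') φ (Pmap ψ f) := by
  intro g m
  rw [Prep_apply, Prep_apply, Pmap_comp_apply, Pmap_comp_apply]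
  congr 2
  · funext x; exact hψ g x
  · ext x; exact h g x

theorem cov_δ_nat {Q Q' : Type} [Group Q] [Group Q'] {a : Act Q G}
    {a' : Act Q' G'}
    {q : Representation k Q M} {q' : Representation k Q' M'} {φ : Q →* Q'} {f : M →ₗ[k] M'}
    (h : Compat q q' φ f) (ψ : G → G') (hψ : ∀ x g, ψ (a.f x g) = a'.f (φ x) (ψ g)) (j : ℕ)
    (x : H (j + 1) q) :
    (covSES q' a').δ j (Hmap h (j + 1) x) = Hmap (Kmap_compat h ψ hψ) j ((covSES q a).δ j x) :=
  SES.δ_nat (covSES q a) (covSES q' a') (Kmap_compat h ψ hψ) (Pmap_compat h ψ hψ) h rfl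
    (by ext; simp) j x

open Classical in
/-- acyclicity of covers: the subgroup `N` acts on `G` with transversal `T` -/
theorem cov_acyclic {N : Type} [Group N] [Finite N] (ρ : Representation k N M)
    (a : Act N G) (T : Set G) (hT : ∀ x, ∃! n : N, a.f n⁻¹ x ∈ T) (j : ℕ) :
    Subsingleton (H (j + 1) (Prep a ρ)) := by
  have := Fintype.ofFinite N
  let s : (G →₀ M) →ₗ[k] (G →₀ M) := Finsupp.lsum k fun x =>
    if x ∈ T then Finsupp.lsingle x else 0
  refine acyclic_of_section _ s ?_ j
  have hs : ∀ x m, s (Finsupp.single x m) = if x ∈ T then Finsupp.single x m else 0 := by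
    intro x m
    simp only [s, Finsupp.lsum_single]
    split_ifs <;> simp
  intro m
  induction m using Finsupp.induction_linear with
  | zero => simp
  | add f g hf hg => simp only [map_add, Finset.sum_add_distrib, hf, hg]
  | single x m =>
    obtain ⟨n, hn, hu⟩ := hT x
    rw [Finset.sum_eq_single n]
    · rw [Prep_apply, Prep_apply, Pmap_single, hs, if_pos hn, Pmap_single,
        ← Module.End.mul_apply, ← map_mul, mul_inv_cancel, map_one]
      have : a.f n (a.f n⁻¹ x) = x := by
        change (a.f n ∘ a.f n⁻¹) x = x
        rw [← a.mul, mul_inv_cancel, a.one]; rfl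
      rw [this]; rfl
    · intro b _ hb
      rw [Prep_apply, Prep_apply, Pmap_single, hs, if_neg (fun h => hb (hu b h)), map_zero]
    · simp

theorem cov_acyclic' [Finite G] (ρ : Representation k G M) (j : ℕ) :
    Subsingleton (H (j + 1) (Prep (lm G) ρ)) := by
  refine cov_acyclic ρ (lm G) {1} (fun x => ⟨x, ?_, ?_⟩) j
  · simp [lm_apply]
  · intro y hy
    simp only [lm_apply, Set.mem_singleton_iff] at hy
    exact (inv_mul_eq_one.1 hy)

end cover
end GH

end

/-! ## Part B -/

section
set_option linter.unusedSectionVars false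

namespace GH
variable {k : Type} [Field k]
section conj
variable {G G' M M' : Type} [Group G] [Group G'] [AddCommGroup M] [Module k M]
  [AddCommGroup M'] [Module k M']

theorem Hmap_conj [Finite G] (g : G) (j : ℕ) : ∀ {M : Type} [AddCommGroup M] [Module k M]
    {ρ : Representation k G M} {φ : G →* G} {f : M →ₗ[k] M} (h : Compat ρ ρ φ f)
    (_ : ∀ x, φ x = g * x * g⁻¹) (_ : f = ρ g) (x : H j ρ), Hmap h j x = x := by
  induction j with
  | zero =>
    rintro M _ _ ρ φ _ h hφ rfl x
    obtain ⟨m, rfl⟩ := h0_surj _ x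
    rw [Hmap_h0, h0_rho]
  | succ j ih =>
    rintro M _ _ ρ φ _ h hφ rfl x
    apply (covSES ρ (lm G)).δ_inj j (cov_acyclic' ρ j)
    rw [cov_δ_nat (a := lm G) (a' := lm G) h (fun x => g * x)
      (by intro x y; simp [lm_apply, hφ, mul_assoc])]
    exact ih _ hφ rfl _

theorem H_central [Finite G] (h2 : (2 : k) ≠ 0) (ρ : Representation k G M) (z : G)
    (hz : ∀ g, z * g = g * z) (hρ : ∀ m, ρ z m = -m) (j : ℕ) : Subsingleton (H j ρ) := by
  have h : Compat ρ ρ (MonoidHom.id G) (ρ z) := fun g m => by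
    simp [← Module.End.mul_apply, ← map_mul, hz]
  have key : ∀ x : H j ρ, x = 0 := by
    intro x
    have h1 := Hmap_conj z j h (fun x => by simp [hz]) rfl x
    have h3 : Compat ρ ρ (MonoidHom.id G) ((-1 : k) • LinearMap.id) := fun g m => by simp
    have h4 : Hmap h j = Hmap h3 j := Hmap_congr _ _ rfl (by ext m; simp [hρ]) j
    rw [h4, Hmap_smul (-1) Compat.id h3, Hmap_id'] at h1
    have : (2 : k) • x = 0 := by
      rw [two_smul]; nth_rewrite 1 [← h1]; simp
    exact (smul_eq_zero.1 this).resolve_left h2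
  exact ⟨fun x y => (key x).trans (key y).symm⟩

theorem Hmap_triv {ρ : Representation k G M} {ρ' : Representation k G' M'} {φ : G →* G'}
    {f : M →ₗ[k] M'} (h : Compat ρ ρ' φ f) (hφ : ∀ g, φ g = 1) (j : ℕ) (x) :
    Hmap h (j + 1) x = 0 := by
  let τ : Representation k Unit M' := 1
  have h1 : Compat ρ τ (1 : G →* Unit) f := fun g m => by
    rw [h, hφ]; simp [τ]
  have h2 : Compat τ ρ' (1 : Unit →* G') LinearMap.id := fun g m => by simp [τ]
  have : Hmap h (j + 1) = Hmap (h2.comp h1) (j + 1) :=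
    Hmap_congr _ _ (by ext g; simp [hφ]) (by ext; rfl) _
  have hs := H_succ_of_subsingleton τ j
  rw [this, ← Hmap_comp_apply h2 h1, Subsingleton.elim (Hmap h1 (j + 1) x) 0, map_zero]

theorem corCompat (f : G' →* G) (ρ : Representation k G M) :
    Compat (ρ.comp f) ρ f LinearMap.id := fun _ _ => rfl

/-- action restricted along a hom -/
def Act.comp {Q Q' X : Type} [Monoid Q] [Monoid Q'] (a : Act Q X) (f : Q' →* Q) : Act Q' X :=
  ⟨fun q => a.f (f q), by rw [map_one, a.one], fun x y => by rw [map_mul, a.mul]⟩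

theorem cov_acyclic_res [Finite G] (f : G' →* G) (hf : Function.Injective f)
    (ρ : Representation k G' M) (j : ℕ) :
    Subsingleton (H (j + 1) (Prep ((lm G).comp f) ρ)) := by
  have : Finite G' := Finite.of_injective f hf
  refine cov_acyclic ρ _ {x | x⁻¹ = Quotient.out (QuotientGroup.mk x⁻¹ : G ⧸ f.range)} ?_ j
  intro x
  have hm : ∀ n, (QuotientGroup.mk (x⁻¹ * f n) : G ⧸ f.range) = QuotientGroup.mk x⁻¹ := fun n =>
    QuotientGroup.eq.2 (by simp)
  have h1 : ∀ n, ((lm G).comp f).f n⁻¹ x ∈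
      {x | x⁻¹ = Quotient.out (QuotientGroup.mk x⁻¹ : G ⧸ f.range)} ↔
      x⁻¹ * f n = Quotient.out (QuotientGroup.mk x⁻¹ : G ⧸ f.range) := by
    intro n
    simp only [Act.comp, lm_apply, map_inv, Set.mem_ofPred_eq, mul_inv_rev, inv_inv, hm]
  obtain ⟨n, hn⟩ : ∃ n, x⁻¹ * f n = Quotient.out (QuotientGroup.mk x⁻¹ : G ⧸ f.range) := by
    obtain ⟨⟨_, n, rfl⟩, h⟩ := QuotientGroup.mk_out_eq_mul f.range x⁻¹
    exact ⟨n, h.symm⟩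
  refine ⟨n, (h1 n).2 hn, fun y hy => hf ?_⟩
  exact mul_left_cancel (((h1 y).1 hy).trans hn.symm)

/-- existence of the transfer -/
theorem exists_transfer [Finite G] (f : G' →* G) (hf : Function.Injective f) (j : ℕ) :
    ∃ tr : ∀ (M : Type) [AddCommGroup M] [Module k M] (ρ : Representation k G M),
      H j ρ → H j (ρ.comp f),
      (∀ (M M' : Type) [AddCommGroup M] [Module k M] [AddCommGroup M'] [Module k M']
        (ρ : Representation k G M) (ρ' : Representation k G M') (u : M →ₗ[k] M')
        (h : Compat ρ ρ' (MonoidHom.id G) u)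
        (h' : Compat (ρ.comp f) (ρ'.comp f) (MonoidHom.id G') u) (x : H j ρ),
        tr M' ρ' (Hmap h j x) = Hmap h' j (tr M ρ x)) ∧
      (∀ (M : Type) [AddCommGroup M] [Module k M] (ρ : Representation k G M) (x : H j ρ),
        Hmap (corCompat f ρ) j (tr M ρ x) = (f.range.index : k) • x) := by
  classical
  have := Fintype.ofFinite G
  induction j with
  | zero =>
    let t : ∀ (M : Type) [AddCommGroup M] [Module k M] (ρ : Representation k G M),
      M →ₗ[k] H 0 (ρ.comp f) := fun M _ _ ρ =>
        h0 (ρ.comp f) ∘ₗ ∑ c : G ⧸ f.range, ρ (Quotient.out c)⁻¹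
    have key : ∀ (M : Type) [AddCommGroup M] [Module k M] (ρ : Representation k G M) (g : G) (m : M),
        h0 (ρ.comp f) (ρ (Quotient.out (g : G ⧸ f.range))⁻¹ m) = h0 (ρ.comp f) (ρ g⁻¹ m) := by
      intro M _ _ ρ g m
      obtain ⟨⟨_, n, rfl⟩, h⟩ := QuotientGroup.mk_out_eq_mul f.range g
      rw [h]
      have : ρ (g * f n)⁻¹ m = (ρ.comp f) n⁻¹ (ρ g⁻¹ m) := by
        simp [← Module.End.mul_apply, ← map_mul]
      rw [this, h0_rho]
    have ht : ∀ (M : Type) [AddCommGroup M] [Module k M] (ρ : Representation k G M) (g m),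
        t M ρ (ρ g m) = t M ρ m := by
      intro M _ _ ρ g m
      simp only [t, LinearMap.comp_apply, LinearMap.sum_apply, map_sum]
      rw [← Equiv.sum_comp (MulAction.toPerm g : Equiv.Perm (G ⧸ f.range))]
      refine Finset.sum_congr rfl fun c _ => ?_
      obtain ⟨y, rfl⟩ := QuotientGroup.mk_surjective c
      rw [key]
      have : (MulAction.toPerm g : Equiv.Perm (G ⧸ f.range)) (y : G ⧸ f.range) =
        ((g * y : G) : G ⧸ f.range) := rfl
      rw [this, key]
      simp [← Module.End.mul_apply, ← map_mul]
    choose tr htr using fun (M : Type) (_ : AddCommGroup M) (_ : Module k M)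
      (ρ : Representation k G M) => h0_lift ρ (t M ρ) (ht M ρ)
    refine ⟨fun M _ _ ρ => tr M _ _ ρ, ?_, ?_⟩
    · intro M M' _ _ _ _ ρ ρ' u h h' x
      obtain ⟨m, rfl⟩ := h0_surj _ x
      beta_reduce
      rw [Hmap_h0, htr, htr]
      simp only [t, LinearMap.comp_apply, Hmap_h0]
      congr 1
      simp only [LinearMap.sum_apply, map_sum]
      exact Finset.sum_congr rfl fun c _ => (h _ _).symm
    · intro M _ _ ρ x
      obtain ⟨m, rfl⟩ := h0_surj _ x
      beta_reduce
      rw [htr]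
      simp only [t, LinearMap.comp_apply, Hmap_h0, LinearMap.id_apply]
      simp only [LinearMap.sum_apply, map_sum, h0_rho, Finset.sum_const, Finset.card_univ]
      rw [Subgroup.index, Nat.card_eq_fintype_card, Nat.cast_smul_eq_nsmul]
  | succ j ih =>
    obtain ⟨tr, h1, h2⟩ := ih
    have tr0 : ∀ (M : Type) [AddCommGroup M] [Module k M] (ρ : Representation k G M),
        tr M ρ 0 = 0 := by
      intro M _ _ ρ
      have z1 : Compat ρ ρ (MonoidHom.id G) 0 := fun _ _ => by simp
      have z2 : Compat (ρ.comp f) (ρ.comp f) (MonoidHom.id G') 0 := fun _ _ => by simp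
      have := h1 M M ρ ρ 0 z1 z2 0
      rw [map_zero, Hmap_zero] at this
      exact this
    have ex : ∀ (M : Type) [AddCommGroup M] [Module k M] (ρ : Representation k G M)
        (x : H (j + 1) ρ), ∃ y : H (j + 1) (ρ.comp f),
        (covSES (ρ.comp f) ((lm G).comp f)).δ j y = tr _ (Krep (lm G) ρ) ((covSES ρ (lm G)).δ j x) := by
      intro M _ _ ρ x
      refine ((covSES (ρ.comp f) ((lm G).comp f)).exact₁ j _).1 ?_
      refine (h1 _ _ (Krep (lm G) ρ) (Prep (lm G) ρ) _ (covSES ρ (lm G)).hf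
        (covSES (ρ.comp f) ((lm G).comp f)).hf _).symm.trans ?_
      rw [((covSES ρ (lm G)).exact₁ j).apply_apply_eq_zero, tr0]
      rfl
    choose tr' htr' using fun (M : Type) (_ : AddCommGroup M) (_ : Module k M)
      (ρ : Representation k G M) => ex M ρ
    refine ⟨fun M _ _ ρ => tr' M _ _ ρ, ?_, ?_⟩
    · intro M M' _ _ _ _ ρ ρ' u h h' x
      apply (covSES (ρ'.comp f) ((lm G).comp f)).δ_inj j (cov_acyclic_res f hf _ j)
      rw [htr', cov_δ_nat (a := lm G) (a' := lm G) h id (by intro x y; rfl),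
        cov_δ_nat (a := (lm G).comp f) (a' := (lm G).comp f) h' id (by intro x y; rfl), htr']
      exact h1 _ _ _ _ _ _ _ _
    · intro M _ _ ρ x
      apply (covSES ρ (lm G)).δ_inj j (cov_acyclic' _ j)
      rw [cov_δ_nat (a := (lm G).comp f) (a' := lm G) (corCompat f ρ) id (by intro x y; rfl), htr', map_smul, ← h2]
      refine congrArg (fun t : _ →ₗ[k] _ => t _) (Hmap_congr _ _ rfl ?_ j)
      ext x : 1
      exact Subtype.ext (congrArg (fun t : (G →₀ M) →ₗ[k] (G →₀ M) => t x.1) Pmap_id)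

theorem cor_surj [Finite G] (f : G' →* G) (hf : Function.Injective f)
    (hi : (f.range.index : k) ≠ 0) (ρ : Representation k G M) (j : ℕ) :
    Function.Surjective (Hmap (corCompat f ρ) j) := by
  obtain ⟨tr, -, h⟩ := exists_transfer (k := k) f hf j
  intro x
  refine ⟨(f.range.index : k)⁻¹ • tr M ρ x, ?_⟩
  rw [map_smul, h, smul_smul, inv_mul_cancel₀ hi, one_smul]
end conj
end GH

end

/-! ## Part C -/

section
set_option linter.unusedSectionVars false

namespace GH
variable {k : Type} [Field k]

/-- a monoid acting on a group by endomorphisms -/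
structure GAct (Q N : Type) [Monoid Q] [Group N] where
  f : Q → N →* N
  one : f 1 = MonoidHom.id N
  mul : ∀ x y, f (x * y) = (f x).comp (f y)

/-- underlying action on the set -/
def GAct.act {Q N : Type} [Monoid Q] [Group N] (a : GAct Q N) : Act Q N :=
  ⟨fun q => a.f q, by rw [a.one]; rfl, fun x y => by rw [a.mul]; rfl⟩

/-- restriction along a monoid hom -/
def GAct.comp {Q Q' N : Type} [Monoid Q] [Monoid Q'] [Group N] (a : GAct Q N) (f : Q' →* Q) :
    GAct Q' N :=
  ⟨fun q => a.f (f q), by rw [map_one, a.one], fun x y => by rw [map_mul, a.mul]⟩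

/-- a representation of `N` with a compatible action of `Q` -/
structure CRep (k : Type) [Field k] {Q N : Type} [Monoid Q] [Group N] (α : GAct Q N)
    (M : Type) [AddCommGroup M] [Module k M] where
  n : Representation k N M
  q : Representation k Q M
  comm : ∀ x, Compat n n (α.f x) (q x)

section
variable {Q N M : Type} [Monoid Q] [Group N] {α : GAct Q N} [AddCommGroup M] [Module k M]

/-- the action on homology -/
noncomputable def D (c : CRep k α M) (j : ℕ) : Representation k Q (H j c.n) where
  toFun x := Hmap (c.comm x) j
  map_one' := by
    ext x
    exact Hmap_id_apply _ α.one (map_one c.q) j x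
  map_mul' x y := by
    ext z
    refine Eq.trans ?_ (Hmap_comp_apply (c.comm x) (c.comm y) j z).symm
    exact congrArg (fun t : _ →ₗ[k] _ => t z) (Hmap_congr _ _ (α.mul x y) (map_mul c.q x y) j)

theorem D_apply (c : CRep k α M) (j : ℕ) (x : Q) : D c j x = Hmap (c.comm x) j := rfl

theorem D_h0 (c : CRep k α M) (x : Q) (m : M) : D c 0 x (h0 c.n m) = h0 c.n (c.q x m) :=
  Hmap_h0 _ _

theorem Hmap_sq {G1 G2 G3 G4 M1 M2 M3 M4 : Type} [Group G1] [Group G2] [Group G3] [Group G4]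
    [AddCommGroup M1] [Module k M1] [AddCommGroup M2] [Module k M2]
    [AddCommGroup M3] [Module k M3] [AddCommGroup M4] [Module k M4]
    {ρ1 : Representation k G1 M1} {ρ2 : Representation k G2 M2}
    {ρ3 : Representation k G3 M3} {ρ4 : Representation k G4 M4}
    {φ12 : G1 →* G2} {φ24 : G2 →* G4} {φ13 : G1 →* G3} {φ34 : G3 →* G4}
    {f12 : M1 →ₗ[k] M2} {f24 : M2 →ₗ[k] M4} {f13 : M1 →ₗ[k] M3} {f34 : M3 →ₗ[k] M4}
    (h24 : Compat ρ2 ρ4 φ24 f24) (h12 : Compat ρ1 ρ2 φ12 f12)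
    (h34 : Compat ρ3 ρ4 φ34 f34) (h13 : Compat ρ1 ρ3 φ13 f13)
    (e : φ24.comp φ12 = φ34.comp φ13) (e' : f24 ∘ₗ f12 = f34 ∘ₗ f13) (j : ℕ) (x : H j ρ1) :
    Hmap h24 j (Hmap h12 j x) = Hmap h34 j (Hmap h13 j x) := by
  rw [Hmap_comp_apply, Hmap_comp_apply]
  exact congrArg (fun t : _ →ₗ[k] _ => t x) (Hmap_congr _ _ e e' j)

theorem Hmap_surj_of_bij {G M M' : Type} [Group G] [AddCommGroup M] [Module k M]
    [AddCommGroup M'] [Module k M'] {ρ : Representation k G M} {ρ' : Representation k G M'}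
    {f : M →ₗ[k] M'} (h : Compat ρ ρ' (MonoidHom.id G) f) (hf : Function.Bijective f) (j : ℕ) :
    Function.Surjective (Hmap h j) := by
  let E := LinearEquiv.ofBijective f hf
  have h' : Compat ρ' ρ (MonoidHom.id G) E.symm.toLinearMap := by
    intro g m
    obtain ⟨m, rfl⟩ := hf.2 m
    have e1 : ∀ m, E.symm (f m) = m := fun m => E.symm_apply_apply m
    simp only [LinearEquiv.coe_coe]
    have := h g m
    simp only [MonoidHom.id_apply] at this ⊢
    rw [← this, e1, e1]
  intro x
  refine ⟨Hmap h' j x, ?_⟩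
  rw [Hmap_comp_apply]
  refine Hmap_id_apply _ rfl ?_ j x
  ext m
  exact E.apply_symm_apply m

/-- `e` acts by zero -/
def Kills (e : MonoidAlgebra k Q) (ρ : Representation k Q M) : Prop :=
  ∀ m, ρ.asAlgebraHom e m = 0

theorem act_equiv {M' : Type} [AddCommGroup M'] [Module k M'] {ρ : Representation k Q M}
    {ρ' : Representation k Q M'} (f : M →ₗ[k] M') (h : ∀ q m, f (ρ q m) = ρ' q (f m))
    (e : MonoidAlgebra k Q) (m : M) :
    f (ρ.asAlgebraHom e m) = ρ'.asAlgebraHom e (f m) := by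
  induction e using MonoidAlgebra.induction_on with
  | of g => simp [h]
  | add a b ha hb => simp [ha, hb]
  | smul r a ha => simp [ha]

theorem act_idem {e : MonoidAlgebra k Q} (he : e * e = e) (ρ : Representation k Q M) (m : M) :
    ρ.asAlgebraHom e (ρ.asAlgebraHom e m) = ρ.asAlgebraHom e m := by
  rw [← Module.End.mul_apply, ← map_mul, he]

theorem Kills.of_surj {M' : Type} [AddCommGroup M'] [Module k M'] {ρ : Representation k Q M}
    {ρ' : Representation k Q M'} {e : MonoidAlgebra k Q} (K : Kills e ρ) (f : M →ₗ[k] M')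
    (h : ∀ q m, f (ρ q m) = ρ' q (f m)) (hf : Function.Surjective f) : Kills e ρ' := by
  intro m
  obtain ⟨m, rfl⟩ := hf m
  rw [← act_equiv f h, K, map_zero]

theorem Kills.of_inj {M' : Type} [AddCommGroup M'] [Module k M'] {ρ : Representation k Q M}
    {ρ' : Representation k Q M'} {e : MonoidAlgebra k Q} (K : Kills e ρ') (f : M →ₗ[k] M')
    (h : ∀ q m, f (ρ q m) = ρ' q (f m)) (hf : Function.Injective f) : Kills e ρ := by
  intro m
  apply hf
  rw [act_equiv f h, K, map_zero]

theorem Kills.of_exact {M' M'' : Type} [AddCommGroup M'] [Module k M']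
    [AddCommGroup M''] [Module k M''] {ρ : Representation k Q M}
    {ρ' : Representation k Q M'} {ρ'' : Representation k Q M''} {e : MonoidAlgebra k Q}
    (he : e * e = e) (K : Kills e ρ) (K'' : Kills e ρ'') (f : M →ₗ[k] M') (g : M' →ₗ[k] M'')
    (hf : ∀ q m, f (ρ q m) = ρ' q (f m)) (hg : ∀ q m, g (ρ' q m) = ρ'' q (g m))
    (hex : Function.Exact f g) : Kills e ρ' := by
  intro m
  have h1 : g (ρ'.asAlgebraHom e m) = 0 := by rw [act_equiv g hg, K'']
  obtain ⟨x, hx⟩ := (hex _).1 h1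
  rw [← act_idem he, ← hx, ← act_equiv f hf, K, map_zero]

end

section Ext
variable (Q N X N' : Type) [Monoid Q] [Group N] [Group X] [Group N']

/-- split extension of groups with operators -/
structure Ext where
  ι : N →* X
  π : X →* N'
  s : N' →* X
  c : GAct N' N
  aN : GAct Q N
  aX : GAct Q X
  aN' : GAct Q N'
  inj : Function.Injective ι
  πι : ∀ x, π (ι x) = 1
  πs : ∀ x, π (s x) = x
  ker : ∀ x, π x = 1 → ∃ y, ι y = x
  hc : ∀ y x, ι (c.f y x) = s y * ι x * (s y)⁻¹
  eι : ∀ q x, aX.f q (ι x) = ι (aN.f q x)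
  es : ∀ q x, aX.f q (s x) = s (aN'.f q x)
  eπ : ∀ q x, π (aX.f q x) = aN'.f q (π x)

variable {Q N X N'} {M : Type} [AddCommGroup M] [Module k M]
variable (E : Ext Q N X N')

/-- restriction to `N` -/
def Ext.resQ (m : CRep k E.aX M) : CRep k E.aN M where
  n := m.n.comp E.ι
  q := m.q
  comm := fun x g v => by
    change m.q x (m.n (E.ι g) v) = m.n (E.ι (E.aN.f x g)) (m.q x v)
    rw [m.comm x, E.eι]

/-- restriction to `N` with action of `N'` -/
def Ext.resN (m : CRep k E.aX M) : CRep k E.c M where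
  n := m.n.comp E.ι
  q := m.n.comp E.s
  comm := fun x g v => by
    change m.n (E.s x) (m.n (E.ι g) v) = m.n (E.ι (E.c.f x g)) (m.n (E.s x) v)
    simp [E.hc, ← Module.End.mul_apply, ← map_mul]

/-- homology of `N` as a representation of `N'` with operators -/
noncomputable def Ext.EH (m : CRep k E.aX M) (j : ℕ) : CRep k E.aN' (H j (m.n.comp E.ι)) where
  n := D (E.resN m) j
  q := D (E.resQ m) j
  comm := fun x g v => by
    refine Hmap_sq ((E.resQ m).comm x) ((E.resN m).comm g) ((E.resN m).comm (E.aN'.f x g))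
      ((E.resQ m).comm x) ?_ ?_ j v
    · ext y
      apply E.inj
      simp only [MonoidHom.comp_apply]
      rw [← E.eι, E.hc, E.hc, map_mul, map_mul, map_inv, E.eι, E.es]
    · ext v
      change m.q x (m.n (E.s g) v) = m.n (E.s (E.aN'.f x g)) (m.q x v)
      rw [m.comm x, E.es]

theorem Ext.edgeCompat (m : CRep k E.aX M) : Compat m.n (E.EH m 0).n E.π (h0 (m.n.comp E.ι)) := by
  intro g v
  refine Eq.trans ?_ (D_h0 (E.resN m) (E.π g) v).symm
  change h0 (m.n.comp E.ι) _ = h0 (m.n.comp E.ι) (m.n (E.s (E.π g)) v)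
  obtain ⟨y, hy⟩ := E.ker (g * (E.s (E.π g))⁻¹) (by simp [E.πs])
  rw [← h0_rho y (m.n (E.s (E.π g)) v)]
  simp [hy, ← Module.End.mul_apply, ← map_mul]

/-- the edge map -/
noncomputable def Ext.edge (m : CRep k E.aX M) (a : ℕ) : H a m.n →ₗ[k] H a (E.EH m 0).n :=
  Hmap (E.edgeCompat m) a

theorem Ext.edge_equiv (m : CRep k E.aX M) (a : ℕ) (q : Q) (x) :
    E.edge m a (D m a q x) = D (E.EH m 0) a q (E.edge m a x) := by
  refine Hmap_sq (E.edgeCompat m) (m.comm q) ((E.EH m 0).comm q) (E.edgeCompat m) ?_ ?_ a x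
  · ext y; exact E.eπ q y
  · ext v; exact (D_h0 (E.resQ m) q v).symm

/-- the cover with operators -/
noncomputable def Ext.K (m : CRep k E.aX M) : CRep k E.aX (AK k X M) where
  n := Krep (lm X) m.n
  q := Krep E.aX.act m.q
  comm := fun x => Kmap_compat (m.comm x) (E.aX.f x) (fun a b => map_mul (E.aX.f x) a b)

noncomputable def Ext.P (m : CRep k E.aX M) : CRep k E.aX (X →₀ M) where
  n := Prep (lm X) m.n
  q := Prep E.aX.act m.q
  comm := fun x => Pmap_compat (m.comm x) (E.aX.f x) (fun a b => map_mul (E.aX.f x) a b)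

/-- SES over X -/
theorem Ext.sX (m : CRep k E.aX M) :
    SES (E.K m).n (E.P m).n m.n (LinearMap.ker (aug k X M)).subtype (aug k X M) :=
  covSES m.n (lm X)

theorem Ext.sN (m : CRep k E.aX M) :
    SES ((E.K m).n.comp E.ι) ((E.P m).n.comp E.ι) (m.n.comp E.ι)
      (LinearMap.ker (aug k X M)).subtype (aug k X M) :=
  covSES (m.n.comp E.ι) ((lm X).comp E.ι)

theorem Ext.acyc [Finite X] (m : CRep k E.aX M) (j : ℕ) :
    Subsingleton (H (j + 1) ((E.P m).n.comp E.ι)) :=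
  cov_acyclic_res E.ι E.inj (m.n.comp E.ι) j

/-- the connecting map for `N` is equivariant for `N'` -/
theorem Ext.δ_n (m : CRep k E.aX M) (j : ℕ) :
    Compat (E.EH m (j + 1)).n (E.EH (E.K m) j).n (MonoidHom.id N') ((E.sN m).δ j) := by
  intro g x
  exact SES.δ_nat (E.sN m) (E.sN m) ((E.resN (E.K m)).comm g) ((E.resN (E.P m)).comm g)
    ((E.resN m).comm g) rfl (by
      ext v; exact (aug_Pmap (k := k) (fun x => E.s g * x) (m.n (E.s g)) _).symm) j x

theorem Ext.δ_q (m : CRep k E.aX M) (j : ℕ) (q : Q) (x) :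
    (E.sN m).δ j ((E.EH m (j + 1)).q q x) = (E.EH (E.K m) j).q q ((E.sN m).δ j x) :=
  SES.δ_nat (E.sN m) (E.sN m) ((E.resQ (E.K m)).comm q) ((E.resQ (E.P m)).comm q)
    ((E.resQ m).comm q) rfl (by
      ext v; exact (aug_Pmap (k := k) (E.aX.f q) (m.q q) _).symm) j x

theorem Hmap_D {Q N M M' : Type} [Monoid Q] [Group N] {α : GAct Q N} [AddCommGroup M] [Module k M]
    [AddCommGroup M'] [Module k M'] (c : CRep k α M) (c' : CRep k α M') {f : M →ₗ[k] M'}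
    (h : Compat c.n c'.n (MonoidHom.id N) f) (hq : ∀ q m, f (c.q q m) = c'.q q (f m)) (j : ℕ)
    (q : Q) (x : H j c.n) : Hmap h j (D c j q x) = D c' j q (Hmap h j x) :=
  Hmap_sq h (c.comm q) (c'.comm q) h rfl (by ext m; exact hq q m) j x

theorem Ext.edge_inj0 (m : CRep k E.aX M) (x : H 0 m.n) (hx : E.edge m 0 x = 0) : x = 0 := by
  obtain ⟨v, rfl⟩ := h0_surj _ x
  obtain ⟨F, hF⟩ := h0_lift (m.n.comp E.ι) (h0 m.n) (fun g w => h0_rho (ρ := m.n) (E.ι g) w)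
  obtain ⟨F', hF'⟩ := h0_lift (E.EH m 0).n F (fun g w => by
    obtain ⟨w, rfl⟩ := h0_surj _ w
    have : (E.EH m 0).n g (h0 (m.n.comp E.ι) w) = h0 (m.n.comp E.ι) (m.n (E.s g) w) :=
      D_h0 (E.resN m) g w
    rw [this, hF, hF, h0_rho])
  rw [Ext.edge, Hmap_h0] at hx
  rw [← hF, ← hF', hx, map_zero]

/-- Edge injectivity -/
theorem Ext.edge_inj [Finite X] {e : MonoidAlgebra k Q} (he : e * e = e) (a : ℕ) :
    ∀ {M : Type} [AddCommGroup M] [Module k M] (m : CRep k E.aX M)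
      (_ : ∀ i j, i + j + 1 = a → Kills e (D (E.EH m (j + 1)) i))
      (x : H a m.n) (_ : E.edge m a x = 0), (D m a).asAlgebraHom e x = 0 := by
  induction a with
  | zero =>
    intro M _ _ m _ x hx
    rw [E.edge_inj0 m x hx, map_zero]
  | succ a ih =>
    intro M _ _ m hK x hx
    -- Z
    let p : H 0 ((E.P m).n.comp E.ι) →ₗ[k] H 0 (m.n.comp E.ι) := Hmap (E.sN m).hg 0
    have hp : Compat (E.EH (E.P m) 0).n (E.EH m 0).n (MonoidHom.id N') p := by
      intro g y
      refine Hmap_sq (E.sN m).hg ((E.resN (E.P m)).comm g) ((E.resN m).comm g) (E.sN m).hg rfl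
        ?_ 0 y
      refine LinearMap.ext fun v => ?_; exact aug_Pmap (k := k) (fun x => E.s g * x) (m.n (E.s g)) v
    let Z := LinearMap.ker p
    have hZ : ∀ g, ∀ y ∈ Z, (E.EH (E.P m) 0).n g y ∈ Z := by
      intro g y hy
      rw [LinearMap.mem_ker] at hy ⊢
      rw [hp, hy, map_zero]
    let zrep : Representation k N' Z :=
      { toFun := fun g => ((E.EH (E.P m) 0).n g).restrict (hZ g)
        map_one' := by ext y; simp [LinearMap.restrict_apply]
        map_mul' := fun a b => by
          ext y; simp [LinearMap.restrict_apply] }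
    have sZ : SES zrep (E.EH (E.P m) 0).n (E.EH m 0).n Z.subtype p :=
      { hf := fun g y => rfl
        hg := hp
        inj := Subtype.val_injective
        surj := Hmap_surj0 _ (E.sN m).surj
        exact := fun y => by
          rw [Submodule.coe_subtype, Subtype.range_coe]; exact LinearMap.mem_ker.symm }
    let i0 : H 0 ((E.K m).n.comp E.ι) →ₗ[k] H 0 ((E.P m).n.comp E.ι) := Hmap (E.sN m).hf 0
    have hex := (E.sN m).exact₂ 0
    let u : H 0 ((E.K m).n.comp E.ι) →ₗ[k] Z := i0.codRestrict Z
      (fun y => LinearMap.mem_ker.2 (hex.apply_apply_eq_zero y))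
    have hu : Compat (E.EH (E.K m) 0).n zrep (MonoidHom.id N') u := by
      intro g y
      apply Subtype.ext
      exact Hmap_sq (E.sN m).hf ((E.resN (E.K m)).comm g) ((E.resN (E.P m)).comm g) (E.sN m).hf rfl
        rfl 0 y
    have sB : SES (E.EH m 1).n (E.EH (E.K m) 0).n zrep ((E.sN m).δ 0) u :=
      { hf := E.δ_n m 0
        hg := hu
        inj := (E.sN m).δ_inj 0 (E.acyc m 0)
        surj := fun z => by
          obtain ⟨y, hy⟩ := (hex z.1).1 (LinearMap.mem_ker.1 z.2)
          exact ⟨y, Subtype.ext hy⟩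
        exact := fun y => by
          rw [← (E.sN m).exact₁ 0 y]
          constructor
          · intro h; exact congrArg Subtype.val h
          · intro h; exact Subtype.ext h }
    -- the class y
    set y := (E.sX m).δ a x with hy
    have h1 : Hmap hu a (E.edge (E.K m) a y) = 0 := by
      have hc : Compat (E.K m).n zrep E.π (u ∘ₗ h0 ((E.K m).n.comp E.ι)) :=
        hu.comp (E.edgeCompat (E.K m))
      have h2 := SES.δ_nat (E.sX m) sZ hc (E.edgeCompat (E.P m)) (E.edgeCompat m)
        (LinearMap.ext fun v => (Hmap_h0 (E.sN m).hf v).symm)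
        (LinearMap.ext fun v => (Hmap_h0 (E.sN m).hg v).symm) a x
      have h3 : Hmap (E.edgeCompat m) (a + 1) x = 0 := hx
      rw [h3, map_zero] at h2
      refine Eq.trans ?_ h2.symm
      exact Hmap_comp_apply hu (E.edgeCompat (E.K m)) a y
    obtain ⟨z, hz⟩ := (sB.exact₂ a _).1 h1
    have h4 : (D (E.EH (E.K m) 0) a).asAlgebraHom e (E.edge (E.K m) a y) = 0 := by
      rw [← hz, ← act_equiv (ρ := D (E.EH m 1) a) (ρ' := D (E.EH (E.K m) 0) a) (Hmap sB.hf a)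
        (Hmap_D (E.EH m 1) (E.EH (E.K m) 0) sB.hf (E.δ_q m 0) a) e z, hK a 0 rfl, map_zero]
    have h5 : E.edge (E.K m) a ((D (E.K m) a).asAlgebraHom e y) = 0 := by
      rw [act_equiv (ρ' := D (E.EH (E.K m) 0) a) _ (E.edge_equiv (E.K m) a), h4]
    have h6 := ih (E.K m) (fun i j hij => by
      have hb : Function.Bijective ((E.sN m).δ (j + 1)) :=
        ⟨(E.sN m).δ_inj _ (E.acyc m _), (E.sN m).δ_surj _ (E.acyc m _)⟩
      exact (hK i (j + 1) (by omega)).of_surj (Hmap (E.δ_n m (j + 1)) i)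
        (Hmap_D _ _ _ (E.δ_q m (j + 1)) i) (Hmap_surj_of_bij _ hb i)) _ h5
    rw [act_idem he] at h6
    apply (E.sX m).δ_inj a (cov_acyclic' _ a)
    rw [act_equiv (ρ' := D (E.K m) a) _ (fun q v => ?_), ← hy, h6, map_zero]
    exact cov_δ_nat (a := lm X) (a' := lm X) (m.comm q) (E.aX.f q)
      (fun a b => map_mul (E.aX.f q) a b) a v

theorem Ext.kills [Finite X] {e : MonoidAlgebra k Q} (he : e * e = e) (a : ℕ)
    (m : CRep k E.aX M) (hK : ∀ i j, i + j = a → Kills e (D (E.EH m j) i)) :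
    Kills e (D m a) := by
  intro x
  rw [← act_idem he]
  refine E.edge_inj he a m (fun i j h => hK i (j + 1) h) _ ?_
  rw [act_equiv (ρ' := D (E.EH m 0) a) _ (E.edge_equiv m a), hK a 0 rfl]

end Ext
end GH

end

/-! ## Part D -/

section
set_option linter.unusedSectionVars false

namespace GH
variable {k : Type} [Field k]

section Weights
variable {I : Type} [Fintype I] [DecidableEq I]

/-- signs as scalars -/
noncomputable def sc (k : Type) [Field k] : SignType →* k := (SignType.castHom : SignType →*₀ k)

@[simp] theorem sc_zero : sc k 0 = 0 := by simp [sc]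
@[simp] theorem sc_neg : sc k (-1) = -1 := by simp [sc]

/-- weight character -/
noncomputable def chi (k : Type) [Field k] (τ : I → ℕ) (o : I → SignType) : k :=
  ∏ i, sc k (o i) ^ τ i

/-- coordinate elements -/
noncomputable def SS (k : Type) [Field k] (i : I) (x : SignType) : MonoidAlgebra k (I → SignType) :=
  MonoidAlgebra.of k _ (Pi.mulSingle i x)

theorem SS_mul (i : I) (x y : SignType) : SS k i x * SS k i y = SS k i (x * y) := by
  rw [SS, SS, SS, ← map_mul, Pi.mulSingle_mul]

theorem SS_one (i : I) : SS k i 1 = 1 := by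
  rw [SS, Pi.mulSingle_one, map_one]

/-- coordinate idempotents -/
noncomputable def et (k : Type) [Field k] (i : I) : Fin 3 → MonoidAlgebra k (I → SignType) :=
  ![SS k i 0, (2 : k)⁻¹ • (1 - SS k i (-1)), (2 : k)⁻¹ • (1 + SS k i (-1)) - SS k i 0]

theorem SS_et (h2 : (2 : k) ≠ 0) (i : I) (x : SignType) (t : Fin 3) :
    SS k i x * et k i t = sc k x ^ (t : ℕ) • et k i t := by
  have a0 : SS k i 0 * SS k i 0 = SS k i 0 := by rw [SS_mul]; rfl
  have a1 : SS k i 0 * SS k i (-1) = SS k i 0 := by rw [SS_mul]; rfl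
  have a2 : SS k i (-1) * SS k i 0 = SS k i 0 := by rw [SS_mul]; rfl
  have a3 : SS k i (-1) * SS k i (-1) = 1 := by rw [SS_mul, ← SS_one (k := k) i]; rfl
  have hh : ∀ y : MonoidAlgebra k (I → SignType), (2 : k)⁻¹ • (y + y) = y := by
    intro y; rw [← two_smul k y, smul_smul, inv_mul_cancel₀ h2, one_smul]
  have e0 : SS k i SignType.zero = SS k i 0 := rfl
  have e1 : SS k i SignType.neg = SS k i (-1) := rfl
  have e2 : SS k i SignType.pos = 1 := SS_one i
  have f0 : sc k SignType.zero = 0 := sc_zero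
  have f1 : sc k SignType.neg = -1 := sc_neg
  have f2 : sc k SignType.pos = 1 := map_one _
  have hh' : ∀ y : MonoidAlgebra k (I → SignType), (2 : k)⁻¹ • y + (2 : k)⁻¹ • y = y := by
    intro y; rw [← smul_add, hh]
  fin_cases t <;> rcases x with _ | _ | _ <;>
    simp [et, SS_one, a0, a1, a2, a3, mul_add, mul_sub, smul_sub, hh', add_comm, ← sub_eq_add_neg]

theorem et_idem (h2 : (2 : k) ≠ 0) (i : I) (t : Fin 3) : et k i t * et k i t = et k i t := by
  have h0 := SS_et h2 i 0 t
  have h1 := SS_et h2 i (-1) t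
  have hh : ∀ y : MonoidAlgebra k (I → SignType), (2 : k)⁻¹ • (y + y) = y := by
    intro y; rw [← two_smul k y, smul_smul, inv_mul_cancel₀ h2, one_smul]
  have key : et k i t = (![SS k i 0, (2 : k)⁻¹ • (1 - SS k i (-1)),
    (2 : k)⁻¹ • (1 + SS k i (-1)) - SS k i 0] : Fin 3 → _) t := rfl
  conv_lhs => lhs; rw [key]
  fin_cases t
  · simpa using h0
  · simp only [Fin.mk_one, Matrix.cons_val_one, Matrix.cons_val_zero, smul_mul_assoc, sub_mul,
      one_mul] at h1 ⊢
    rw [h1]; simp [hh]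
  · simp only [Fin.reduceFinMk, Matrix.cons_val, smul_mul_assoc, sub_mul, add_mul, one_mul]
      at h0 h1 ⊢
    rw [h1, h0]; simp [hh]

/-- weight idempotents -/
noncomputable def idm (k : Type) [Field k] (τ : I → Fin 3) : MonoidAlgebra k (I → SignType) :=
  ∏ i, et k i (τ i)

theorem of_idm (h2 : (2 : k) ≠ 0) (τ : I → Fin 3) (o : I → SignType) :
    MonoidAlgebra.of k _ o * idm k τ = chi k (fun i => (τ i : ℕ)) o • idm k τ := by
  have h : MonoidAlgebra.of k _ o = ∏ i, SS k i (o i) := by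
    simp only [SS]
    rw [← map_prod, Finset.univ_prod_mulSingle]
  rw [h, idm, ← Finset.prod_mul_distrib, Finset.prod_congr rfl (fun i _ => SS_et h2 i (o i) (τ i)),
    chi, Finset.prod_smul]

theorem sum_et (i : I) (h2 : (2 : k) ≠ 0) : ∑ t, et k i t = 1 := by
  have hh : ∀ y : MonoidAlgebra k (I → SignType), (2 : k)⁻¹ • (y + y) = y := by
    intro y; rw [← two_smul k y, smul_smul, inv_mul_cancel₀ h2, one_smul]
  rw [Fin.sum_univ_three]
  simp only [et, Matrix.cons_val]
  have := hh 1
  rw [smul_add] at this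
  rw [smul_sub, smul_add]
  linear_combination (exp := 1) this

theorem sum_idm (h2 : (2 : k) ≠ 0) : ∑ τ : I → Fin 3, idm k τ = 1 := by
  have := Finset.prod_univ_sum (fun _ : I => (Finset.univ : Finset (Fin 3))) (fun i t => et k i t)
  simp only [sum_et _ h2, Finset.prod_const_one] at this
  rw [this, Fintype.piFinset_univ]
  rfl

/-- weight vectors -/
def IsW {M : Type} [AddCommGroup M] [Module k M] (τ : I → ℕ)
    (ρ : Representation k (I → SignType) M) (m : M) : Prop :=
  ∀ o, ρ o m = chi k τ o • m

/-- total of a reduced weight -/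
def tot (τ : I → Fin 3) : ℕ := ∑ i, (τ i : ℕ)

/-- reduce an exponent -/
def red (t : ℕ) : Fin 3 := if t = 0 then 0 else if t % 2 = 1 then 1 else 2

theorem red_le (t : ℕ) : (red t : ℕ) ≤ t := by
  unfold red; split_ifs <;> simp <;> omega

variable {M : Type} [AddCommGroup M] [Module k M] {ρ : Representation k (I → SignType) M}

theorem IsW.SS {σ : I → ℕ} {m : M} (h : IsW σ ρ m) (i : I) (x : SignType) :
    ρ.asAlgebraHom (SS k i x) m = sc k x ^ σ i • m := by
  rw [GH.SS, Representation.asAlgebraHom_of, h, chi, Finset.prod_eq_single i]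
  · simp
  · intro j _ hj; simp [Pi.mulSingle_eq_of_ne hj]
  · simp

theorem IsW.et (h2 : (2 : k) ≠ 0) {σ : I → ℕ} {m : M} (h : IsW σ ρ m) (i : I) (t : Fin 3)
    (ht : t ≠ red (σ i)) : ρ.asAlgebraHom (et k i t) m = 0 := by
  have h0 := h.SS i 0
  have h1 := h.SS i (-1)
  rw [sc_zero] at h0
  rw [sc_neg] at h1
  have hh : (2 : k)⁻¹ • (m + m) = m := by
    rw [← two_smul k m, smul_smul, inv_mul_cancel₀ h2, one_smul]
  rcases Nat.eq_zero_or_pos (σ i) with hs | hs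
  · rw [hs, pow_zero, one_smul] at h0 h1
    have : red (σ i) = 0 := by rw [hs]; rfl
    rw [this] at ht
    fin_cases t
    · exact absurd rfl ht
    · simp [GH.et, h1]
    · simp only [GH.et, Fin.reduceFinMk, Matrix.cons_val, map_sub, map_smul, map_add, map_one,
        LinearMap.sub_apply, LinearMap.smul_apply, LinearMap.add_apply, Module.End.one_apply, h0,
        h1, hh, sub_self]
  · rw [zero_pow hs.ne', zero_smul] at h0
    rcases Nat.even_or_odd (σ i) with hp | hp
    · rw [hp.neg_one_pow, one_smul] at h1
      have : red (σ i) = 2 := by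
        unfold red; rw [if_neg hs.ne', if_neg (by rw [Nat.even_iff.1 hp]; omega)]
      rw [this] at ht
      fin_cases t
      · simp [GH.et, h0]
      · simp [GH.et, h1]
      · exact absurd rfl ht
    · rw [hp.neg_one_pow] at h1
      have : red (σ i) = 1 := by
        unfold red; rw [if_neg hs.ne', if_pos (Nat.odd_iff.1 hp)]
      rw [this] at ht
      fin_cases t
      · simp [GH.et, h0]
      · exact absurd rfl ht
      · simp [GH.et, h0, h1]

theorem IsW.idm (h2 : (2 : k) ≠ 0) {σ : I → ℕ} {m : M} (h : IsW σ ρ m) (τ : I → Fin 3)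
    (ht : τ ≠ fun i => red (σ i)) : ρ.asAlgebraHom (idm k τ) m = 0 := by
  obtain ⟨i, hi⟩ := Function.ne_iff.1 ht
  rw [GH.idm, ← Finset.prod_erase_mul _ _ (Finset.mem_univ i), map_mul, Module.End.mul_apply,
    h.et h2 i _ hi, map_zero]

theorem sum_act (h2 : (2 : k) ≠ 0) (m : M) :
    ∑ τ : I → Fin 3, ρ.asAlgebraHom (idm k τ) m = m := by
  rw [← LinearMap.sum_apply, ← map_sum, sum_idm h2, map_one, Module.End.one_apply]

theorem IsW.idm_red (h2 : (2 : k) ≠ 0) {σ : I → ℕ} {m : M} (h : IsW σ ρ m) :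
    ρ.asAlgebraHom (GH.idm k (fun i => red (σ i))) m = m := by
  conv_rhs => rw [← sum_act (ρ := ρ) h2 m]
  rw [Finset.sum_eq_single (fun i => red (σ i))]
  · intro τ _ h'; exact h.idm h2 τ h'
  · simp

theorem isW_idm (h2 : (2 : k) ≠ 0) (τ : I → Fin 3) (m : M) :
    IsW (fun i => (τ i : ℕ)) ρ (ρ.asAlgebraHom (idm k τ) m) := by
  intro o
  rw [← Representation.asAlgebraHom_of, ← Module.End.mul_apply, ← map_mul, of_idm h2, map_smul,
    LinearMap.smul_apply]

theorem idm_idem (h2 : (2 : k) ≠ 0) (τ : I → Fin 3) : idm k τ * idm k τ = idm k τ := by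
  rw [idm, ← Finset.prod_mul_distrib, Finset.prod_congr rfl (fun i _ => et_idem h2 i (τ i))]

/-- weight at most `b` -/
def Wt (b : ℕ) (ρ : Representation k (I → SignType) M) : Prop :=
  ∀ τ : I → Fin 3, b < tot τ → Kills (idm k τ) ρ

theorem Wt.mono {b b' : ℕ} (h : Wt b ρ) (hb : b ≤ b') : Wt b' ρ :=
  fun τ ht => h τ (lt_of_le_of_lt hb ht)

theorem Wt.vec (h2 : (2 : k) ≠ 0) {b : ℕ} (h : Wt b ρ) (τ : I → Fin 3) (m : M)
    (hm : IsW (fun i => (τ i : ℕ)) ρ m) (hb : b < tot τ) : m = 0 := by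
  have h1 := hm.idm_red h2
  have : (fun i => red (τ i : ℕ)) = τ := by
    funext i
    have : ∀ t : Fin 3, red (t : ℕ) = t := by decide
    exact this _
  rw [this, h τ hb] at h1
  exact h1.symm

theorem Wt.of_span (h2 : (2 : k) ≠ 0) {b : ℕ}
    (h : ∀ m, m ∈ Submodule.span k {m | ∃ σ : I → ℕ, ∑ i, σ i ≤ b ∧ IsW σ ρ m}) : Wt b ρ := by
  intro τ ht m
  induction h m using Submodule.span_induction with
  | mem x hx =>
    obtain ⟨σ, hσ, hw⟩ := hx
    refine hw.idm h2 τ ?_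
    rintro rfl
    have : tot (fun i => red (σ i)) ≤ ∑ i, σ i := Finset.sum_le_sum (fun i _ => red_le _)
    omega
  | zero => simp
  | add x y _ _ hx hy => rw [map_add, hx, hy, add_zero]
  | smul a x _ hx => rw [map_smul, hx, smul_zero]

theorem Wt.ind (h2 : (2 : k) ≠ 0) {b : ℕ} (h : Wt b ρ) (P : Submodule k M)
    (hP : ∀ τ : I → Fin 3, tot τ ≤ b → ∀ m, IsW (fun i => (τ i : ℕ)) ρ m → m ∈ P) (m : M) :
    m ∈ P := by
  rw [← sum_act (ρ := ρ) h2 m]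
  refine Submodule.sum_mem _ fun τ _ => ?_
  by_cases ht : tot τ ≤ b
  · exact hP τ ht _ (isW_idm h2 τ m)
  · rw [h τ (by omega)]; exact P.zero_mem

theorem Wt.of_surj {b : ℕ} {M' : Type} [AddCommGroup M'] [Module k M']
    {ρ' : Representation k (I → SignType) M'} (K : Wt b ρ) (f : M →ₗ[k] M')
    (h : ∀ q m, f (ρ q m) = ρ' q (f m)) (hf : Function.Surjective f) : Wt b ρ' :=
  fun τ ht => (K τ ht).of_surj f h hf

theorem Wt.of_inj {b : ℕ} {M' : Type} [AddCommGroup M'] [Module k M']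
    {ρ' : Representation k (I → SignType) M'} (K : Wt b ρ') (f : M →ₗ[k] M')
    (h : ∀ q m, f (ρ q m) = ρ' q (f m)) (hf : Function.Injective f) : Wt b ρ :=
  fun τ ht => (K τ ht).of_inj f h hf

theorem Wt.of_exact (h2 : (2 : k) ≠ 0) {b : ℕ} {M' M'' : Type} [AddCommGroup M'] [Module k M']
    [AddCommGroup M''] [Module k M'']
    {ρ' : Representation k (I → SignType) M'} {ρ'' : Representation k (I → SignType) M''}
    (K : Wt b ρ) (K'' : Wt b ρ'') (f : M →ₗ[k] M') (g : M' →ₗ[k] M'')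
    (hf : ∀ q m, f (ρ q m) = ρ' q (f m)) (hg : ∀ q m, g (ρ' q m) = ρ'' q (g m))
    (hex : Function.Exact f g) : Wt b ρ' :=
  fun τ ht => Kills.of_exact (idm_idem h2 τ) (K τ ht) (K'' τ ht) f g hf hg hex

/-- maximal weight always holds -/
theorem Wt.max (b : ℕ) (hb : 2 * Fintype.card I ≤ b) : Wt b ρ := by
  intro τ ht
  exfalso
  have : tot τ ≤ ∑ _i : I, 2 := Finset.sum_le_sum (fun i _ => by omega)
  simp at this
  omega

theorem Ext.wt (h2 : (2 : k) ≠ 0) {N X N' : Type} [Group N] [Group X] [Group N'] [Finite X]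
    (E : Ext (I → SignType) N X N') (a b : ℕ) (m : CRep k E.aX M)
    (hK : ∀ i j, i + j = a → Wt b (D (E.EH m j) i)) : Wt b (D m a) :=
  fun τ ht => E.kills (idm_idem h2 τ) a m (fun i j h => hK i j h τ ht)

end Weights
end GH

end

/-! ## Part E -/

section
set_option linter.unusedSectionVars false

namespace GH
variable {k : Type} [Field k]

section Nil
variable {N : Type} [Group N]

/-- augmentation submodule -/
noncomputable def augI (k N : Type) [Field k] [Group N] : Submodule k (MonoidAlgebra k N) :=
  Submodule.span k (Set.range fun n : N => MonoidAlgebra.of k N n - 1)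

theorem augI_mem (n : N) : MonoidAlgebra.of k N n - 1 ∈ augI k N :=
  Submodule.subset_span ⟨n, rfl⟩

theorem augI_mul_eq (p : ℕ) [Fact p.Prime] [CharP k p] [Finite k] [Finite N] (hN : IsPGroup p N)
    (X : Submodule k (MonoidAlgebra k N)) (hX : X = augI k N * X) : X = ⊥ := by
  by_contra hne
  have hst : ∀ n : N, ∀ x ∈ X, MonoidAlgebra.of k N n * x ∈ X := by
    intro n x hx
    have h1 : (MonoidAlgebra.of k N n - 1) * x ∈ X := by
      rw [hX]; exact Submodule.mul_mem_mul (augI_mem n) hx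
    have := X.add_mem h1 hx
    rwa [sub_mul, one_mul, sub_add_cancel] at this
  let T : N → X →ₗ[k] X := fun n => (LinearMap.mulLeft k (MonoidAlgebra.of k N n)).restrict (hst n)
  have hT : ∀ n x, (T n x : MonoidAlgebra k N) = MonoidAlgebra.of k N n * x := fun n x => rfl
  let act : MulAction N (Module.Dual k X) :=
    { smul := fun n f => f ∘ₗ T n⁻¹
      one_smul := fun f => by
        refine LinearMap.ext fun x => ?_
        change f (T (1 : N)⁻¹ x) = f x
        congr 1
        apply Subtype.ext
        rw [hT, inv_one, map_one, one_mul]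
      mul_smul := fun a b f => by
        refine LinearMap.ext fun x => ?_
        change f (T (a * b)⁻¹ x) = f (T b⁻¹ (T a⁻¹ x))
        congr 1
        apply Subtype.ext
        rw [hT, hT, hT, mul_inv_rev, map_mul, mul_assoc] }
  have hsm : ∀ (n : N) (f : Module.Dual k X), n • f = f ∘ₗ T n⁻¹ := fun n f => rfl
  have : Finite (MonoidAlgebra k N) := Finite.of_injective (fun f : MonoidAlgebra k N => fun n => f.coeff n)
    (fun a b h => by ext n; exact congrFun h n)
  have : Finite (Module.Dual k X) := Module.finite_of_finite k
  have : Nontrivial X := Submodule.nontrivial_iff_ne_bot.2 hne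
  obtain ⟨f, hf⟩ := exists_ne (0 : Module.Dual k X)
  have hp : p ∣ Nat.card (Module.Dual k X) := by
    have h1 : addOrderOf f = p := addOrderOf_eq_prime (by
      rw [← Nat.cast_smul_eq_nsmul k, CharP.cast_eq_zero, zero_smul]) hf
    rw [← h1]
    exact addOrderOf_dvd_natCard f
  obtain ⟨g, hg, hg0⟩ := hN.exists_fixed_point_of_prime_dvd_card_of_fixed_point _ hp
    (a := (0 : Module.Dual k X)) (fun n => by rw [hsm, LinearMap.zero_comp])
  apply hg0
  have hk : augI k N * X ≤ (LinearMap.ker g).map X.subtype := by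
    refine Submodule.mul_le.2 fun m hm x hx => ?_
    have : augI k N ≤ ((LinearMap.ker g).map X.subtype).comap (LinearMap.mulRight k x) := by
      refine Submodule.span_le.2 ?_
      rintro _ ⟨n, rfl⟩
      have h1 : g (T n ⟨x, hx⟩) = g ⟨x, hx⟩ := by
        have := congrArg (fun t : Module.Dual k X => t ⟨x, hx⟩) (hg n⁻¹)
        simp only [hsm, inv_inv] at this
        exact this
      rw [← sub_eq_zero, ← map_sub] at h1
      refine ⟨_, h1, ?_⟩
      change MonoidAlgebra.of k N n * x - x = (MonoidAlgebra.of k N n - 1) * x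
      rw [sub_mul, one_mul]
    exact this hm
  refine LinearMap.ext fun x => ?_
  obtain ⟨y, hy, hyx⟩ := hk (hX.le x.2)
  have : y = x := Subtype.ext hyx
  rw [← this]
  exact (LinearMap.mem_ker.1 hy).symm

theorem augI_nilp (p : ℕ) [Fact p.Prime] [CharP k p] [Finite k] [Finite N] (hN : IsPGroup p N) :
    ∃ r, augI k N ^ r = ⊥ := by
  let L : ℕ → Submodule k (MonoidAlgebra k N) := fun r => augI k N ^ r * ⊤
  have hL : ∀ r, L (r + 1) ≤ L r := by
    intro r
    change augI k N ^ (r + 1) * ⊤ ≤ augI k N ^ r * ⊤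
    rw [pow_succ, mul_assoc]
    exact mul_le_mul_right le_top _
  have : Finite (MonoidAlgebra k N) := Finite.of_injective (fun f : MonoidAlgebra k N => fun n => f.coeff n)
    (fun a b h => by ext n; exact congrFun h n)
  obtain ⟨r, hr⟩ := IsArtinian.monotone_stabilizes
    (⟨fun r => OrderDual.toDual (L r), monotone_nat_of_le_succ hL⟩ :
      ℕ →o (Submodule k (MonoidAlgebra k N))ᵒᵈ)
  have hr1 : L r = augI k N * L r := by
    have h1 : L r = L (r + 1) := hr (r + 1) (Nat.le_succ r)
    have h2 : L (r + 1) = augI k N * L r := by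
      change augI k N ^ (r + 1) * ⊤ = augI k N * (augI k N ^ r * ⊤)
      rw [pow_succ', mul_assoc]
    exact h1.trans h2
  have h3 := augI_mul_eq p hN _ hr1
  refine ⟨r, le_bot_iff.1 ?_⟩
  rw [← h3]
  intro x hx
  have := Submodule.mul_mem_mul hx (Submodule.mem_top (x := (1 : MonoidAlgebra k N)))
  rwa [mul_one] at this

end Nil

section Dev
variable {Q N : Type} [Monoid Q] [Group N] {α : GAct Q N}
variable {M : Type} [AddCommGroup M] [Module k M]

/-- sub CRep -/
noncomputable def CRep.sub (c : CRep k α M) (W : Submodule k M) (hn : ∀ g, W ≤ W.comap (c.n g))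
    (hq : ∀ g, W ≤ W.comap (c.q g)) : CRep k α W where
  n := c.n.subrepresentation W hn
  q := c.q.subrepresentation W hq
  comm := fun x g m => Subtype.ext (c.comm x g m)

/-- quotient CRep -/
noncomputable def CRep.quot (c : CRep k α M) (W : Submodule k M) (hn : ∀ g, W ≤ W.comap (c.n g))
    (hq : ∀ g, W ≤ W.comap (c.q g)) : CRep k α (M ⧸ W) where
  n := c.n.quotient W hn
  q := c.q.quotient W hq
  comm := fun x g m => by
    obtain ⟨m, rfl⟩ := Submodule.mkQ_surjective W m
    exact congrArg W.mkQ (c.comm x g m)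

theorem subquot_SES {G : Type} [Group G] (ρ : Representation k G M) (W : Submodule k M)
    (hn : ∀ g, W ≤ W.comap (ρ g)) :
    SES (ρ.subrepresentation W hn) ρ (ρ.quotient W hn) W.subtype W.mkQ where
  hf := fun g m => rfl
  hg := fun g m => rfl
  inj := Subtype.val_injective
  surj := Submodule.mkQ_surjective W
  exact := fun x => by
    rw [Submodule.coe_subtype, Subtype.range_coe, ← LinearMap.mem_ker, Submodule.ker_mkQ]; rfl

/-- augmentation submodule of a representation -/
def IM (ρ : Representation k N M) : Submodule k M :=
  Submodule.span k {x | ∃ g m, ρ g m - m = x}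

theorem IM_n (ρ : Representation k N M) (g : N) : IM ρ ≤ (IM ρ).comap (ρ g) := by
  refine Submodule.span_le.2 ?_
  rintro _ ⟨h, m, rfl⟩
  change ρ g (ρ h m - m) ∈ IM ρ
  have e : ρ g (ρ h m - m) = (ρ (g * h) m - m) - (ρ g m - m) := by
    rw [map_mul, Module.End.mul_apply, map_sub]; abel
  rw [e]
  exact Submodule.sub_mem _ (Submodule.subset_span ⟨_, _, rfl⟩) (Submodule.subset_span ⟨_, _, rfl⟩)

theorem IM_q (c : CRep k α M) (x : Q) : IM c.n ≤ (IM c.n).comap (c.q x) := by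
  refine Submodule.span_le.2 ?_
  rintro _ ⟨h, m, rfl⟩
  change c.q x (c.n h m - m) ∈ IM c.n
  rw [map_sub, c.comm]
  exact Submodule.subset_span ⟨_, _, rfl⟩

theorem devissage_aux
    (P : ∀ (M : Type) [AddCommGroup M] [Module k M], CRep k α M → Prop)
    (htriv : ∀ (M : Type) [AddCommGroup M] [Module k M] (c : CRep k α M),
      (∀ g m, c.n g m = m) → P M c)
    (hext : ∀ (M : Type) [AddCommGroup M] [Module k M] (c : CRep k α M) (W : Submodule k M)
      (hn : ∀ g, W ≤ W.comap (c.n g)) (hq : ∀ g, W ≤ W.comap (c.q g)),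
      P _ (c.sub W hn hq) → P _ (c.quot W hn hq) → P M c) (r : ℕ) :
    ∀ (M : Type) [AddCommGroup M] [Module k M] (c : CRep k α M),
      (∀ x ∈ augI k N ^ r, c.n.asAlgebraHom x = 0) → P M c := by
  induction r with
  | zero =>
    intro M _ _ c h
    have h1 := h 1 (by rw [pow_zero]; exact Submodule.one_le.1 le_rfl)
    rw [map_one] at h1
    refine htriv M c fun g m => ?_
    have : ∀ m : M, m = 0 := fun m => congrArg (fun t : M →ₗ[k] M => t m) h1
    rw [this (c.n g m), this m]
  | succ r ih =>
    intro M _ _ c h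
    refine hext M c (IM c.n) (IM_n c.n) (IM_q c) (ih _ _ ?_) (htriv _ _ ?_)
    · intro x hx
      refine LinearMap.ext fun m => ?_
      apply Subtype.ext
      have e := act_equiv (ρ := (c.sub (IM c.n) (IM_n c.n) (IM_q c)).n) (ρ' := c.n)
        (IM c.n).subtype (fun _ _ => rfl) x m
      refine Eq.trans e ?_
      change c.n.asAlgebraHom x m.1 = 0
      obtain ⟨m, hm⟩ := m
      change c.n.asAlgebraHom x m = 0
      clear e
      change m ∈ Submodule.span k {x | ∃ g m, c.n g m - m = x} at hm
      induction hm using Submodule.span_induction with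
      | mem y hy =>
        obtain ⟨g, v, rfl⟩ := hy
        have h2 := h (x * (MonoidAlgebra.of k N g - 1)) (by
          rw [pow_succ]; exact Submodule.mul_mem_mul hx (augI_mem g))
        have h3 := congrArg (fun t : M →ₗ[k] M => t v) h2
        simpa using h3
      | zero => exact map_zero _
      | add a b _ _ ha hb => rw [map_add, ha, hb, add_zero]
      | smul a b _ hb => rw [map_smul, hb, smul_zero]
    · intro g m
      obtain ⟨m, rfl⟩ := Submodule.mkQ_surjective _ m
      change (IM c.n).mkQ (c.n g m) = (IM c.n).mkQ m
      rw [← sub_eq_zero, ← map_sub, ← LinearMap.mem_ker, Submodule.ker_mkQ]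
      exact Submodule.subset_span ⟨_, _, rfl⟩

theorem devissage (p : ℕ) [Fact p.Prime] [CharP k p] [Finite k] [Finite N] (hN : IsPGroup p N)
    (P : ∀ (M : Type) [AddCommGroup M] [Module k M], CRep k α M → Prop)
    (htriv : ∀ (M : Type) [AddCommGroup M] [Module k M] (c : CRep k α M),
      (∀ g m, c.n g m = m) → P M c)
    (hext : ∀ (M : Type) [AddCommGroup M] [Module k M] (c : CRep k α M) (W : Submodule k M)
      (hn : ∀ g, W ≤ W.comap (c.n g)) (hq : ∀ g, W ≤ W.comap (c.q g)),
      P _ (c.sub W hn hq) → P _ (c.quot W hn hq) → P M c)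
    (M : Type) [AddCommGroup M] [Module k M] (c : CRep k α M) : P M c := by
  obtain ⟨r, hr⟩ := augI_nilp (k := k) p hN
  refine devissage_aux P htriv hext r M c ?_
  intro x hx
  rw [hr, Submodule.mem_bot] at hx
  rw [hx, map_zero]

end Dev
end GH

end

/-! ## Part F -/

section
set_option linter.unusedSectionVars false

namespace GH
variable {k : Type} [Field k]

theorem inv_H1 {N M : Type} [CommGroup N] [Finite N] [AddCommGroup M] [Module k M]
    (ρ : Representation k N M) (ht : ∀ g m, ρ g m = m)
    {φ : N →* N} {f : M →ₗ[k] M} (h : Compat ρ ρ φ f) (hφ : ∀ n, φ n = n⁻¹) (hf : ∀ m, f m = m)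
    (x : H 1 ρ) : Hmap h 1 x = -x := by
  have hψ : ∀ x g : N, ((lm N).f x g)⁻¹ = (lm N).f (φ x) g⁻¹ := fun x g => by
    rw [lm_apply, lm_apply, hφ, mul_inv]
  apply (covSES ρ (lm N)).δ_inj 0 (cov_acyclic' ρ 0)
  rw [cov_δ_nat (a := lm N) (a' := lm N) h (fun n => n⁻¹) hψ 0 x, map_neg]
  generalize (covSES ρ (lm N)).δ 0 x = y
  obtain ⟨v, rfl⟩ := h0_surj _ y
  rw [Hmap_h0]
  let L : (N →₀ M) →ₗ[k] AK k N M :=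
    (LinearMap.id - (Finsupp.lsingle (1 : N)) ∘ₗ aug k N M).codRestrict _ (fun w => by
      rw [LinearMap.mem_ker]
      simp [aug_single])
  have hL : ∀ w, ((L w : AK k N M) : N →₀ M) = w - Finsupp.single 1 (aug k N M w) := fun w => rfl
  have hv : L v.1 = v := by
    apply Subtype.ext
    rw [hL, LinearMap.mem_ker.1 v.2]; simp
  rw [← hv]
  generalize v.1 = w
  rw [eq_neg_iff_add_eq_zero, ← map_add]
  induction w using Finsupp.induction_linear with
  | zero => simp
  | add a b ha hb =>
    have : ∀ (p : AK k N M →ₗ[k] AK k N M), p (L (a + b)) + L (a + b) =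
      (p (L a) + L a) + (p (L b) + L b) := by intro p; rw [map_add, map_add]; abel
    rw [this, map_add, ha, hb, add_zero]
  | single n m =>
    set u := Kmap (k := k) (fun n : N => n⁻¹) f (L (Finsupp.single n m)) with hu
    have e : (Krep (lm N) ρ) n u = - L (Finsupp.single n m) := by
      apply Subtype.ext
      rw [Krep_apply, Kmap_coe, hu, Kmap_coe]
      simp only [hL, aug_single, map_sub, Pmap_single, hf, ht, Submodule.coe_neg, lm_apply]
      simp
    rw [map_add, ← h0_rho n u, e, map_neg, neg_add_cancel]

section line
variable {I : Type} [Fintype I] [DecidableEq I]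

/-- sign monomial -/
def sg (C : I → ℕ) : (I → SignType) →* SignType where
  toFun o := ∏ i, o i ^ C i
  map_one' := by simp
  map_mul' a b := by simp [mul_pow, Finset.prod_mul_distrib]

theorem sc_sg (C : I → ℕ) (o : I → SignType) : sc k (sg C o) = chi k C o := by
  change sc k (∏ i, o i ^ C i) = _
  rw [map_prod, chi]
  exact Finset.prod_congr rfl fun i _ => map_pow _ _ _

theorem chi_add_mul (σ C : I → ℕ) (t : ℕ) (o : I → SignType) :
    chi k (fun i => σ i + t * C i) o = chi k σ o * chi k C o ^ t := by
  rw [chi, chi, chi, ← Finset.prod_pow, ← Finset.prod_mul_distrib]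
  exact Finset.prod_congr rfl fun i _ => by rw [pow_add, mul_comm t, pow_mul]

/-- trivial operators -/
def GAct.triv (Q N : Type) [Monoid Q] [Group N] : GAct Q N :=
  ⟨fun _ => MonoidHom.id N, rfl, fun _ _ => rfl⟩

theorem D_alg {Q N M : Type} [Monoid Q] [Group N] [AddCommGroup M] [Module k M]
    (c : CRep k (GAct.triv Q N) M) (j : ℕ) (e : MonoidAlgebra k Q) :
    ∃ h : Compat c.n c.n (MonoidHom.id N) (c.q.asAlgebraHom e),
      (D c j).asAlgebraHom e = Hmap h j := by
  induction e using MonoidAlgebra.induction_on with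
  | of g =>
    refine ⟨fun n m => ?_, ?_⟩
    · rw [Representation.asAlgebraHom_of]; exact c.comm g n m
    · rw [Representation.asAlgebraHom_of, D_apply]
      exact Hmap_congr _ _ rfl (Representation.asAlgebraHom_of _ _).symm j
  | add a b ha hb =>
    obtain ⟨ha, ha'⟩ := ha
    obtain ⟨hb, hb'⟩ := hb
    have h : Compat c.n c.n (MonoidHom.id N) (c.q.asAlgebraHom a + c.q.asAlgebraHom b) :=
      fun n m => by rw [LinearMap.add_apply, ha, hb, LinearMap.add_apply, map_add]
    refine ⟨by rw [map_add]; exact h, ?_⟩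
    rw [map_add, ha', hb', ← Hmap_add ha hb h]
    exact Hmap_congr _ _ rfl (map_add _ _ _).symm j
  | smul r a ha =>
    obtain ⟨ha, ha'⟩ := ha
    have h : Compat c.n c.n (MonoidHom.id N) (r • c.q.asAlgebraHom a) :=
      fun n m => by rw [LinearMap.smul_apply, ha, LinearMap.smul_apply, map_smul]
    refine ⟨by rw [map_smul]; exact h, ?_⟩
    rw [map_smul, ha', ← Hmap_smul r ha h]
    exact Hmap_congr _ _ rfl (map_smul _ _ _).symm j

theorem line_triv (h2 : (2 : k) ≠ 0) {N M : Type} [CommGroup N] [Finite N]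
    [AddCommGroup M] [Module k M]
    (β : GAct SignType N) (hneg : ∀ n, β.f (-1) n = n⁻¹) (hzero : ∀ n, β.f 0 n = 1) (C : I → ℕ)
    {α : GAct (I → SignType) N} (hα : ∀ o, α.f o = β.f (sg C o)) (c : CRep k α M)
    (ht : ∀ g m, c.n g m = m) (b : ℕ) (hb : Wt b c.q) (j : ℕ) :
    Wt (b + (∑ i, C i) * j) (D c j) := by
  let c1 : CRep k (β.comp (Pi.evalMonoidHom (fun _ : Unit => SignType) ())) M :=
    ⟨c.n, 1, fun x g m => by rw [ht, ht]⟩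
  let c2 : CRep k (GAct.triv (I → SignType) N) M :=
    ⟨c.n, c.q, fun x g m => by rw [ht, ht]⟩
  have hf : ∀ o m, c1.q o m = m := fun o m => rfl
  have w1 : Wt j (D c1 j) := by
    rcases j with _ | _ | j
    · refine Wt.of_span h2 fun m => Submodule.subset_span ⟨fun _ => 0, by simp, fun o => ?_⟩
      obtain ⟨m, rfl⟩ := h0_surj _ m
      rw [D_h0, hf]; simp [chi]
    · refine Wt.of_span h2 fun m => Submodule.subset_span ⟨fun _ => 1, by simp, fun o => ?_⟩
      have hs : chi k (fun _ => 1) o = sc k (o ()) := by simp [chi]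
      rw [hs, D_apply]
      rcases ho : o () with _ | _ | _
      · have := Hmap_triv (c1.comm o) (fun g => by
          change β.f (o ()) g = 1
          rw [ho]; exact hzero g) 0 m
        refine this.trans ?_
        simp
      · have := inv_H1 c1.n ht (c1.comm o) (fun g => by
          change β.f (o ()) g = g⁻¹
          rw [ho]; exact hneg g) (hf o) m
        refine this.trans ?_
        simp
      · have := Hmap_id_apply (c1.comm o) (by
          change β.f (o ()) = _
          rw [ho]; exact β.one) (by ext m; exact hf o m) 1 m
        refine this.trans ?_
        simp
    · exact Wt.max _ (by simp)
  have w2 : Wt b (D c2 j) := by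
    intro τ hτ x
    obtain ⟨h, he⟩ := D_alg c2 j (idm k τ)
    rw [he]
    have hz : c2.q.asAlgebraHom (idm k τ) = 0 := LinearMap.ext fun m => hb τ hτ m
    have hc : Compat c2.n c2.n (MonoidHom.id N) (0 : M →ₗ[k] M) := fun g m => by simp
    rw [Hmap_congr h hc rfl hz j, Hmap_zero hc]; rfl
  have hD : ∀ o x, D c j o x = D c1 j (fun _ => sg C o) (D c2 j o x) := by
    intro o x
    have := Hmap_comp_apply (c1.comm (fun _ => sg C o)) (c2.comm o) j x
    refine Eq.trans ?_ this.symm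
    refine congrArg (fun t : _ →ₗ[k] _ => t x) (Hmap_congr _ _ ?_ ?_ j)
    · rw [hα]; rfl
    · ext m; rfl
  have hcomm : ∀ o p x, D c1 j p (D c2 j o x) = D c2 j o (D c1 j p x) := by
    intro o p x
    exact Hmap_sq (c1.comm p) (c2.comm o) (c2.comm o) (c1.comm p) rfl (by ext m; rfl) j x
  refine Wt.of_span h2 fun x => ?_
  refine w1.ind h2 _ (fun t htt y hy => ?_) x
  rw [← sum_act (ρ := D c2 j) h2 y]
  refine Submodule.sum_mem _ fun τ _ => ?_
  by_cases hτ : b < tot τ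
  · rw [w2 τ hτ]; exact Submodule.zero_mem _
  refine Submodule.subset_span ⟨fun i => (τ i : ℕ) + (t () : ℕ) * C i, ?_, fun o => ?_⟩
  · rw [Finset.sum_add_distrib, ← Finset.mul_sum, mul_comm]
    have : tot t = (t () : ℕ) := by simp [tot]
    rw [this] at htt
    have := Nat.mul_le_mul_left (∑ i, C i) htt
    have : tot τ = ∑ i, (τ i : ℕ) := rfl
    omega
  · have h1 := isW_idm (ρ := D c2 j) h2 τ y o
    rw [hD, h1, map_smul]
    have h3 := act_equiv (ρ := D c2 j) (ρ' := D c2 j) (D c1 j (fun _ => sg C o))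
      (fun q m => hcomm q _ m) (idm k τ) y
    have h4 := hy (fun _ => sg C o)
    rw [h3, h4, map_smul, chi_add_mul, smul_smul, ← sc_sg C]
    congr 2
    simp [chi]

/-- groups with operators whose homology has controlled weights -/
def Good (k : Type) [Field k] (κ : ℕ) {N : Type} [Group N] (α : GAct (I → SignType) N) : Prop :=
  ∀ (M : Type) [AddCommGroup M] [Module k M] (c : CRep k α M) (b j : ℕ), Wt b c.q →
    Wt (b + κ * j) (D c j)

theorem Good.ext (h2 : (2 : k) ≠ 0) {κ : ℕ} {N X N' : Type} [Group N] [Group X] [Group N'] [Finite X]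
    (E : Ext (I → SignType) N X N') (hN : Good k κ E.aN) (hN' : Good k κ E.aN') :
    Good k κ E.aX := by
  intro M _ _ c b a hb
  refine E.wt h2 a _ c fun i j hij => ?_
  have h1 : Wt (b + κ * j) (E.EH c j).q := hN M (E.resQ c) b j hb
  have := hN' _ (E.EH c j) _ i h1
  refine this.mono ?_
  subst hij
  rw [mul_add]; omega

theorem Good.line (h2 : (2 : k) ≠ 0) (p : ℕ) [Fact p.Prime] [CharP k p] [Finite k]
    {N : Type} [CommGroup N] [Finite N] (hN : IsPGroup p N)
    (β : GAct SignType N) (hneg : ∀ n, β.f (-1) n = n⁻¹) (hzero : ∀ n, β.f 0 n = 1) (C : I → ℕ)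
    {α : GAct (I → SignType) N} (hα : ∀ o, α.f o = β.f (sg C o)) (κ : ℕ) (hκ : ∑ i, C i ≤ κ) :
    Good k κ α := by
  intro M _ _ c b j
  revert j
  refine devissage p hN (fun M _ _ c => ∀ j, Wt b c.q → Wt (b + κ * j) (D c j)) ?_ ?_ M c
  · intro M _ _ c ht j hb
    refine (line_triv h2 β hneg hzero C hα c ht b hb j).mono ?_
    have := Nat.mul_le_mul_right j hκ
    omega
  · intro M _ _ c W hn hq h1 h3 j hb
    have S := subquot_SES c.n W hn
    refine Wt.of_exact h2 (h1 j (hb.of_inj W.subtype (fun _ _ => rfl) Subtype.val_injective))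
      (h3 j (hb.of_surj W.mkQ (fun _ _ => rfl) (Submodule.mkQ_surjective W)))
      (Hmap S.hf j) (Hmap S.hg j) ?_ ?_ (S.exact₂ j)
    · exact Hmap_D (c.sub W hn hq) c S.hf (fun _ _ => rfl) j
    · exact Hmap_D c (c.quot W hn hq) S.hg (fun _ _ => rfl) j

end line
end GH

end

/-! ## Part G -/

section
set_option linter.unusedSectionVars false

namespace GH
variable {k : Type} [Field k]

section semi
variable {Q N N' : Type} [Monoid Q] [Group N] [Group N']

/-- action by automorphisms -/
def GAct.aut (c : GAct N' N) : N' →* MulAut N where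
  toFun y :=
    { toFun := c.f y
      invFun := c.f y⁻¹
      left_inv := fun n => by
        rw [← MonoidHom.comp_apply, ← c.mul, inv_mul_cancel, c.one]; rfl
      right_inv := fun n => by
        rw [← MonoidHom.comp_apply, ← c.mul, mul_inv_cancel, c.one]; rfl
      map_mul' := fun a b => map_mul _ _ _ }
  map_one' := by ext n; exact congrArg (fun t : N →* N => t n) c.one
  map_mul' a b := by ext n; exact congrArg (fun t : N →* N => t n) (c.mul a b)

theorem GAct.aut_apply (c : GAct N' N) (y : N') (n : N) : c.aut y n = c.f y n := rfl

/-- semidirect product -/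
abbrev Semi (c : GAct N' N) := N ⋊[c.aut] N'

instance (c : GAct N' N) [Finite N] [Finite N'] : Finite (Semi c) :=
  Finite.of_equiv _ SemidirectProduct.equivProd.symm

/-- split extension from a semidirect product -/
def Ext.semi (c : GAct N' N) (aN : GAct Q N) (aN' : GAct Q N')
    (h : ∀ q y n, aN.f q (c.f y n) = c.f (aN'.f q y) (aN.f q n)) : Ext Q N (Semi c) N' where
  ι := SemidirectProduct.inl
  π := SemidirectProduct.rightHom
  s := SemidirectProduct.inr
  c := c
  aN := aN
  aX :=
    { f := fun q => SemidirectProduct.map (aN.f q) (aN'.f q) (fun y => by ext n; exact h q y n)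
      one := by
        ext x
        · exact congrArg (fun t : N →* N => t x.left) aN.one
        · exact congrArg (fun t : N' →* N' => t x.right) aN'.one
      mul := fun a b => by
        ext x
        · exact congrArg (fun t : N →* N => t x.left) (aN.mul a b)
        · exact congrArg (fun t : N' →* N' => t x.right) (aN'.mul a b) }
  aN' := aN'
  inj := SemidirectProduct.inl_injective
  πι := fun x => rfl
  πs := fun x => rfl
  ker := fun x hx => ⟨x.left, by ext; rfl; exact hx.symm⟩
  hc := fun y x => by
    have := SemidirectProduct.inl_aut (φ := c.aut) y x
    rw [GAct.aut_apply] at this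
    rw [this, map_inv]
  eι := fun q x => by ext <;> simp [SemidirectProduct.map]
  es := fun q x => by ext <;> simp [SemidirectProduct.map]
  eπ := fun q x => rfl

/-- lift from a semidirect product -/
def Semi.lift {G : Type} [Monoid G] {c : GAct N' N} (f : N →* G) (g : N' →* G)
    (h : ∀ y n, g y * f n = f (c.f y n) * g y) : Semi c →* G where
  toFun x := f x.left * g x.right
  map_one' := by simp
  map_mul' a b := by
    simp only [SemidirectProduct.mul_left, SemidirectProduct.mul_right, map_mul, GAct.aut_apply]
    rw [mul_assoc, mul_assoc, ← mul_assoc (g a.right), h, mul_assoc]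

end semi

section vec
variable {I : Type} [Fintype I] [DecidableEq I]

theorem good_subsingleton (h2 : (2 : k) ≠ 0) (p : ℕ) [Fact p.Prime] [CharP k p] [Finite k]
    {N : Type} [Group N] [Subsingleton N] (α : GAct (I → SignType) N) (κ : ℕ) :
    Good k κ α := by
  let i : CommGroup N := { (inferInstance : Group N) with mul_comm := fun a b => Subsingleton.elim _ _ }
  refine Good.line (α := α) h2 p (N := N) ?_ (GAct.triv _ _) (fun n => Subsingleton.elim _ _)
    (fun n => Subsingleton.elim _ _) (fun _ => 0) (fun o => ?_) κ (by simp)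
  · exact IsPGroup.of_card (n := 0) (by simp)
  · ext n; exact Subsingleton.elim _ _

theorem Good.iso (h2 : (2 : k) ≠ 0) (p : ℕ) [Fact p.Prime] [CharP k p] [Finite k]
    {N N' : Type} [Group N] [Group N'] [Finite N'] {α : GAct (I → SignType) N}
    {α' : GAct (I → SignType) N'} {κ : ℕ} (h : Good k κ α) (e : N ≃* N')
    (he : ∀ o n, α'.f o (e n) = e (α.f o n)) : Good k κ α' := by
  let E : Ext (I → SignType) N N' Unit :=
    { ι := e, π := 1, s := 1, c := GAct.triv _ _, aN := α, aX := α', aN' := GAct.triv _ _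
      inj := e.injective
      πι := fun _ => rfl
      πs := fun _ => rfl
      ker := fun x _ => ⟨e.symm x, e.apply_symm_apply x⟩
      hc := fun y x => by simp [GAct.triv]
      eι := he
      es := fun q x => by simp
      eπ := fun _ _ => rfl }
  exact Good.ext h2 E h (good_subsingleton h2 p _ κ)

variable {F : Type} [Field F]

/-- operators from additive maps -/
def addAct {Q A : Type} [Monoid Q] [AddCommGroup A] (f : Q → A →+ A)
    (h1 : ∀ a, f 1 a = a) (hm : ∀ x y a, f (x * y) a = f x (f y a)) : GAct Q (Multiplicative A) where
  f q := AddMonoidHom.toMultiplicative (f q)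
  one := by ext a; exact h1 a
  mul x y := by ext a; exact hm x y a

/-- diagonal action on a coordinate space -/
noncomputable def vact {J : Type} (F : Type) [Field F] (C : J → I → ℕ) : GAct (I → SignType) (Multiplicative (J → F)) :=
  addAct (fun o => { toFun := fun v j => sc F (sg (C j) o) * v j
                     map_zero' := by ext; simp
                     map_add' := fun a b => by ext; simp [mul_add] })
    (fun a => by ext; simp) (fun x y a => by ext; simp [mul_assoc])

theorem vact_apply {J : Type} (C : J → I → ℕ) (o : I → SignType) (v : J → F) :
    (vact F C).f o (Multiplicative.ofAdd v) =
      Multiplicative.ofAdd (fun j => sc F (sg (C j) o) * v j) := rfl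

theorem mult_pgroup (p : ℕ) [CharP F p] {A : Type} [AddCommGroup A] [Module F A] :
    IsPGroup p (Multiplicative A) := by
  intro g
  refine ⟨1, ?_⟩
  rw [pow_one]
  change Multiplicative.ofAdd (p • g.toAdd) = 1
  rw [← Nat.cast_smul_eq_nsmul F, CharP.cast_eq_zero, zero_smul]; rfl

theorem Good.vec (h2 : (2 : k) ≠ 0) (p : ℕ) [Fact p.Prime] [CharP k p] [Finite k]
    [CharP F p] [Finite F] (κ : ℕ) (J : Type) [Finite J] :
    ∀ (C : J → I → ℕ), (∀ j, ∑ i, C j i ≤ κ) → Good k κ (vact F C) := by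
  suffices h : Finite J ∧ ∀ (C : J → I → ℕ), (∀ j, ∑ i, C j i ≤ κ) → Good k κ (vact F C) from h.2
  induction J using Finite.induction_empty_option with
  | of_equiv e ih =>
    rename_i α β
    obtain ⟨hf, ih⟩ := ih
    have : Finite β := Finite.of_equiv α e
    refine ⟨this, fun C hC => ?_⟩
    refine Good.iso h2 p (ih (fun a => C (e a)) (fun a => hC _))
      (AddEquiv.toMultiplicative (LinearEquiv.funCongrLeft F F e.symm).toAddEquiv) ?_
    intro o n
    apply Multiplicative.toAdd.injective
    funext j
    change sc F (sg (C j) o) * n.toAdd (e.symm j) = sc F (sg (C (e (e.symm j))) o) * n.toAdd (e.symm j)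
    rw [e.apply_symm_apply]
  | h_empty =>
    refine ⟨inferInstance, fun C hC => ?_⟩
    exact good_subsingleton h2 p _ κ
  | h_option ih =>
    rename_i J _
    obtain ⟨hf, ih⟩ := ih
    refine ⟨inferInstance, fun C hC => ?_⟩
    let β : GAct SignType (Multiplicative F) := addAct (fun o => AddMonoidHom.mulLeft (sc F o))
      (fun a => by simp) (fun x y a => by simp [mul_assoc])
    let E : Ext (I → SignType) (Multiplicative F) (Multiplicative (Option J → F))
        (Multiplicative (J → F)) :=
      { ι := AddMonoidHom.toMultiplicative
          { toFun := fun x j => j.elim x (fun _ => 0)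
            map_zero' := by ext j; cases j <;> rfl
            map_add' := fun a b => by ext j; cases j <;> simp }
        π := AddMonoidHom.toMultiplicative
          { toFun := fun x j => x (some j)
            map_zero' := rfl
            map_add' := fun a b => rfl }
        s := AddMonoidHom.toMultiplicative
          { toFun := fun x j => j.elim 0 (fun j => x j)
            map_zero' := by ext j; cases j <;> rfl
            map_add' := fun a b => by ext j; cases j <;> simp }
        c := GAct.triv _ _
        aN := β.comp (sg (C none))
        aX := vact F C
        aN' := vact F (fun j => C (some j))
        inj := fun a b h => congrFun (congrArg Multiplicative.toAdd h) none
        πι := fun x => rfl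
        πs := fun x => rfl
        ker := fun x hx => ⟨Multiplicative.ofAdd (x.toAdd none), by
          apply Multiplicative.toAdd.injective
          funext j
          cases j with
          | none => rfl
          | some j => exact (congrFun (congrArg Multiplicative.toAdd hx) j).symm⟩
        hc := fun y x => by rw [mul_comm, inv_mul_cancel_left]; rfl
        eι := fun q x => by
          apply Multiplicative.toAdd.injective
          funext j
          cases j with
          | none => rfl
          | some j => exact mul_zero _
        es := fun q x => by
          apply Multiplicative.toAdd.injective
          funext j
          cases j with
          | none => exact mul_zero _
          | some j => rfl
        eπ := fun q x => rfl }
    refine Good.ext h2 E ?_ (ih _ (fun j => hC _))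
    refine Good.line h2 p (mult_pgroup (F := F) p) β ?_ ?_ (C none) (fun o => rfl) κ (hC none)
    · intro n
      change Multiplicative.ofAdd (sc F (-1) * n.toAdd) = _
      rw [sc_neg, neg_one_mul]; rfl
    · intro n
      change Multiplicative.ofAdd (sc F 0 * n.toAdd) = _
      rw [sc_zero, zero_mul]; rfl

end vec
end GH

end

/-! ## Part H -/

section
set_option linter.unusedSectionVars false

namespace GH
variable {k : Type} [Field k]

section uv
variable {F : Type} [Field F] {J : Type} [Fintype J] [DecidableEq J]

/-- diagonal matrices of signs -/
noncomputable def dg (F J : Type) [Field F] [Fintype J] [DecidableEq J] :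
    (J → SignType) →* Matrix J J F where
  toFun o := Matrix.diagonal fun j => sc F (o j)
  map_one' := by simp
  map_mul' a b := by rw [Matrix.diagonal_mul_diagonal]; simp

theorem dg_apply (o : J → SignType) : dg F J o = Matrix.diagonal fun j => sc F (o j) := rfl

/-- elementary matrix -/
noncomputable def EE (F : Type) [Field F] (i f : J) : Matrix J J F := Matrix.single i f 1

/-- swap matrix -/
noncomputable def sw (F : Type) [Field F] (i f : J) : Matrix J J F :=
  (1 : Matrix J J F).submatrix (Equiv.swap i f) id

theorem dg_EE (o : J → SignType) (i f : J) : dg F J o * EE F i f = sc F (o i) • EE F i f := by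
  ext a b
  rw [dg_apply, Matrix.diagonal_mul, EE, Matrix.smul_apply, Matrix.single_apply]
  split_ifs with h
  · rw [← h.1]; rfl
  · simp

theorem EE_dg (o : J → SignType) (i f : J) : EE F i f * dg F J o = sc F (o f) • EE F i f := by
  ext a b
  rw [dg_apply, Matrix.mul_diagonal, EE, Matrix.smul_apply, Matrix.single_apply]
  split_ifs with h
  · rw [← h.2]; simp
  · simp

theorem dg_sw (o : J → SignType) (i f : J) :
    dg F J o * sw F i f = sw F i f * dg F J (fun j => o (Equiv.swap i f j)) := by
  ext a b
  rw [dg_apply, dg_apply, Matrix.diagonal_mul, Matrix.mul_diagonal, sw, Matrix.submatrix_apply,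
    Matrix.one_apply]
  simp only [id]
  split_ifs with h
  · rw [← h, Equiv.swap_apply_self, mul_comm]
  · simp

theorem key3 (i f : J) (h : i ≠ f) :
    dg F J (Pi.mulSingle f 0) * (1 + EE F i f) * sw F i f * dg F J (Pi.mulSingle f 0) =
      dg F J (Pi.mulSingle f 0) := by
  rw [mul_add, mul_one, dg_EE, Pi.mulSingle_eq_of_ne h, map_one, one_smul]
  have e1 : EE F i f * sw F i f = EE F i i := by
    ext a b
    rw [EE, EE, Matrix.single_apply]
    by_cases ha : i = a
    · subst ha
      rw [Matrix.single_mul_apply_same]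
      simp [sw, Matrix.one_apply]
    · rw [Matrix.single_mul_apply_of_ne]
      · simp [ha]
      · exact fun h => ha h.symm
  rw [add_mul, e1, add_mul, EE_dg, Pi.mulSingle_eq_of_ne h, map_one, one_smul]
  ext a b
  rw [dg_apply, Matrix.add_apply, Matrix.mul_diagonal, Matrix.diagonal_mul, EE, Matrix.single_apply,
    sw, Matrix.submatrix_apply, Matrix.one_apply, Matrix.diagonal_apply]
  by_cases hb : b = f
  · subst hb
    simp [h]
    intro h; subst h; simp
  · rw [Pi.mulSingle_eq_of_ne hb, map_one, mul_one]
    by_cases ha : a = f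
    · subst ha
      simp [h, Ne.symm hb]
    · rw [Pi.mulSingle_eq_of_ne ha, map_one, one_mul]
      by_cases hai : a = i
      · subst hai
        by_cases hab : a = b
        · simp [hab, Ne.symm hb]
        · simp [hab, Ne.symm hb]
      · simp [Equiv.swap_apply_of_ne_of_ne hai ha, Ne.symm hai]

theorem sw_sw (i f : J) : sw F i f * sw F i f = 1 := by
  ext a b
  simp [sw, Matrix.mul_apply, Matrix.one_apply, Equiv.swap_apply_eq_iff]

theorem one_add_EE (i f : J) (h : i ≠ f) (c d : F) :
    (1 + c • EE F i f) * (1 + d • EE F i f) = 1 + (c + d) • EE F i f := by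
  have : EE F i f * EE F i f = 0 := Matrix.single_mul_single_of_ne _ _ _ _ (Ne.symm h) _
  rw [mul_add, mul_one, add_mul, one_mul, smul_mul_smul_comm, this, smul_zero, add_zero, add_smul,
    add_assoc]

theorem chi_mulSingle (τ : J → ℕ) (j : J) (x : SignType) :
    chi k τ (Pi.mulSingle j x) = sc k x ^ τ j := by
  rw [chi, Finset.prod_eq_single j]
  · simp
  · intro a _ ha; simp [Pi.mulSingle_eq_of_ne ha]
  · simp

theorem chi_mul (τ : J → ℕ) (o o' : J → SignType) : chi k τ (o * o') = chi k τ o * chi k τ o' := by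
  rw [chi, chi, chi, ← Finset.prod_mul_distrib]
  exact Finset.prod_congr rfl fun i _ => by rw [Pi.mul_apply, map_mul, mul_pow]

theorem chi_eq_of_idm (h2 : (2 : k) ≠ 0) {M : Type} [AddCommGroup M] [Module k M]
    {ρ : Representation k (J → SignType) M} (τ : J → Fin 3) (v : M) (c : k) (o : J → SignType)
    (h : ρ o v = c • v) (hv : ρ.asAlgebraHom (idm k τ) v ≠ 0) : chi k (fun j => (τ j : ℕ)) o = c := by
  have h1 := isW_idm (ρ := ρ) h2 τ v o
  have h3 : ρ o (ρ.asAlgebraHom (idm k τ) v) = c • ρ.asAlgebraHom (idm k τ) v := by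
    rw [← Representation.asAlgebraHom_of, ← Module.End.mul_apply, ← map_mul, mul_comm, map_mul,
      Module.End.mul_apply, Representation.asAlgebraHom_of, h, map_smul]
  rw [h1] at h3
  exact smul_left_injective k hv h3

theorem fin3_eq (h2 : (2 : k) ≠ 0) (a b : Fin 3) (h0 : (0 : k) ^ (a : ℕ) = 0 ^ (b : ℕ))
    (h1 : (-1 : k) ^ (a : ℕ) = (-1) ^ (b : ℕ)) : a = b := by
  have h3 : (-1 : k) ≠ 1 := fun h => h2 (by rw [← one_add_one_eq_two]; nth_rw 1 [← h]; simp)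
  fin_cases a <;> fin_cases b <;> simp_all [eq_comm]

theorem uv (h2 : (2 : k) ≠ 0) {M : Type} [AddCommGroup M] [Module k M]
    (ρ : Representation k (Matrix J J F) M) (i f : J) (hif : i ≠ f) (τ : J → Fin 3)
    (hf : τ f = 0) (hi : τ i ≠ 0) (t : M) (ht : IsW (fun j => (τ j : ℕ)) (ρ.comp (dg F J)) t) :
    ∃ v, ρ (1 + EE F i f) (ρ (sw F i f) t) = ρ (sw F i f) t + t + v ∧
      ρ (1 - EE F i f) (ρ (sw F i f) t) = ρ (sw F i f) t + (-1 : k) ^ (τ i : ℕ) • t +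
        ρ (dg F J (Pi.mulSingle i (-1))) v ∧
      ∀ τ' : J → Fin 3, Representation.asAlgebraHom (ρ.comp (dg F J)) (idm k τ') v ≠ 0 →
        (∀ j, j ≠ i → j ≠ f → τ' j = τ j) ∧ τ' i ≠ 0 ∧ τ' f ≠ 0 ∧
        ((τ' i : ℕ) + τ' f) % 2 = (τ i : ℕ) % 2 := by
  have ht0 : ∀ o, ρ (dg F J o) t = chi k (fun j => (τ j : ℕ)) o • t := ht
  have hz : ((τ i : Fin 3) : ℕ) ≠ 0 := fun h => hi (Fin.ext h)
  have hfz : ((τ f : Fin 3) : ℕ) = 0 := by rw [hf]; rfl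
  have hswp : ∀ o, ρ (dg F J o) (ρ (sw F i f) t) =
      chi k (fun j => (τ j : ℕ)) (fun j => o (Equiv.swap i f j)) • ρ (sw F i f) t := by
    intro o
    rw [← Module.End.mul_apply, ← map_mul, dg_sw, map_mul, Module.End.mul_apply, ht0, map_smul]
  have hsc : ∀ (a : J) (x : SignType), (fun j => (Pi.mulSingle a x : J → SignType) (Equiv.swap i f j)) =
      Pi.mulSingle (Equiv.swap i f a) x := by
    intro a x; funext j
    by_cases h : j = Equiv.swap i f a
    · subst h; simp
    · rw [Pi.mulSingle_eq_of_ne h, Pi.mulSingle_eq_of_ne]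
      rintro h'; exact h (by rw [← h', Equiv.swap_apply_self])
  refine ⟨ρ (1 + EE F i f) (ρ (sw F i f) t) - ρ (sw F i f) t - t, by abel, ?_, ?_⟩
  · have e1 : ρ (dg F J (Pi.mulSingle i (-1))) (ρ (sw F i f) t) = ρ (sw F i f) t := by
      rw [hswp, hsc, Equiv.swap_apply_left, chi_mulSingle, hfz, pow_zero, one_smul]
    have : dg F J (Pi.mulSingle i (-1)) * (1 + EE F i f) =
        (1 - EE F i f) * dg F J (Pi.mulSingle i (-1)) := by
      rw [mul_add, mul_one, sub_mul, one_mul, dg_EE, EE_dg, Pi.mulSingle_eq_same,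
        Pi.mulSingle_eq_of_ne (Ne.symm hif), sc_neg, map_one]
      simp [sub_eq_add_neg]
    rw [map_sub (ρ (dg F J (Pi.mulSingle i (-1)))), map_sub (ρ (dg F J (Pi.mulSingle i (-1)))), e1,
      ← Module.End.mul_apply (ρ (dg F J (Pi.mulSingle i (-1)))) (ρ (1 + EE F i f)),
      ← map_mul, this, map_mul, Module.End.mul_apply, e1, ht0, chi_mulSingle, sc_neg]
    abel
  · set v := ρ (1 + EE F i f) (ρ (sw F i f) t) - ρ (sw F i f) t - t with hv
    have c1 : ∀ o : J → SignType, o i = o f → ρ (dg F J o) v = chi k (fun j => (τ j : ℕ)) o • v := by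
      intro o ho
      have hoo : (fun j => o (Equiv.swap i f j)) = o := by
        funext j
        rw [Equiv.swap_apply_def]
        split_ifs with h h' <;> simp_all
      have hc : dg F J o * (1 + EE F i f) = (1 + EE F i f) * dg F J o := by
        rw [mul_add, add_mul, dg_EE, EE_dg, ho, mul_one, one_mul]
      rw [hv, map_sub, map_sub, ← Module.End.mul_apply (ρ _) (ρ _), ← map_mul, hc, map_mul,
        Module.End.mul_apply, hswp, hoo, ht0, map_smul, smul_sub, smul_sub]
    have c2 : ρ (dg F J (Pi.mulSingle f 0)) v = 0 := by
      have e : t = ρ (dg F J (Pi.mulSingle f 0)) t := by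
        rw [ht0, chi_mulSingle, hfz, pow_zero, one_smul]
      have e1 : ρ (dg F J (Pi.mulSingle f 0)) (ρ (1 + EE F i f) (ρ (sw F i f) t)) = t := by
        rw [← Module.End.mul_apply, ← Module.End.mul_apply, ← map_mul, ← map_mul]
        nth_rw 1 [e]
        rw [← Module.End.mul_apply, ← map_mul, key3 i f hif, ← e]
      rw [hv, map_sub, map_sub, e1, ← e, hswp, hsc, Equiv.swap_apply_right, chi_mulSingle, sc_zero,
        zero_pow hz, zero_smul, sub_zero, sub_self]
    have c3 : ρ (dg F J (Pi.mulSingle i 0)) v = 0 := by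
      have e1 : dg F J (Pi.mulSingle i 0) * (1 + EE F i f) = dg F J (Pi.mulSingle i 0) := by
        rw [mul_add, mul_one, dg_EE, Pi.mulSingle_eq_same, sc_zero, zero_smul, add_zero]
      rw [hv, map_sub, map_sub, ← Module.End.mul_apply, ← map_mul, e1, sub_self, ht0, chi_mulSingle,
        sc_zero, zero_pow hz, zero_smul, sub_zero]
    intro τ' hτ'
    refine ⟨fun j hji hjf => ?_, fun h => ?_, fun h => ?_, ?_⟩
    · have hx : ∀ x : SignType, sc k x ^ (τ' j : ℕ) = sc k x ^ (τ j : ℕ) := by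
        intro x
        have := chi_eq_of_idm h2 τ' v _ (Pi.mulSingle j x) (c1 (Pi.mulSingle j x) (by
          rw [Pi.mulSingle_eq_of_ne (Ne.symm hji), Pi.mulSingle_eq_of_ne (Ne.symm hjf)])) hτ'
        rwa [chi_mulSingle, chi_mulSingle] at this
      exact fin3_eq h2 _ _ (by simpa using hx 0) (by simpa using hx (-1))
    · have := chi_eq_of_idm h2 τ' v 0 (Pi.mulSingle i 0) (c3.trans (zero_smul _ _).symm) hτ'
      rw [chi_mulSingle, h] at this
      simp at this
    · have := chi_eq_of_idm h2 τ' v 0 (Pi.mulSingle f 0) (c2.trans (zero_smul _ _).symm) hτ'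
      rw [chi_mulSingle, h] at this
      simp at this
    · have := chi_eq_of_idm h2 τ' v _ (Pi.mulSingle i (-1) * Pi.mulSingle f (-1))
        (c1 _ (by simp [Pi.mulSingle_eq_of_ne hif, Pi.mulSingle_eq_of_ne (Ne.symm hif)])) hτ'
      rw [chi_mul, chi_mul, chi_mulSingle, chi_mulSingle, chi_mulSingle, chi_mulSingle, sc_neg, hfz,
        pow_zero, mul_one, ← pow_add] at this
      have h3 : (-1 : k) ≠ 1 := fun h => h2 (by rw [← one_add_one_eq_two]; nth_rw 1 [← h]; simp)
      rcases Nat.even_or_odd ((τ' i : ℕ) + τ' f) with h | h <;>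
        rcases Nat.even_or_odd (τ i : ℕ) with h' | h'
      · rw [Nat.even_iff.1 h, Nat.even_iff.1 h']
      · rw [h.neg_one_pow, h'.neg_one_pow] at this; exact absurd this.symm h3
      · rw [h.neg_one_pow, h'.neg_one_pow] at this; exact absurd this h3
      · rw [Nat.odd_iff.1 h, Nat.odd_iff.1 h']

theorem tot_inl {I : Type} [Fintype I] (τ : I ⊕ Unit → Fin 3) :
    tot τ = ∑ i, (τ (Sum.inl i) : ℕ) + τ (Sum.inr ()) := by
  rw [tot, Fintype.sum_sum_type]; simp

/-- block embedding -/
def emb (F : Type) [Field F] (I K : Type) [Fintype I] [DecidableEq I] [Fintype K] [DecidableEq K] :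
    Matrix I I F →* Matrix (I ⊕ K) (I ⊕ K) F where
  toFun x := Matrix.fromBlocks x 0 0 1
  map_one' := Matrix.fromBlocks_one
  map_mul' a b := by rw [Matrix.fromBlocks_multiply]; simp

/-- shears -/
def shr {F : Type} [Field F] {I : Type} [Fintype I] [DecidableEq I] (v : I → F) :
    Matrix (I ⊕ Unit) (I ⊕ Unit) F := Matrix.fromBlocks 1 (Matrix.of fun i _ => v i) 0 1

theorem shr_single {I : Type} [Fintype I] [DecidableEq I] (i : I) (c : F) :
    shr (Pi.single i c) = 1 + c • EE F (Sum.inl i) (Sum.inr ()) := by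
  ext a b
  rcases a with a | a <;> rcases b with b | b <;>
    simp [shr, EE, Matrix.single_apply, Matrix.one_apply, Pi.single_apply, @eq_comm _ i]

theorem emb_dg {I K : Type} [Fintype I] [DecidableEq I] [Fintype K] [DecidableEq K] (o : I → SignType) :
    emb F I K (dg F I o) = dg F (I ⊕ K) (Sum.elim o 1) := by
  ext a b
  rcases a with a | a <;> rcases b with b | b <;>
    simp [emb, dg_apply, Matrix.diagonal_apply, Matrix.one_apply]

theorem chi_elim {I K : Type} [Fintype I] [Fintype K] (τ : I ⊕ K → ℕ) (o : I → SignType) :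
    chi k τ (Sum.elim o 1) = chi k (fun i => τ (Sum.inl i)) o := by
  rw [chi, chi, Fintype.prod_sum_type]; simp

theorem R0 (h2 : (2 : k) ≠ 0) {I : Type} [Fintype I] [DecidableEq I] {M M' : Type} [AddCommGroup M]
    [Module k M] [AddCommGroup M'] [Module k M']
    (ρ : Representation k (Matrix (I ⊕ Unit) (I ⊕ Unit) F) M)
    (ρ' : Representation k (I → SignType) M') (f : M →ₗ[k] M') (hf : Function.Surjective f)
    (hs : ∀ (v : I → F) m, f (ρ (shr v) m) = f m)
    (he : ∀ o m, f (ρ (emb F I Unit (dg F I o)) m) = ρ' o (f m)) (κ : ℕ)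
    (hW : Wt (κ + 1) (ρ.comp (dg F (I ⊕ Unit)))) : Wt κ ρ' := by
  refine Wt.of_span h2 fun m' => ?_
  obtain ⟨m, rfl⟩ := hf m'
  refine hW.ind h2 (Submodule.comap f (Submodule.span k _)) (fun τ hτ t ht => ?_) m
  have hw : IsW (fun i => ((τ (Sum.inl i) : Fin 3) : ℕ)) ρ' (f t) := by
    intro o
    rw [← he, emb_dg]
    have := ht (Sum.elim o 1)
    rw [chi_elim] at this
    rw [← map_smul]
    exact congrArg f this
  by_cases hle : ∑ i, (τ (Sum.inl i) : ℕ) ≤ κ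
  · exact Submodule.subset_span ⟨_, hle, hw⟩
  suffices f t = 0 by rw [Submodule.mem_comap, this]; exact zero_mem _
  rw [tot_inl] at hτ
  have hfz : τ (Sum.inr ()) = 0 := Fin.ext (by simp; omega)
  obtain ⟨i, -, hi⟩ := Finset.exists_ne_zero_of_sum_ne_zero
    (s := Finset.univ) (f := fun i => (τ (Sum.inl i) : ℕ)) (by omega)
  have hi' : τ (Sum.inl i) ≠ 0 := fun h => hi (by simp [h])
  obtain ⟨v, e1, e2, hv⟩ := uv h2 ρ (Sum.inl i) (Sum.inr ()) (by simp) τ hfz hi' t ht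
  have hv' : ∀ τ' : I ⊕ Unit → Fin 3,
      Representation.asAlgebraHom (ρ.comp (dg F (I ⊕ Unit))) (idm k τ') v ≠ 0 →
        τ' (Sum.inl i) = 1 ∧ τ (Sum.inl i) = 2 := by
    intro τ' hne
    obtain ⟨h3, h4, h5, h6⟩ := hv τ' hne
    have h7 : tot τ' ≤ κ + 1 := by
      by_contra hcon
      exact hne (hW τ' (by omega) v)
    rw [tot_inl, ← Finset.add_sum_erase _ _ (Finset.mem_univ i)] at h7
    rw [← Finset.add_sum_erase _ _ (Finset.mem_univ i)] at hle
    rw [Finset.sum_congr rfl (fun j hj => by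
      rw [h3 (Sum.inl j) (by simpa using Finset.ne_of_mem_erase hj) (by simp)])] at h7
    have h4' : (τ' (Sum.inl i) : ℕ) ≠ 0 := fun h => h4 (Fin.ext h)
    have h5' : (τ' (Sum.inr ()) : ℕ) ≠ 0 := fun h => h5 (Fin.ext h)
    constructor <;> apply Fin.ext <;> simp <;> omega
  have E1 : 1 + EE F (Sum.inl i) (Sum.inr ()) = shr (Pi.single i 1) := by rw [shr_single, one_smul]
  have E2 : 1 - EE F (Sum.inl i) (Sum.inr ()) = shr (Pi.single i (-1)) := by
    rw [shr_single, neg_smul, one_smul, sub_eq_add_neg]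
  have f1 := congrArg f e1
  have f2 := congrArg f e2
  rw [E1, hs, map_add, map_add] at f1
  rw [E2, hs, map_add, map_add, map_smul] at f2
  by_cases hv0 : v = 0
  · rw [hv0, map_zero, add_zero] at f1
    exact left_eq_add.1 f1
  obtain ⟨τ0, h0⟩ : ∃ τ' : I ⊕ Unit → Fin 3,
      Representation.asAlgebraHom (ρ.comp (dg F (I ⊕ Unit))) (idm k τ') v ≠ 0 := by
    by_contra hcon
    push Not at hcon
    apply hv0
    rw [← sum_act (ρ := ρ.comp (dg F (I ⊕ Unit))) h2 v]
    exact Finset.sum_eq_zero fun τ' _ => hcon τ'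
  have hti := (hv' τ0 h0).2
  have hsv : ρ (dg F _ (Pi.mulSingle (Sum.inl i) (-1))) v = - v := by
    have := sum_act (ρ := ρ.comp (dg F (I ⊕ Unit))) h2 v
    conv_lhs => rw [← this]
    conv_rhs => rw [← this]
    rw [map_sum, ← Finset.sum_neg_distrib]
    refine Finset.sum_congr rfl fun τ' _ => ?_
    by_cases hne : Representation.asAlgebraHom (ρ.comp (dg F (I ⊕ Unit))) (idm k τ') v = 0
    · rw [hne]; simp
    · have := isW_idm (ρ := ρ.comp (dg F (I ⊕ Unit))) h2 τ' v (Pi.mulSingle (Sum.inl i) (-1))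
      rw [chi_mulSingle, (hv' τ' hne).1] at this
      refine Eq.trans this ?_
      simp
  rw [hsv, map_neg, hti] at f2
  simp at f2
  have g1 : f t + f v = 0 := by
    have := f1; rw [add_assoc] at this; exact left_eq_add.1 this
  have g2 : f t - f v = 0 := by
    have := f2; rw [add_assoc] at this; rw [sub_eq_add_neg]; exact left_eq_add.1 this
  have : (2 : k) • f t = 0 := by
    rw [two_smul]
    calc f t + f t = (f t + f v) + (f t - f v) := by abel
      _ = 0 := by rw [g1, g2, add_zero]
  exact (smul_eq_zero.1 this).resolve_left h2

end uv
end GH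

end

/-! ## Part I -/

section
set_option linter.unusedSectionVars false

namespace GH
variable {k : Type} [Field k]

section gen
variable {Q N N' M : Type} [Monoid Q] [Group N] [Group N'] [AddCommGroup M] [Module k M]

theorem SES.sub {G A B C : Type} [Group G] [AddCommGroup A] [Module k A] [AddCommGroup B] [Module k B]
    [AddCommGroup C] [Module k C] {a : Representation k G A} {b : Representation k G B}
    {c : Representation k G C} {f : A →ₗ[k] B} {g : B →ₗ[k] C} (S : SES a b c f g) (j : ℕ)
    (h1 : Subsingleton (H j a)) (h3 : Subsingleton (H j c)) : Subsingleton (H j b) := by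
  refine subsingleton_of_forall_eq 0 fun x => ?_
  obtain ⟨y, rfl⟩ := (S.exact₂ j x).1 (Subsingleton.elim _ _)
  rw [Subsingleton.elim y 0, map_zero]

theorem H_iso {G G' : Type} [Group G] [Group G'] [Finite G'] (e : G →* G') (he : Function.Bijective e)
    (ρ : Representation k G' M) (j : ℕ) (h : Subsingleton (H j (ρ.comp e))) :
    Subsingleton (H j ρ) := by
  have := cor_surj e he.1 (by rw [MonoidHom.range_eq_top.2 he.2]; simp) ρ j
  exact this.subsingleton

theorem kills_one {ρ : Representation k Q M} : Kills 1 ρ ↔ Subsingleton M := by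
  constructor
  · intro h
    refine subsingleton_of_forall_eq 0 fun x => ?_
    have := h x
    rwa [map_one] at this
  · intro h m; exact Subsingleton.elim _ _

/-- trivial operators -/
def tExt (c : GAct N' N) : Ext Unit N (Semi c) N' :=
  Ext.semi c (GAct.triv _ _) (GAct.triv _ _) (fun _ _ _ => rfl)

/-- trivial operators on a representation -/
def tCR (c : GAct N' N) (σ : Representation k (Semi c) M) : CRep k (tExt c).aX M where
  n := σ
  q := 1
  comm := fun _ _ _ => rfl

theorem semi_D (α : GAct Q N) (f : N' →* Q)
    (σ : Representation k (Semi (α.comp f)) M) (cr : CRep k α M)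
    (h1 : σ.comp SemidirectProduct.inl = cr.n) (h2 : ∀ y, σ (SemidirectProduct.inr y) = cr.q (f y))
    (i j : ℕ) (h : Subsingleton (H i ((D cr j).comp f))) :
    Subsingleton (H i (D ((tExt _).resN (tCR _ σ)) j)) := by
  obtain ⟨n, q, comm⟩ := cr
  subst h1
  have e : @Eq (Representation k N' (H j (σ.comp SemidirectProduct.inl)))
      (D ((tExt _).resN (tCR _ σ)) j) ((D (α := α) ⟨_, q, comm⟩ j).comp f) :=
    MonoidHom.ext fun y => Hmap_congr _ _ rfl (h2 y) j
  exact e ▸ h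

theorem semi_vanish [Finite N] [Finite N'] (α : GAct Q N) (f : N' →* Q)
    (σ : Representation k (Semi (α.comp f)) M) (cr : CRep k α M)
    (h1 : σ.comp SemidirectProduct.inl = cr.n) (h2 : ∀ y, σ (SemidirectProduct.inr y) = cr.q (f y))
    (a : ℕ) (h : ∀ i j, i + j = a → Subsingleton (H i ((D cr j).comp f))) :
    Subsingleton (H a σ) := by
  have := (tExt (α.comp f)).kills (e := 1) (mul_one 1) a (tCR _ σ) (fun i j hij => kills_one.2 ?_)
  · exact (kills_one (ρ := D (tCR _ σ) a)).1 this
  · exact semi_D α f σ cr h1 h2 i j (h i j hij)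

theorem semi_edge [Finite N] [Finite N'] (α : GAct Q N) (f : N' →* Q)
    (cr : CRep k α M)
    (h1 : ∀ n, cr.n n = 1) (h2 : ∀ q, cr.q q = 1)
    (a : ℕ) (h : ∀ i j, i + j + 1 = a → Subsingleton (H i ((D cr (j + 1)).comp f)))
    (hc : Compat (1 : Representation k (Semi (α.comp f)) M) 1
      (SemidirectProduct.inr.comp SemidirectProduct.rightHom) LinearMap.id)
    (x : H a (1 : Representation k (Semi (α.comp f)) M)) : Hmap hc a x = x := by
  let E := tExt (α.comp f)
  let m : CRep k E.aX M := tCR _ 1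
  have key := E.edge_inj (e := 1) (mul_one 1) a m (fun i j hij => kills_one.2
    (semi_D α f 1 cr (by ext n : 1; exact (h1 n).symm) (fun y => (h2 _).symm) i (j + 1) (h i j hij)))
    (show H a m.n from Hmap hc a x - x) (by
      refine ((E.edge m a).map_sub (Hmap hc a x) x).trans (sub_eq_zero.2 ?_)
      refine (Hmap_comp_apply (E.edgeCompat m) hc a x).trans ?_
      exact congrArg (fun t : _ →ₗ[k] _ => t x) (Hmap_congr _ _ (by ext y; rfl) (by ext; rfl) a))
  rw [map_one] at key
  exact sub_eq_zero.1 (key : Hmap hc a x - x = 0)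

end gen

section weights2
variable {F : Type} [Field F] {I J : Type} [Fintype I] [DecidableEq I] [Fintype J] [DecidableEq J]
variable {M : Type} [AddCommGroup M] [Module k M]

/-- pulling back weights along a map dividing characters -/
theorem Wt.pull (h2 : (2 : k) ≠ 0) {b : ℕ} {ρ : Representation k (J → SignType) M}
    {ρ' : Representation k (I → SignType) M} (h : Wt b ρ)
    (g : (I → SignType) → (J → SignType)) (hg : ∀ o, ρ' o = ρ (g o))
    (hc : ∀ τ : J → Fin 3, ∃ σ : I → ℕ, ∑ i, σ i ≤ tot τ ∧ ∀ o, chi k (fun j => (τ j : ℕ)) (g o) = chi k σ o) :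
    Wt b ρ' := by
  refine Wt.of_span h2 fun m => ?_
  refine h.ind h2 _ (fun τ hτ t ht => ?_) m
  obtain ⟨σ, h3, h4⟩ := hc τ
  refine Submodule.subset_span ⟨σ, h3.trans hτ, fun o => ?_⟩
  rw [hg, ht, h4]

theorem Wt.inl (h2 : (2 : k) ≠ 0) {b : ℕ} {ρ : Representation k (Matrix (I ⊕ J) (I ⊕ J) F) M}
    (h : Wt b (ρ.comp (dg F (I ⊕ J)))) : Wt b ((ρ.comp (emb F I J)).comp (dg F I)) := by
  refine h.pull h2 (fun o => Sum.elim o 1) (fun o => ?_) (fun τ => ⟨fun i => τ (Sum.inl i), ?_, fun o => ?_⟩)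
  · change ρ (emb F I J (dg F I o)) = ρ _
    rw [emb_dg]
  · rw [tot, Fintype.sum_sum_type]; simp
  · rw [chi_elim]

/-- reindexing -/
def rx (F : Type) [Field F] (e : I ≃ J) : Matrix I I F →* Matrix J J F :=
  (Matrix.reindexAlgEquiv F F e : Matrix I I F →* Matrix J J F)

theorem rx_bij (e : I ≃ J) : Function.Bijective (rx F e) := (Matrix.reindexAlgEquiv F F e).bijective

theorem rx_dg (e : I ≃ J) (o : I → SignType) : rx F e (dg F I o) = dg F J (fun j => o (e.symm j)) := by
  ext a b
  simp [rx, dg_apply, Matrix.diagonal_apply]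

theorem Wt.rx (h2 : (2 : k) ≠ 0) {b : ℕ} {ρ : Representation k (Matrix J J F) M} (e : I ≃ J)
    (h : Wt b (ρ.comp (dg F J))) : Wt b ((ρ.comp (rx F e)).comp (dg F I)) := by
  refine h.pull h2 (fun o j => o (e.symm j)) (fun o => ?_) (fun τ => ⟨fun i => τ (e i), ?_, fun o => ?_⟩)
  · change ρ (GH.rx F e (dg F I o)) = ρ _
    rw [rx_dg]
  · rw [tot, ← e.sum_comp]
  · rw [chi, chi, ← e.prod_comp]; simp

/-- units -/
abbrev GLu (F : Type) [Field F] (I : Type) [Fintype I] [DecidableEq I] := (Matrix I I F)ˣ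

/-- inclusion of units -/
def co (F : Type) [Field F] (I : Type) [Fintype I] [DecidableEq I] : GLu F I →* Matrix I I F :=
  Units.coeHom _

theorem units_bij {A B : Type} [Monoid A] [Monoid B] (f : A →* B) (h : Function.Bijective f) :
    Function.Bijective (Units.map f) := by
  refine ⟨Units.map_injective h.1, fun u => ?_⟩
  let e := MulEquiv.ofBijective f h
  exact ⟨Units.map e.symm.toMonoidHom u, Units.ext (e.apply_symm_apply _)⟩

/-- affine action -/
def amat (F : Type) [Field F] (I : Type) [Fintype I] [DecidableEq I] :
    GAct (Matrix I I F) (Multiplicative (I → F)) :=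
  addAct (fun x => (Matrix.mulVecLin x).toAddMonoidHom) (fun a => by simp) (fun x y a => by simp)

theorem amat_apply (x : Matrix I I F) (v : I → F) :
    (amat F I).f x (Multiplicative.ofAdd v) = Multiplicative.ofAdd (x.mulVec v) := rfl

/-- shears as a homomorphism -/
def shrH (F : Type) [Field F] (I : Type) [Fintype I] [DecidableEq I] :
    Multiplicative (I → F) →* Matrix (I ⊕ Unit) (I ⊕ Unit) F where
  toFun v := shr v.toAdd
  map_one' := by
    ext a b
    rcases a with a | a <;> rcases b with b | b <;> simp [shr, Matrix.one_apply]
  map_mul' u v := by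
    rw [shr, shr, shr, Matrix.fromBlocks_multiply]
    congr 1 <;> simp
    ext a b; simp [add_comm]

theorem emb_shr (x : Matrix I I F) (v : Multiplicative (I → F)) :
    emb F I Unit x * shrH F I v = shrH F I ((amat F I).f x v) * emb F I Unit x := by
  change Matrix.fromBlocks x 0 0 1 * shr _ = shr (x.mulVec v.toAdd) * Matrix.fromBlocks x 0 0 1
  rw [shr, shr, Matrix.fromBlocks_multiply, Matrix.fromBlocks_multiply]
  congr 1 <;> simp
  ext a b
  simp [Matrix.mul_apply, Matrix.mulVec, dotProduct]

/-- affine group -/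
abbrev AffG (F : Type) [Field F] (I : Type) [Fintype I] [DecidableEq I] :=
  Semi ((amat F I).comp (co F I))

/-- affine group into GL -/
def affGL (F : Type) [Field F] (I : Type) [Fintype I] [DecidableEq I] : AffG F I →* GLu F (I ⊕ Unit) :=
  Semi.lift (shrH F I).toHomUnits (Units.map (emb F I Unit)) (fun _ _ => Units.ext (emb_shr _ _))

theorem affGL_coe (x : AffG F I) :
    Units.val (affGL F I x) = Matrix.fromBlocks x.right.1 (Matrix.of fun i _ => x.left.toAdd i) 0 1 := by
  change shr _ * Matrix.fromBlocks x.right.1 0 0 1 = _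
  rw [shr, Matrix.fromBlocks_multiply]; simp

theorem affGL_inj : Function.Injective (affGL F I) := by
  intro x y h
  have := congrArg (fun u : GLu F (I ⊕ Unit) => u.1) h
  simp only [affGL_coe, Matrix.fromBlocks_inj] at this
  ext i
  · exact congrFun (congrFun this.2.1 i) ()
  · exact congrFun (congrFun this.1 _) _

theorem card_GLu [Fintype F] (n : ℕ) (h : Fintype.card I = n) :
    Nat.card (GLu F I) = ∏ i : Fin n, (Fintype.card F ^ n - Fintype.card F ^ (i : ℕ)) := by
  rw [← Matrix.card_GL_field]
  exact Nat.card_congr (Equiv.ofBijective _ (units_bij _ (rx_bij (F := F) (Fintype.equivFinOfCardEq h))))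

theorem affGL_index [Fintype F] (p : ℕ) [Fact p.Prime] [CharP k p] [CharP F p] :
    ((affGL F I).range.index : k) ≠ 0 := by
  set q := Fintype.card F with hq
  set n := Fintype.card I with hn
  have h1 : Nat.card (GLu F (I ⊕ Unit)) = (q ^ (n + 1) - 1) * (q ^ n * Nat.card (GLu F I)) := by
    rw [card_GLu n rfl, card_GLu (n + 1) (by simp [hn]), Fin.prod_univ_succ]
    refine congrArg₂ _ (by simp [hq]) ?_
    · have : q ^ n = ∏ i : Fin n, q := by simp
      nth_rw 1 [this]
      rw [← Finset.prod_mul_distrib]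
      refine Finset.prod_congr rfl fun i _ => ?_
      rw [Nat.mul_sub, Fin.val_succ, pow_succ', pow_succ', hq]
  have h2 : Nat.card (AffG F I) = q ^ n * Nat.card (GLu F I) := by
    rw [Nat.card_congr SemidirectProduct.equivProd, Nat.card_prod]
    congr 1
    rw [Nat.card_congr Multiplicative.toAdd, Nat.card_eq_fintype_card, Fintype.card_fun]
  have h3 : Nat.card (affGL F I).range = q ^ n * Nat.card (GLu F I) := by
    rw [← h2]; exact (Nat.card_congr (MonoidHom.ofInjective affGL_inj).toEquiv).symm
  have h4 := (affGL F I).range.card_mul_index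
  have hq0 : 0 < q := Fintype.card_pos
  have h5 : (affGL F I).range.index = q ^ (n + 1) - 1 := by
    have hpos : 0 < q ^ n * Nat.card (GLu F I) := by rw [← h2]; exact Nat.card_pos
    rw [h3, h1, mul_comm (q ^ (n + 1) - 1)] at h4
    exact Nat.eq_of_mul_eq_mul_left hpos h4
  rw [h5, Nat.cast_sub (Nat.one_le_pow _ _ hq0), Nat.cast_pow]
  have : (q : k) = 0 := by
    rw [CharP.cast_eq_zero_iff k p, ← CharP.cast_eq_zero_iff F p, hq, Nat.cast_card_eq_zero]
  rw [this]
  simp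

end weights2
end GH

end

/-! ## Part J -/

section
set_option linter.unusedSectionVars false

namespace GH
variable {k : Type} [Field k]

/-- restriction of operators -/
def CRep.comp {Q Q' N M : Type} [Monoid Q] [Monoid Q'] [Group N] [AddCommGroup M] [Module k M]
    {α : GAct Q N} (c : CRep k α M) (f : Q' →* Q) : CRep k (α.comp f) M where
  n := c.n
  q := c.q.comp f
  comm := fun x => c.comm (f x)

theorem CRep.D_comp {Q Q' N M : Type} [Monoid Q] [Monoid Q'] [Group N] [AddCommGroup M] [Module k M]
    {α : GAct Q N} (c : CRep k α M) (f : Q' →* Q) (j : ℕ) : D (c.comp f) j = (D c j).comp f := rfl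

section Z
variable {G G' G'' : Type} [Group G] [Group G'] [Group G''] {M : Type} [AddCommGroup M] [Module k M]

/-- trivial coefficients -/
theorem tc (k M : Type) [Field k] [AddCommGroup M] [Module k M] {G G' : Type} [Group G] [Group G']
    (φ : G →* G') : Compat (1 : Representation k G M) (1 : Representation k G' M) φ LinearMap.id :=
  fun _ _ => rfl

/-- zero on homology -/
def Zr (k M : Type) [Field k] [AddCommGroup M] [Module k M] {G G' : Type} [Group G] [Group G'] (a : ℕ)
    (φ : G →* G') : Prop := ∀ x, Hmap (tc k M φ) a x = 0

theorem tc_comp (ψ : G' →* G'') (φ : G →* G') (a : ℕ) (x) :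
    Hmap (tc k M (ψ.comp φ)) a x = Hmap (tc k M ψ) a (Hmap (tc k M φ) a x) :=
  (Hmap_comp_apply (tc k M ψ) (tc k M φ) a x).symm

theorem Zr.left {a : ℕ} {φ : G →* G'} (h : Zr k M a φ) (ψ : G' →* G'') : Zr k M a (ψ.comp φ) :=
  fun x => by rw [tc_comp, h, map_zero]

theorem Zr.right {a : ℕ} {φ : G' →* G''} (h : Zr k M a φ) (χ : G →* G') : Zr k M a (φ.comp χ) :=
  fun x => by rw [tc_comp, h]

theorem Zr.of_surj {a : ℕ} {φ : G' →* G''} {χ : G →* G'}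
    (hs : Function.Surjective (Hmap (tc k M χ) a)) (h : Zr k M a (φ.comp χ)) : Zr k M a φ := by
  intro x
  obtain ⟨x, rfl⟩ := hs x
  rw [← tc_comp, h]

theorem tc_surj [Finite G'] (f : G →* G') (hf : Function.Injective f)
    (hi : (f.range.index : k) ≠ 0) (j : ℕ) :
    Function.Surjective (Hmap (tc k M f) j) := cor_surj f hf hi 1 j

theorem tc_surj_bij [Finite G'] (f : G →* G') (hf : Function.Bijective f) (j : ℕ) :
    Function.Surjective (Hmap (tc k M f) j) :=
  tc_surj f hf.1 (by rw [MonoidHom.range_eq_top.2 hf.2]; simp) j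

end Z

section T
variable {F : Type} [Field F] {I J : Type} [Fintype I] [DecidableEq I] [Fintype J] [DecidableEq J]
variable {M : Type} [AddCommGroup M] [Module k M]

theorem h0_unit (ρ : Representation k (Matrix I I F) M) (x y : Matrix I I F) (h : x * y = 1)
    (h' : y * x = 1) (m : M) : h0 (ρ.comp (co F I)) (ρ x m) = h0 (ρ.comp (co F I)) m :=
  h0_rho (ρ := ρ.comp (co F I)) (⟨x, y, h, h'⟩ : GLu F I) m

theorem T0 (h2 : (2 : k) ≠ 0) (ρ : Representation k (Matrix I I F) M) (c : ℕ)
    (hc : c < Fintype.card I) (h0' : ρ 0 = 0) (hW : Wt (2 * c + 1) (ρ.comp (dg F I))) :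
    Subsingleton (H 0 (ρ.comp (co F I))) := by
  have hodd : ∀ (τ : I → Fin 3) (i : I), τ i = 1 → ∀ t, IsW (fun j => (τ j : ℕ)) (ρ.comp (dg F I)) t →
      h0 (ρ.comp (co F I)) t = 0 := by
    intro τ i hi t ht
    have e : dg F I (Pi.mulSingle i (-1)) * dg F I (Pi.mulSingle i (-1)) = 1 := by
      rw [← map_mul, ← Pi.mulSingle_mul]
      have : (-1 : SignType) * -1 = 1 := rfl
      rw [this, Pi.mulSingle_one, map_one]
    have h3 := h0_unit ρ _ _ e e t
    have h4 : ρ (dg F I (Pi.mulSingle i (-1))) t = - t := by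
      have := ht (Pi.mulSingle i (-1))
      rw [chi_mulSingle, hi] at this
      refine Eq.trans this ?_
      simp
    rw [h4, map_neg] at h3
    have : (2 : k) • h0 (ρ.comp (co F I)) t = 0 := by
      rw [two_smul]; nth_rw 1 [← h3]; simp
    exact (smul_eq_zero.1 this).resolve_left h2
  have key : ∀ (s : ℕ) (τ : I → Fin 3), 2 * c + 2 ≤ tot τ + s → ∀ t,
      IsW (fun j => (τ j : ℕ)) (ρ.comp (dg F I)) t → h0 (ρ.comp (co F I)) t = 0 := by
    intro s
    induction s with
    | zero =>
      intro τ hτ t ht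
      rw [hW.vec h2 τ t ht (by omega), map_zero]
    | succ s ih =>
      intro τ hτ t ht
      by_cases hs : 2 * c + 2 ≤ tot τ + s
      · exact ih τ hs t ht
      by_cases ho : ∃ i, τ i = 1
      · obtain ⟨i, hi⟩ := ho
        exact hodd τ i hi t ht
      push Not at ho
      by_cases hz : ∀ i, τ i = 0
      · have h3 := ht 0
        have e : dg F I 0 = 0 := by ext a b; simp [dg_apply, Matrix.diagonal_apply]
        have h4 : chi k (fun j => (τ j : ℕ)) (0 : I → SignType) = 1 := by simp [chi, hz]
        rw [h4, one_smul] at h3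
        have h5 : ρ (dg F I 0) t = t := h3
        rw [e, h0'] at h5
        rw [← h5]; simp
      push Not at hz
      obtain ⟨i, hi⟩ := hz
      have hf : ∃ f, τ f = 0 := by
        by_contra hcon
        push Not at hcon
        have : tot τ = ∑ _j : I, 2 := Finset.sum_congr rfl fun j _ => by
          have h3 := ho j
          have h4 := hcon j
          have : ∀ x : Fin 3, x ≠ 1 → x ≠ 0 → (x : ℕ) = 2 := by decide
          exact this _ h3 h4
        simp at this
        omega
      obtain ⟨f, hf⟩ := hf
      have hif : i ≠ f := by rintro rfl; exact hi hf
      obtain ⟨v, e1, -, hv⟩ := uv h2 ρ i f hif τ hf hi t ht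
      have e2 := congrArg (h0 (ρ.comp (co F I))) e1
      have hu1 : (1 + EE F i f) * (1 - EE F i f) = 1 := by
        have := one_add_EE (F := F) i f hif 1 (-1)
        simpa [sub_eq_add_neg] using this
      have hu2 : (1 - EE F i f) * (1 + EE F i f) = 1 := by
        have := one_add_EE (F := F) i f hif (-1) 1
        simpa [sub_eq_add_neg] using this
      rw [h0_unit ρ _ _ hu1 hu2, map_add, map_add] at e2
      have hv0 : h0 (ρ.comp (co F I)) v = 0 := by
        rw [← sum_act (ρ := ρ.comp (dg F I)) h2 v, map_sum]
        refine Finset.sum_eq_zero fun τ' _ => ?_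
        by_cases hne : Representation.asAlgebraHom (ρ.comp (dg F I)) (idm k τ') v = 0
        · rw [hne, map_zero]
        obtain ⟨h3, h4, h5, h6⟩ := hv τ' hne
        by_cases h7 : τ' i = 1
        · exact hodd τ' i h7 _ (isW_idm h2 τ' v)
        have t2 : ∀ x : Fin 3, x ≠ 1 → x ≠ 0 → (x : ℕ) = 2 := by decide
        have hti := t2 _ (ho i) hi
        have hti' := t2 _ h7 h4
        have htf' : (τ' f : ℕ) ≠ 0 := fun h => h5 (Fin.ext h)
        refine ih τ' ?_ _ (isW_idm h2 τ' v)
        have : tot τ + 1 ≤ tot τ' := by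
          rw [tot, tot, ← Finset.add_sum_erase _ _ (Finset.mem_univ i),
            ← Finset.add_sum_erase _ _ (Finset.mem_erase.2 ⟨Ne.symm hif, Finset.mem_univ f⟩),
            ← Finset.add_sum_erase _ (fun j => (τ' j : ℕ)) (Finset.mem_univ i),
            ← Finset.add_sum_erase _ (fun j => (τ' j : ℕ)) (Finset.mem_erase.2 ⟨Ne.symm hif, Finset.mem_univ f⟩),
            Finset.sum_congr rfl (fun j hj => by
              rw [h3 j (Finset.ne_of_mem_erase (Finset.mem_of_mem_erase hj)) (Finset.ne_of_mem_erase hj)] :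
              ∀ j ∈ (Finset.univ.erase i).erase f, ((τ' j : Fin 3) : ℕ) = τ j)]
          have : (τ f : ℕ) = 0 := by rw [hf]; rfl
          omega
        omega
      rw [hv0, add_zero] at e2
      exact left_eq_add.1 e2
  refine subsingleton_of_forall_eq 0 fun x => ?_
  obtain ⟨m, rfl⟩ := h0_surj _ x
  exact hW.ind h2 (LinearMap.ker (h0 (ρ.comp (co F I))))
    (fun τ _ t ht => key (2 * c + 2) τ (by omega) t ht) m

/-- main vanishing statement for GL -/
def TT (k F : Type) [Field k] [Field F] (m : ℕ) : Prop :=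
  ∀ (I : Type) [Fintype I] [DecidableEq I] (a c : ℕ), a + c ≤ m → a + c < Fintype.card I →
  ∀ (M : Type) [AddCommGroup M] [Module k M] (ρ : Representation k (Matrix I I F) M), ρ 0 = 0 →
    Wt (2 * c + 1) (ρ.comp (dg F I)) → Subsingleton (H a (ρ.comp (co F I)))

theorem TT.mono {m m' : ℕ} (h : TT k F m) (hm : m' ≤ m) : TT k F m' :=
  fun I _ _ a c h1 h2 => h I a c (h1.trans hm) h2

theorem amat_good (h2 : (2 : k) ≠ 0) (p : ℕ) [Fact p.Prime] [CharP k p] [Finite k]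
    [CharP F p] [Finite F] : Good k 1 ((amat F I).comp (dg F I)) := by
  refine Good.iso h2 p (Good.vec (F := F) h2 p 1 I (fun j i => if i = j then 1 else 0) (by simp))
    (MulEquiv.refl _) fun o n => ?_
  change Multiplicative.ofAdd ((dg F I o).mulVec n.toAdd) = Multiplicative.ofAdd _
  congr 1
  funext j
  rw [dg_apply, Matrix.mulVec_diagonal]
  congr 1
  change _ = sc F (sg _ o)
  rw [sc_sg, chi, Finset.prod_eq_single j]
  · simp
  · intro b _ hb; simp [hb]
  · simp

theorem amat_wt (h2 : (2 : k) ≠ 0) (p : ℕ) [Fact p.Prime] [CharP k p] [Finite k]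
    [CharP F p] [Finite F] (cr : CRep k (amat F I) M) (b l : ℕ) (h : Wt b (cr.q.comp (dg F I))) :
    Wt (b + l) ((D cr l).comp (dg F I)) := by
  have := amat_good (I := I) (F := F) h2 p M (cr.comp (dg F I)) b l h
  rw [one_mul] at this
  exact this

theorem amat_red (cr : CRep k (amat F I) M) (l : ℕ) : D cr (l + 1) 0 = 0 := by
  ext x
  refine Hmap_triv _ (fun g => ?_) l x
  change Multiplicative.ofAdd ((0 : Matrix I I F).mulVec g.toAdd) = 1
  rw [Matrix.zero_mulVec]; rfl

theorem wt_one {G : Type} [Monoid G] (h2 : (2 : k) ≠ 0) (f : (I → SignType) →* G) :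
    Wt 0 ((1 : Representation k G M).comp f) := by
  refine Wt.of_span h2 fun m => Submodule.subset_span ⟨0, by simp, fun o => ?_⟩
  simp [chi]

/-- trivial CRep -/
def cr1 (k M : Type) [Field k] [AddCommGroup M] [Module k M] {Q N : Type} [Monoid Q] [Group N]
    (α : GAct Q N) : CRep k α M := ⟨1, 1, fun _ _ _ => rfl⟩

/-- enlarging the affine group -/
def affj (F : Type) [Field F] (I J : Type) [Fintype I] [DecidableEq I] [Fintype J] [DecidableEq J] :
    AffG F I →* AffG F (I ⊕ J) :=
  SemidirectProduct.map
    (AddMonoidHom.toMultiplicative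
      { toFun := fun v => Sum.elim v 0
        map_zero' := by ext i; cases i <;> rfl
        map_add' := fun a b => by ext i; cases i <;> simp })
    (Units.map (emb F I J)) (fun y => by
      refine MonoidHom.ext fun v => Multiplicative.toAdd.injective (funext fun i => ?_)
      change Sum.elim (Matrix.mulVec y.1 v.toAdd) 0 i =
        (Matrix.fromBlocks y.1 0 0 1).mulVec (Sum.elim v.toAdd 0) i
      rw [Matrix.fromBlocks_mulVec]
      cases i <;> simp)

theorem C_St (h2 : (2 : k) ≠ 0) (p : ℕ) [Fact p.Prime] [CharP k p] [Finite k]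
    [CharP F p] [Fintype F] (a : ℕ) (hT : TT k F a) (j : ℕ) :
    ∀ (A R : Type) [Fintype A] [DecidableEq A] [Fintype R] [DecidableEq R], Fintype.card A = j →
      a + 1 < Fintype.card A + Fintype.card R → Zr k M (a + 1) (Units.map (emb F A R)) := by
  induction j with
  | zero =>
    intro A R _ _ _ _ hA _
    have : IsEmpty A := Fintype.card_eq_zero_iff.1 hA
    have : Subsingleton (GLu F A) := ⟨fun x y => Units.ext (Subsingleton.elim _ _)⟩
    have := H_succ_of_subsingleton (1 : Representation k (GLu F A) M) a
    intro x
    rw [Subsingleton.elim x 0, map_zero]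
  | succ j ih =>
    intro A R _ _ _ _ hA hR
    obtain ⟨e⟩ : Nonempty (Fin j ⊕ Unit ≃ A) := ⟨Fintype.equivOfCardEq (by simp [hA])⟩
    refine Zr.of_surj (tc_surj_bij _ (units_bij _ (rx_bij e)) _)
      (Zr.of_surj (tc_surj _ affGL_inj (affGL_index p) _) ?_)
    let B := Fin j ⊕ R
    let β : B ⊕ Unit ≃ A ⊕ R :=
      ((Equiv.sumAssoc _ _ _).trans ((Equiv.sumCongr (Equiv.refl _) (Equiv.sumComm _ _)).trans
        (Equiv.sumAssoc _ _ _).symm)).trans (Equiv.sumCongr e (Equiv.refl R))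
    have e1 : ((Units.map (emb F A R)).comp (Units.map (rx F e))).comp (affGL F (Fin j)) =
        (Units.map (rx F β)).comp ((affGL F B).comp (affj F (Fin j) R)) := by
      refine MonoidHom.ext fun x => Units.ext ?_
      change emb F A R (rx F e (Units.val (affGL F _ x))) = rx F β (Units.val (affGL F B (affj F _ _ x)))
      rw [affGL_coe, affGL_coe]
      ext a b
      obtain ⟨a, rfl⟩ := β.surjective a
      obtain ⟨b, rfl⟩ := β.surjective b
      rcases a with (a | a) | a <;> rcases b with (b | b) | b <;>
        simp [β, B, rx, emb, affj, SemidirectProduct.map, Matrix.one_apply]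
    rw [e1]
    refine Zr.left ?_ _
    intro x
    rw [tc_comp]
    have hcard : a < Fintype.card B := by simp [B]; omega
    have key := semi_edge (amat F B) (co F B) (cr1 k M (amat F B)) (fun _ => rfl) (fun _ => rfl) (a + 1)
      (fun i l hil => hT B i ((l + 1) / 2) (by omega) (by omega) _ (D (cr1 k M (amat F B)) (l + 1))
        (amat_red _ l) ((amat_wt h2 p (cr1 k M (amat F B)) 0 (l + 1) (wt_one h2 _)).mono (by omega)))
      (tc k M _) (Hmap (tc k M (affj F (Fin j) R)) (a + 1) x)
    rw [← key, ← tc_comp, ← tc_comp]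
    have e2 : (((affGL F B).comp (SemidirectProduct.inr.comp SemidirectProduct.rightHom)).comp
        (affj F (Fin j) R)) = ((Units.map (rx F (Equiv.sumAssoc (Fin j) R Unit).symm)).comp
          (Units.map (emb F (Fin j) (R ⊕ Unit)))).comp SemidirectProduct.rightHom := by
      refine MonoidHom.ext fun x => Units.ext ?_
      change Units.val (affGL F B _) = rx F _ (emb F _ _ (Units.val x.right))
      rw [affGL_coe]
      ext a b
      rcases a with (a | a) | a <;> rcases b with (b | b) | b <;>
        simp [B, rx, emb, affj, SemidirectProduct.map, Matrix.one_apply]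
    have h3 := ((ih (Fin j) (R ⊕ Unit) (by simp) (by simp; omega)).left
      (Units.map (rx F (Equiv.sumAssoc (Fin j) R Unit).symm))).right
      (SemidirectProduct.rightHom (N := Multiplicative (Fin j → F)) (φ := ((amat F (Fin j)).comp (co F (Fin j))).aut))
    rw [← e2] at h3
    exact h3 x

theorem C_thm (h2 : (2 : k) ≠ 0) (p : ℕ) [Fact p.Prime] [CharP k p] [Finite k]
    [CharP F p] [Fintype F] (a : ℕ) (hT : TT k F a) (ha : a + 1 < Fintype.card I) :
    Subsingleton (H (a + 1) (1 : Representation k (GLu F I) M)) := by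
  have h := C_St (M := M) h2 p a hT _ I Empty rfl (by simpa using ha)
  have e : (Units.map (rx F (Equiv.sumEmpty I Empty))).comp (Units.map (emb F I Empty)) =
      MonoidHom.id (GLu F I) := by
    refine MonoidHom.ext fun x => Units.ext ?_
    change rx F _ (emb F _ _ x.1) = x.1
    ext a b
    simp [rx, emb]
  have h3 := h.left (Units.map (rx F (Equiv.sumEmpty I Empty)))
  rw [e] at h3
  refine subsingleton_of_forall_eq 0 fun x => ?_
  rw [← h3 x]
  exact (Hmap_id_apply _ rfl rfl _ x).symm

end T
end GH

end

/-! ## Part K -/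

section
set_option linter.unusedSectionVars false

namespace GH
variable {k : Type} [Field k]

section T
variable {F : Type} [Field F] {I : Type} [Fintype I] [DecidableEq I]
variable {M : Type} [AddCommGroup M] [Module k M]

theorem dg_neg_one : dg F I (fun _ => -1) = -1 := by
  ext a b
  simp [dg_apply, Matrix.diagonal_apply, Matrix.one_apply, sc]
  split_ifs <;> simp

theorem chi_neg_one (τ : I → ℕ) : chi k τ (fun _ => -1) = (-1) ^ ∑ i, τ i := by
  rw [chi, Finset.prod_pow_eq_pow_sum]
  simp [sc]

theorem wt_even (h2 : (2 : k) ≠ 0) (ρ : Representation k (Matrix I I F) M) (c : ℕ)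
    (hz : ρ (-1) = 1) (hW : Wt (2 * c + 1) (ρ.comp (dg F I))) : Wt (2 * c) (ρ.comp (dg F I)) := by
  intro τ hτ m
  by_cases h : 2 * c + 1 < tot τ
  · exact hW τ h m
  have ht := isW_idm (ρ := ρ.comp (dg F I)) h2 τ m (fun _ => -1)
  set t := Representation.asAlgebraHom (ρ.comp (dg F I)) (idm k τ) m
  rw [chi_neg_one] at ht
  change ρ (dg F I _) t = _ at ht
  have e : ∑ i, (τ i : ℕ) = 2 * c + 1 := by change tot τ = _; omega
  rw [dg_neg_one, hz, e, pow_succ, pow_mul] at ht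
  have h3 : t = - t := by simpa using ht
  have : (2 : k) • t = 0 := by
    rw [two_smul]; nth_rw 1 [h3]; simp
  exact (smul_eq_zero.1 this).resolve_left h2

theorem wt_zero (h2 : (2 : k) ≠ 0) (ρ : Representation k (Matrix I I F) M)
    (h0' : ρ 0 = 0) (hW : Wt 0 (ρ.comp (dg F I))) : Subsingleton M := by
  refine subsingleton_of_forall_eq 0 fun m => ?_
  refine (Submodule.mem_bot k).1 (hW.ind h2 ⊥ (fun τ hτ t ht => ?_) m)
  have hz : ∀ i, τ i = 0 := fun i => by
    have : tot τ = 0 := by omega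
    rw [tot, Finset.sum_eq_zero_iff] at this
    exact Fin.ext (this i (Finset.mem_univ i))
  have h3 := ht 0
  have e : dg F I 0 = 0 := by ext a b; simp [dg_apply, Matrix.diagonal_apply]
  have h4 : chi k (fun j => (τ j : ℕ)) (0 : I → SignType) = 1 := by simp [chi, hz]
  rw [h4, one_smul] at h3
  have h5 : ρ (dg F I 0) t = t := h3
  rw [e, h0'] at h5
  rw [← h5]; simp

theorem H_sub0 {G : Type} [Group G] (ρ : Representation k G M) [Subsingleton M] (a : ℕ) :
    Subsingleton (H a ρ) := by
  refine subsingleton_of_forall_eq 0 fun x => ?_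
  have h : Compat ρ ρ (MonoidHom.id G) (0 : M →ₗ[k] M) := fun g m => by simp
  rw [← Hmap_id_apply h rfl (LinearMap.ext fun _ => Subsingleton.elim _ _) a x]
  exact congrFun (congrArg DFunLike.coe (Hmap_zero h a)) x

/-- the CRep attached to a representation of matrices -/
noncomputable def crM (ρ : Representation k (Matrix (I ⊕ Unit) (I ⊕ Unit) F) M) : CRep k (amat F I) M where
  n := ρ.comp (shrH F I)
  q := ρ.comp (emb F I Unit)
  comm x g m := by
    change ρ _ (ρ _ m) = ρ _ (ρ _ m)
    rw [← Module.End.mul_apply, ← Module.End.mul_apply, ← map_mul, ← map_mul, emb_shr]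

/-- splitting off the part on which zero acts as identity -/
theorem split_red (h2 : (2 : k) ≠ 0) [Finite F] (θ : Representation k (Matrix I I F) M) (a b : ℕ)
    (hW : Wt b (θ.comp (dg F I)))
    (hC : ∀ (M' : Type) [AddCommGroup M'] [Module k M'],
      Subsingleton (H a (1 : Representation k (GLu F I) M')))
    (hR : ∀ (M' : Type) [AddCommGroup M'] [Module k M'] (ρ : Representation k (Matrix I I F) M'),
      ρ 0 = 0 → Wt b (ρ.comp (dg F I)) → Subsingleton (H a (ρ.comp (co F I)))) :
    Subsingleton (H a (θ.comp (co F I))) := by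
  let W := LinearMap.ker (θ 0)
  have hs : ∀ x, W ≤ W.comap (θ x) := fun x m hm => by
    change θ 0 (θ x m) = 0
    rw [← Module.End.mul_apply, ← map_mul, zero_mul]; exact hm
  refine (subquot_SES (θ.comp (co F I)) W (fun g => hs _)).sub a ?_ ?_
  · refine hR W (θ.subrepresentation W hs) ?_ ?_
    · ext m; exact m.2
    · exact hW.of_inj W.subtype (fun _ _ => rfl) Subtype.val_injective
  · have e : Representation.quotient (θ.comp (co F I)) W (fun g => hs _) = 1 := by
      refine MonoidHom.ext fun g => LinearMap.ext fun m => ?_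
      obtain ⟨m, rfl⟩ := Submodule.mkQ_surjective W m
      change W.mkQ (θ g.1 m) = W.mkQ m
      rw [← sub_eq_zero, ← map_sub, ← LinearMap.mem_ker, Submodule.ker_mkQ]
      change θ 0 (θ g.1 m - m) = 0
      rw [map_sub, ← Module.End.mul_apply, ← map_mul, zero_mul, sub_self]
    rw [e]
    exact hC _

theorem TT_half (h2 : (2 : k) ≠ 0) [Finite F] (ρ : Representation k (Matrix I I F) M) (a c : ℕ)
    (h0' : ρ 0 = 0) (hW : Wt (2 * c + 1) (ρ.comp (dg F I)))
    (hR : ∀ (M' : Type) [AddCommGroup M'] [Module k M'] (ρ : Representation k (Matrix I I F) M'),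
      ρ 0 = 0 → Wt (2 * c) (ρ.comp (dg F I)) → Subsingleton (H a (ρ.comp (co F I)))) :
    Subsingleton (H a (ρ.comp (co F I))) := by
  let W := LinearMap.ker (1 + ρ (-1))
  have hs : ∀ x, W ≤ W.comap (ρ x) := fun x m hm => by
    change ρ x m + ρ (-1) (ρ x m) = 0
    have hm : m + ρ (-1) m = 0 := hm
    have e : ρ (-1) (ρ x m) = ρ x (ρ (-1) m) := by
      rw [← Module.End.mul_apply, ← Module.End.mul_apply, ← map_mul, ← map_mul]; simp
    rw [e, ← map_add, hm, map_zero]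
  refine (subquot_SES (ρ.comp (co F I)) W (fun g => hs _)).sub a ?_ ?_
  · refine H_central h2 _ (-1 : GLu F I) (fun g => by simp) (fun m => Subtype.ext ?_) a
    have : m.1 + ρ (-1) m.1 = 0 := m.2
    exact (neg_eq_of_add_eq_zero_right this).symm
  · refine hR (M ⧸ W) (ρ.quotient W hs) ?_ (wt_even h2 _ c ?_ ?_)
    · refine LinearMap.ext fun m => ?_
      obtain ⟨m, rfl⟩ := Submodule.mkQ_surjective W m
      change W.mkQ (ρ 0 m) = 0
      rw [h0']; simp
    · refine LinearMap.ext fun m => ?_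
      obtain ⟨m, rfl⟩ := Submodule.mkQ_surjective W m
      change W.mkQ (ρ (-1) m) = W.mkQ m
      rw [← sub_eq_zero, ← map_sub, ← LinearMap.mem_ker, Submodule.ker_mkQ]
      change (ρ (-1) m - m) + ρ (-1) (ρ (-1) m - m) = 0
      rw [map_sub, ← Module.End.mul_apply, ← map_mul]
      simp
    · exact hW.of_surj W.mkQ (fun _ _ => rfl) (Submodule.mkQ_surjective W)

theorem TT_all (h2 : (2 : k) ≠ 0) (p : ℕ) [Fact p.Prime] [CharP k p] [Finite k]
    [CharP F p] [Fintype F] (m : ℕ) : TT k F m := by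
  induction m with
  | zero =>
    intro I _ _ a c hac hc M _ _ ρ h0' hW
    obtain rfl : a = 0 := by omega
    exact T0 h2 ρ c (by omega) h0' hW
  | succ m ih =>
    intro I _ _ a c hac hc M _ _ ρ h0' hW
    rcases a with _ | a
    · exact T0 h2 ρ c (by omega) h0' hW
    refine TT_half h2 ρ (a + 1) c h0' hW fun M _ _ ρ h0' hW => ?_
    rcases c with _ | c
    · have := wt_zero h2 ρ h0' hW
      exact H_sub0 _ _
    obtain ⟨j, hj⟩ : ∃ j, Fintype.card I = j + 1 := ⟨Fintype.card I - 1, by omega⟩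
    obtain ⟨e⟩ : Nonempty (Fin j ⊕ Unit ≃ I) := ⟨Fintype.equivOfCardEq (by simp [hj])⟩
    refine H_iso (Units.map (rx F e)) (units_bij _ (rx_bij e)) _ _ ?_
    have hW' := hW.rx h2 e
    set θ := ρ.comp (rx F e) with hθ
    have e1 : (ρ.comp (co F I)).comp (Units.map (rx F e)) = θ.comp (co F _) := rfl
    rw [e1]
    have hθ0 : θ 0 = 0 := by
      change ρ (rx F e 0) = 0
      have : rx F e 0 = 0 := by ext; simp [rx]
      rw [this, h0']
    refine @Function.Surjective.subsingleton _ _ _ ?_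
      (cor_surj (affGL F (Fin j)) affGL_inj (affGL_index p) (θ.comp (co F _)) (a + 1))
    refine semi_vanish (amat F (Fin j)) (co F (Fin j)) _ (crM θ) ?_ ?_ _ ?_
    · refine MonoidHom.ext fun v => ?_
      change θ (Units.val (affGL F _ _)) = θ (shrH F _ v)
      congr 1
      rw [affGL_coe]; rfl
    · intro y
      change θ (Units.val (affGL F _ _)) = θ (emb F _ _ y.1)
      congr 1
      rw [affGL_coe]
      ext u v
      rcases u with u | u <;> rcases v with v | v <;> simp [emb]
    · intro i l hil
      rcases l with _ | l
      · obtain rfl : i = a + 1 := hil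
        have h3 : Wt (2 * c + 1) ((D (crM θ) 0).comp (dg F (Fin j))) := by
          refine R0 h2 θ _ (h0 (crM θ).n) (h0_surj _) (fun v m => ?_) (fun o m => ?_) _ hW'
          · exact h0_rho (ρ := (crM θ).n) (Multiplicative.ofAdd v) m
          · exact (D_h0 (crM θ) (dg F _ o) m).symm
        refine split_red h2 (D (crM θ) 0) (a + 1) _ h3 (fun M' _ _ => ?_) (fun M' _ _ ρ' h4 h5 => ?_)
        · exact C_thm h2 p a (ih.mono (by omega)) (by simp; omega)
        · exact ih (Fin j) (a + 1) c (by omega) (by simp; omega) M' ρ' h4 h5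
      · refine ih (Fin j) i (c + 1 + (l + 1) / 2) (by omega) (by simp; omega) _ (D (crM θ) (l + 1))
          (amat_red _ l) ((amat_wt h2 p (crM θ) (2 * (c + 1)) (l + 1) (hW'.inl h2)).mono (by omega))

end T
end GH

end

/-! ## Part L -/

section
set_option linter.unusedSectionVars false
set_option linter.unusedVariables false
set_option linter.unusedSimpArgs false

namespace GH
variable {k : Type} [Field k]

/-- symmetric bilinear forms -/
structure SB (F U : Type) [Field F] where
  b : (U → F) →ₗ[F] (U → F) →ₗ[F] F
  symm : ∀ x y, b x y = b y x

section NN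
variable {F U : Type} [Field F]

/-- the unipotent radical -/
@[ext]
structure NN (B : SB F U) (I : Type) where
  T : I → U → F
  Z : I → I → F
  h : ∀ i j, Z i j + Z j i + B.b (T i) (T j) = 0

variable {B : SB F U} {I J : Type}

instance [Finite F] [Finite U] [Finite I] : Finite (NN B I) :=
  Finite.of_injective (fun n : NN B I => (n.T, n.Z)) (fun a b h => by
    have h := Prod.ext_iff.1 h
    exact NN.ext h.1 h.2)

instance : Mul (NN B I) :=
  ⟨fun a b => ⟨a.T + b.T, fun i j => a.Z i j + b.Z i j - B.b (a.T i) (b.T j), fun i j => by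
    have h1 := a.h i j
    have h2 := b.h i j
    simp only [Pi.add_apply, map_add, LinearMap.add_apply]
    rw [B.symm (a.T j) (b.T i)]
    linear_combination h1 + h2⟩⟩

instance : One (NN B I) := ⟨⟨0, 0, fun i j => by simp⟩⟩

instance : Inv (NN B I) := ⟨fun a => ⟨-a.T, fun i j => a.Z j i, fun i j => by
    have h1 := a.h i j
    simp only [Pi.neg_apply, map_neg, LinearMap.neg_apply, neg_neg]
    linear_combination h1⟩⟩

@[simp] theorem NN.mul_T (a b : NN B I) : (a * b).T = a.T + b.T := rfl
@[simp] theorem NN.mul_Z (a b : NN B I) (i j : I) :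
    (a * b).Z i j = a.Z i j + b.Z i j - B.b (a.T i) (b.T j) := rfl
@[simp] theorem NN.one_T : (1 : NN B I).T = 0 := rfl
@[simp] theorem NN.one_Z : (1 : NN B I).Z = 0 := rfl
@[simp] theorem NN.inv_T (a : NN B I) : (a⁻¹).T = -a.T := rfl
@[simp] theorem NN.inv_Z (a : NN B I) (i j : I) : (a⁻¹).Z i j = a.Z j i := rfl

instance : Group (NN B I) :=
  Group.ofLeftAxioms
    (fun a b c => by
      ext i j
      · simp [add_assoc]
      · simp; ring)
    (fun a => by ext i j <;> simp)
    (fun a => by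
      ext i j
      · simp
      · simp
        linear_combination a.h i j)

theorem NN.pow_T (a : NN B I) (n : ℕ) : (a ^ n).T = n • a.T := by
  induction n with
  | zero => simp
  | succ n ih => rw [pow_succ, NN.mul_T, ih, succ_nsmul]

theorem NN.pow_Z (a : NN B I) (ha : a.T = 0) (n : ℕ) : (a ^ n).Z = n • a.Z := by
  induction n with
  | zero => simp
  | succ n ih =>
    ext i j
    rw [pow_succ, NN.mul_Z, ih, succ_nsmul, ha]
    simp

theorem NN.pgroup (p : ℕ) [CharP F p] : IsPGroup p (NN B I) := by
  intro g
  refine ⟨2, ?_⟩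
  rw [pow_two, pow_mul]
  have h1 : (g ^ p).T = 0 := by
    rw [NN.pow_T]; ext i j; simp
  ext i j
  · rw [NN.pow_T, h1]; simp
  · rw [NN.pow_Z _ h1]; simp

/-- scaling -/
def nsc (s : I → F) : NN B I →* NN B I where
  toFun n := ⟨fun i => s i • n.T i, fun i j => s i * s j * n.Z i j, fun i j => by
    simp only [map_smul, LinearMap.smul_apply, smul_eq_mul]
    linear_combination s i * s j * n.h i j⟩
  map_one' := by ext <;> simp
  map_mul' a b := by
    ext i j
    · simp [mul_add]
    · simp; ring

/-- signs acting through a map of index sets -/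
noncomputable def sact (B : SB F U) {K : Type} (e : I → K) : GAct (K → SignType) (NN B I) where
  f o := nsc (fun i => sc F (o (e i)))
  one := by ext <;> simp [nsc]
  mul x y := by
    ext n i j
    · simp [nsc, mul_assoc]
    · simp [nsc]; ring

theorem sact_T {K : Type} (e : I → K) (o : K → SignType) (n : NN B I) (i : I) :
    ((sact B e).f o n).T i = sc F (o (e i)) • n.T i := rfl

theorem sact_Z {K : Type} (e : I → K) (o : K → SignType) (n : NN B I) (i j : I) :
    ((sact B e).f o n).Z i j = sc F (o (e i)) * sc F (o (e j)) * n.Z i j := rfl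

/-- matrices acting -/
def nact (B : SB F U) (I : Type) [Fintype I] [DecidableEq I] : GAct (Matrix I I F) (NN B I) where
  f x :=
    { toFun := fun n => ⟨fun i => ∑ a, x i a • n.T a, fun i j => ∑ a, ∑ b, x i a * x j b * n.Z a b,
        fun i j => by
          simp only [map_sum, map_smul, LinearMap.smul_apply, smul_eq_mul, LinearMap.sum_apply, Finset.mul_sum]
          rw [Finset.sum_comm (f := fun a b => x j a * x i b * n.Z a b), Finset.sum_comm (f := fun a b => x j a * (x i b * _)),
            ← Finset.sum_add_distrib,
            ← Finset.sum_add_distrib]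
          refine Finset.sum_eq_zero fun a _ => ?_
          rw [← Finset.sum_add_distrib, ← Finset.sum_add_distrib]
          refine Finset.sum_eq_zero fun b _ => ?_
          linear_combination x i a * x j b * n.h a b⟩
      map_one' := by ext <;> simp
      map_mul' := fun n m => by
        ext i j
        · simp [mul_add, Finset.sum_add_distrib]
        · simp only [NN.mul_Z, map_sum, map_smul, LinearMap.smul_apply, smul_eq_mul, LinearMap.sum_apply, Finset.mul_sum]
          rw [Finset.sum_comm (f := fun a b => x j a * (x i b * _)), ← Finset.sum_add_distrib, ← Finset.sum_sub_distrib]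
          refine Finset.sum_congr rfl fun a _ => ?_
          rw [← Finset.sum_add_distrib, ← Finset.sum_sub_distrib]
          refine Finset.sum_congr rfl fun b _ => ?_
          ring }
  one := by
    ext n i j
    · simp [Matrix.one_apply]
    · simp [Matrix.one_apply]
  mul x y := by
    ext n i j
    · simp only [MonoidHom.coe_mk, OneHom.coe_mk, MonoidHom.comp_apply, Matrix.mul_apply, Finset.sum_apply,
        Pi.smul_apply, smul_eq_mul, Finset.sum_mul, Finset.mul_sum]
      rw [Finset.sum_comm]
      simp [mul_assoc]
    · simp only [MonoidHom.coe_mk, OneHom.coe_mk, MonoidHom.comp_apply, Matrix.mul_apply]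
      have e1 : ∀ n : Matrix I I F, ∀ x : Matrix I I F, (Matrix.of fun i j => ∑ a, ∑ b, x i a * x j b * n a b) = x * n * x.transpose := by
        intro n x
        ext i j
        simp only [Matrix.of_apply, Matrix.mul_apply, Finset.sum_mul, Matrix.transpose_apply]
        rw [Finset.sum_comm]
        refine Finset.sum_congr rfl fun b _ => Finset.sum_congr rfl fun a _ => by ring
      have e2 := congrFun (congrFun (e1 (Matrix.of n.Z) (x * y)) i) j
      have e3 := congrFun (congrFun (e1 (Matrix.of fun i j => ∑ a, ∑ b, y i a * y j b * n.Z a b) x) i) j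
      have e4 := e1 (Matrix.of n.Z) y
      simp only [Matrix.of_apply] at e4
      rw [e4] at e3
      simp only [Matrix.of_apply, Matrix.mul_apply] at e2 e3 
      rw [e2]
      have e5 := congrFun (congrFun (show (x * y) * Matrix.of n.Z * (x*y).transpose = x * (y * Matrix.of n.Z * y.transpose) * x.transpose by
        rw [Matrix.transpose_mul]; simp only [Matrix.mul_assoc]) i) j
      simp only [Matrix.mul_apply, Matrix.of_apply] at e5
      rw [e5, ← e3]
      refine Finset.sum_congr rfl fun a _ => Finset.sum_congr rfl fun b _ => ?_
      congr 1
      have e6 := congrFun (congrFun e4 a) b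
      simp only [Matrix.mul_apply, Matrix.of_apply] at e6
      rw [e6]

theorem nact_dg [Fintype I] [DecidableEq I] (o : I → SignType) :
    (nact B I).f (dg F I o) = (sact B id).f o := by
  ext n i j
  · simp [nact, sact, nsc, dg_apply, Matrix.diagonal_apply]
  · simp [nact, sact, nsc, dg_apply, Matrix.diagonal_apply]

/-- inclusion of the new row -/
noncomputable def nι (B : SB F U) (h2 : (2 : F) ≠ 0) (I : Type) : Multiplicative (I ⊕ U → F) →* NN B (I ⊕ Unit) where
  toFun w := ⟨Sum.elim (fun _ => 0) (fun _ u => w.toAdd (Sum.inr u)),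
    Sum.elim (fun i => Sum.elim (fun _ => 0) (fun _ => - w.toAdd (Sum.inl i)))
      (fun _ => Sum.elim (fun i => w.toAdd (Sum.inl i))
        (fun _ => - (2 : F)⁻¹ * B.b (fun u => w.toAdd (Sum.inr u)) (fun u => w.toAdd (Sum.inr u)))), by
    rintro (i | i) (j | j)
    · simp
    · simp
    · simp
    · simp
      field_simp
      ring⟩
  map_one' := by
    have e : (fun _ : U => (0 : F)) = 0 := rfl
    ext i j
    · rcases i with i | i <;> simp
    · rcases i with i | i <;> rcases j with j | j <;> simp [e]
  map_mul' a b := by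
    have e : (fun u => a.toAdd (Sum.inr u) + b.toAdd (Sum.inr u)) =
      (fun u => a.toAdd (Sum.inr u)) + (fun u => b.toAdd (Sum.inr u)) := rfl
    have e0 : (fun _ : U => (0 : F)) = 0 := rfl
    ext i j
    · rcases i with i | i <;> simp
    · rcases i with i | i <;> rcases j with j | j <;> simp [e, e0]
      · ring
      · rw [B.symm (fun u => b.toAdd (Sum.inr u))]
        field_simp
        ring

/-- projection -/
def nπ (B : SB F U) (I : Type) : NN B (I ⊕ Unit) →* NN B I where
  toFun n := ⟨fun i => n.T (Sum.inl i), fun i j => n.Z (Sum.inl i) (Sum.inl j), fun i j => n.h _ _⟩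
  map_one' := rfl
  map_mul' a b := rfl

/-- section -/
def nσ (B : SB F U) (I : Type) : NN B I →* NN B (I ⊕ Unit) where
  toFun n := ⟨Sum.elim n.T (fun _ => 0), Sum.elim (fun i => Sum.elim (fun j => n.Z i j) (fun _ => 0)) (fun _ _ => 0), by
    rintro (i | i) (j | j)
    · simpa using n.h i j
    · simp
    · simp
    · simp⟩
  map_one' := by
    ext i j
    · rcases i with i | i <;> simp
    · rcases i with i | i <;> rcases j with j | j <;> simp
  map_mul' a b := by
    ext i j
    · rcases i with i | i <;> simp
    · rcases i with i | i <;> rcases j with j | j <;> simp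

/-- conjugation action on the new row -/
def nconj (B : SB F U) (I : Type) : GAct (NN B I) (Multiplicative (I ⊕ U → F)) :=
  addAct (fun y => { toFun := fun w => Sum.elim (fun i => w (Sum.inl i) + B.b (y.T i) (fun u => w (Sum.inr u)))
                                        (fun u => w (Sum.inr u))
                     map_zero' := by
                       have e0 : (fun _ : U => (0 : F)) = 0 := rfl
                       ext i; rcases i with i | i <;> simp [e0]
                     map_add' := fun a b => by
                       have e : (fun u => a (Sum.inr u) + b (Sum.inr u)) =
                          (fun u => a (Sum.inr u)) + (fun u => b (Sum.inr u)) := rfl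
                       ext i; rcases i with i | i <;> simp [e]; ring })
    (fun a => by ext i; rcases i with i | i <;> simp)
    (fun x y a => by ext i; rcases i with i | i <;> simp; ring)

/-- weights of the new row -/
def Crow {K : Type} [DecidableEq K] (e : I ⊕ Unit → K) (U : Type) : I ⊕ U → K → ℕ :=
  Sum.elim (fun i k => (if k = e (Sum.inl i) then 1 else 0) + (if k = e (Sum.inr ()) then 1 else 0))
    (fun _ k => if k = e (Sum.inr ()) then 1 else 0)

theorem chi_one {K : Type} [Fintype K] [DecidableEq K] (a : K) (o : K → SignType) :
    chi F (fun k => if k = a then 1 else 0) o = sc F (o a) := by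
  rw [chi, Finset.prod_eq_single a]
  · simp
  · intro b _ hb; simp [hb]
  · simp

theorem chi_two {K : Type} [Fintype K] [DecidableEq K] (a b : K) (o : K → SignType) :
    chi F (fun k => (if k = a then 1 else 0) + (if k = b then 1 else 0)) o = sc F (o a) * sc F (o b) := by
  rw [← chi_one a, ← chi_one b, chi, chi, chi, ← Finset.prod_mul_distrib]
  refine Finset.prod_congr rfl fun x _ => pow_add _ _ _

theorem vact_row {K : Type} [Fintype K] [DecidableEq K] (e : I ⊕ Unit → K) (o : K → SignType)
    (w : Multiplicative (I ⊕ U → F)) : ((vact F (Crow e U)).f o w).toAdd =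
      Sum.elim (fun i => sc F (o (e (Sum.inl i))) * sc F (o (e (Sum.inr ()))) * w.toAdd (Sum.inl i))
        (fun u => sc F (o (e (Sum.inr ()))) * w.toAdd (Sum.inr u)) := by
  ext j
  change sc F (sg (Crow e U j) o) * w.toAdd j = _
  rw [sc_sg]
  rcases j with j | j
  · exact congrArg (· * _) (chi_two _ _ o)
  · exact congrArg (· * _) (chi_one _ o)

/-- the row extension -/
noncomputable def nExt (B : SB F U) (h2 : (2 : F) ≠ 0) {K : Type} [Fintype K] [DecidableEq K] (e : I ⊕ Unit → K) :
    Ext (K → SignType) (Multiplicative (I ⊕ U → F)) (NN B (I ⊕ Unit)) (NN B I) where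
  ι := nι B h2 I
  π := nπ B I
  s := nσ B I
  c := nconj B I
  aN := vact F (Crow e U)
  aX := sact B e
  aN' := sact B (fun i => e (Sum.inl i))
  inj a b h := by
    apply Multiplicative.toAdd.injective
    ext j
    rcases j with j | j
    · exact congrArg (fun n : NN B (I ⊕ Unit) => n.Z (Sum.inr ()) (Sum.inl j)) h
    · exact congrArg (fun n : NN B (I ⊕ Unit) => n.T (Sum.inr ()) j) h
  πι x := by ext i j <;> simp [nπ, nι]
  πs x := by ext i j <;> simp [nπ, nσ]
  ker x hx := by
    have hT : ∀ i, x.T (Sum.inl i) = 0 := fun i => congrArg (fun n : NN B I => n.T i) hx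
    have hZ : ∀ i j, x.Z (Sum.inl i) (Sum.inl j) = 0 := fun i j => congrArg (fun n : NN B I => n.Z i j) hx
    refine ⟨Multiplicative.ofAdd (Sum.elim (fun i => x.Z (Sum.inr ()) (Sum.inl i)) (x.T (Sum.inr ()))), ?_⟩
    ext i j
    · rcases i with i | i
      · simp [nι, hT]
      · simp [nι]
    · rcases i with i | i <;> rcases j with j | j
      · simp [nι, hZ]
      · have := x.h (Sum.inl i) (Sum.inr j)
        simp [hT] at this
        simp [nι]
        linear_combination -this
      · simp [nι]
      · have := x.h (Sum.inr ()) (Sum.inr ())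
        have e : (fun u => x.T (Sum.inr ()) u) = x.T (Sum.inr ()) := rfl
        simp [nι]
        field_simp
        linear_combination -this
  hc y x := by
    have e0 : (fun _ : U => (0 : F)) = 0 := rfl
    ext i j
    · rcases i with i | i <;> simp [nι, nσ, nconj, addAct]
    · rcases i with i | i <;> rcases j with j | j
      · simp [nι, nσ, e0]
        linear_combination -y.h i j
      · simp [nι, nσ, nconj, addAct, e0]
        ring
      · simp [nι, nσ, nconj, addAct, e0]
        rw [B.symm]
      · simp [nι, nσ, nconj, addAct, e0]
  eι q x := by
    have e0 : (fun u => sc F (q (e (Sum.inr ()))) * x.toAdd (Sum.inr u)) =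
      sc F (q (e (Sum.inr ()))) • (fun u => x.toAdd (Sum.inr u)) := rfl
    ext i j
    · rcases i with i | i <;> simp [nι, sact_T, vact_row]
    · rcases i with i | i <;> rcases j with j | j <;> simp [nι, sact_Z, vact_row, e0] <;>
        first | ring1 | (left; ring1)
  es q x := by
    ext i j
    · rcases i with i | i <;> simp [nσ, sact_T]
    · rcases i with i | i <;> rcases j with j | j <;> simp [nσ, sact_Z]
  eπ q x := by
    ext i j <;> simp [nπ, sact_T, sact_Z]

end NN
end GH

end

/-! ## Part M -/

section
set_option linter.unusedSectionVars false
set_option linter.unusedVariables false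
set_option linter.unusedSimpArgs false

namespace GH
variable {k : Type} [Field k]

section A
variable {K : Type} [Fintype K] [DecidableEq K] {Y : Type} [AddCommGroup Y] [Module k Y]

theorem chi_mul' (τ σ : K → ℕ) (o : K → SignType) : chi k (τ + σ) o = chi k τ o * chi k σ o := by
  rw [chi, chi, chi, ← Finset.prod_mul_distrib]
  exact Finset.prod_congr rfl fun i _ => pow_add _ _ _

theorem Wt.twist (h2 : (2 : k) ≠ 0) {ρ ρ1 ρ2 : Representation k (K → SignType) Y}
    (hD : ∀ o x, ρ o x = ρ1 o (ρ2 o x)) (hcomm : ∀ o p x, ρ1 p (ρ2 o x) = ρ2 o (ρ1 p x))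
    {a b : ℕ} (w1 : Wt a ρ1) (w2 : Wt b ρ2) : Wt (a + b) ρ := by
  refine Wt.of_span h2 fun x => ?_
  refine w1.ind h2 _ (fun t htt y hy => ?_) x
  rw [← sum_act (ρ := ρ2) h2 y]
  refine Submodule.sum_mem _ fun τ _ => ?_
  by_cases hτ : b < tot τ
  · rw [w2 τ hτ]; exact Submodule.zero_mem _
  refine Submodule.subset_span ⟨(fun i => (t i : ℕ)) + fun i => (τ i : ℕ), ?_, fun o => ?_⟩
  · have : tot t + tot τ ≤ a + b := by omega
    refine le_trans (le_of_eq ?_) this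
    exact Finset.sum_add_distrib
  · have h1 := isW_idm (ρ := ρ2) h2 τ y o
    rw [hD, h1, map_smul]
    have h3 := act_equiv (ρ := ρ2) (ρ' := ρ2) (ρ1 o) (fun q m => hcomm q _ m) (idm k τ) y
    rw [h3, hy o, map_smul, chi_mul', smul_smul, mul_comm]

theorem chi_push {I : Type} [Fintype I] (e : I → K) (τ : I → ℕ) (o : K → SignType) :
    chi k τ (fun i => o (e i)) = chi k (fun x => ∑ i, if x = e i then τ i else 0) o := by
  simp only [chi, ← Finset.prod_pow_eq_pow_sum]
  rw [Finset.prod_comm]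
  refine Finset.prod_congr rfl fun i _ => ?_
  rw [Finset.prod_eq_single (e i)]
  · simp
  · intro b _ hb; simp [hb]
  · simp

theorem Wt.push (h2 : (2 : k) ≠ 0) {I : Type} [Fintype I] [DecidableEq I] (e : I → K) {b : ℕ}
    {ρ : Representation k (I → SignType) Y} {ρ' : Representation k (K → SignType) Y}
    (h : Wt b ρ) (hg : ∀ o, ρ' o = ρ (fun i => o (e i))) : Wt b ρ' := by
  refine h.pull h2 (fun o i => o (e i)) hg (fun τ => ⟨_, ?_, fun o => chi_push e _ o⟩)
  rw [Finset.sum_comm]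
  simp [tot]

/-- strengthened weight bound -/
def WP (k : Type) [Field k] {N : Type} [Group N] (α : GAct (K → SignType) N) : Prop :=
  ∀ (M : Type) [AddCommGroup M] [Module k M] (c : CRep k α M) (b j : ℕ), Wt b c.q →
    Wt (b + 2 * j + 1) (D c (j + 1))

theorem WP.iso {N N' : Type} [Group N] [Group N'] [Finite N'] {α : GAct (K → SignType) N}
    {α' : GAct (K → SignType) N'} (h : WP k α) (e : N ≃* N')
    (he : ∀ o n, α'.f o (e n) = e (α.f o n)) : WP k α' := by
  intro M _ _ c b j hb
  let c' : CRep k α M := ⟨c.n.comp e.toMonoidHom, c.q, fun x g m => by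
    change c.q x (c.n (e g) m) = c.n (e (α.f x g)) (c.q x m)
    rw [c.comm, he]⟩
  refine (h M c' b j hb).of_surj (Hmap (corCompat e.toMonoidHom c.n) (j + 1)) (fun o x => ?_) ?_
  · refine Hmap_sq (corCompat e.toMonoidHom c.n) (c'.comm o) (c.comm o) (corCompat e.toMonoidHom c.n) ?_ rfl _ x
    ext n; exact (he o n).symm
  · exact cor_surj e.toMonoidHom e.injective (by
      rw [MonoidHom.range_eq_top.2 e.surjective]; simp) c.n (j + 1)

end A

section B
variable {F U : Type} [Field F] {B : SB F U} {I J : Type}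

/-- reindexing -/
def nre (B : SB F U) (ε : I ≃ J) : NN B I ≃* NN B J where
  toFun n := ⟨fun j => n.T (ε.symm j), fun i j => n.Z (ε.symm i) (ε.symm j), fun i j => n.h _ _⟩
  invFun n := ⟨fun j => n.T (ε j), fun i j => n.Z (ε i) (ε j), fun i j => n.h _ _⟩
  left_inv n := by ext <;> simp
  right_inv n := by ext <;> simp
  map_mul' a b := rfl

theorem nn_good (h2 : (2 : k) ≠ 0) (h2' : (2 : F) ≠ 0) (p : ℕ) [Fact p.Prime] [CharP k p] [Finite k]
    [CharP F p] [Finite F] [Finite U] (B : SB F U) (K : Type) [Fintype K] [DecidableEq K] (n : ℕ) :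
    ∀ (I : Type) [Fintype I], Fintype.card I = n → ∀ e : I → K, Good k 2 (sact B e) := by
  induction n with
  | zero =>
    intro I _ hI e
    have : IsEmpty I := Fintype.card_eq_zero_iff.1 hI
    have : Subsingleton (NN B I) := ⟨fun a b => by ext i; exact isEmptyElim i; exact isEmptyElim i⟩
    exact good_subsingleton h2 p _ 2
  | succ n ih =>
    intro I _ hI e
    obtain ⟨ε⟩ : Nonempty (Fin n ⊕ Unit ≃ I) := ⟨Fintype.equivOfCardEq (by simp [hI])⟩
    have hg : Good k 2 (sact B (fun i => e (ε i))) := by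
      refine Good.ext h2 (nExt B h2' (fun i => e (ε i))) ?_ (ih (Fin n) (by simp) _)
      refine Good.vec h2 p 2 _ _ ?_
      rintro (j | j)
      · simp [Crow, Finset.sum_add_distrib]
      · simp [Crow]
    refine Good.iso h2 p hg (nre B ε) fun o n => ?_
    ext i j
    · simp [sact_T, nre]
    · simp [sact_Z, nre]

/-- partial matrix action on the new row -/
noncomputable def rowM (F : Type) [Field F] (I : Type) [Fintype I] [DecidableEq I] [DecidableEq U] (u0 : U) :
    GAct (Matrix (I ⊕ Unit) (I ⊕ Unit) F) (Multiplicative (I ⊕ U → F)) :=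
  addAct (fun x => { toFun := fun w => Sum.elim
                        (fun i => x.mulVec (Sum.elim (fun i => w (Sum.inl i)) (fun _ => w (Sum.inr u0))) (Sum.inl i))
                        (fun u => if u = u0 then
                          x.mulVec (Sum.elim (fun i => w (Sum.inl i)) (fun _ => w (Sum.inr u0))) (Sum.inr ())
                          else w (Sum.inr u))
                     map_zero' := by
                       ext i; rcases i with i | i <;> simp [Matrix.mulVec, dotProduct]
                     map_add' := fun a b => by
                       ext i; rcases i with i | i
                       · simp [Matrix.mulVec, dotProduct, mul_add, Finset.sum_add_distrib]; ring
                       · simp [Matrix.mulVec, dotProduct, mul_add, Finset.sum_add_distrib]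
                         split_ifs
                         · ring
                         · rfl })
    (fun a => by
      ext i; rcases i with i | i
      · simp
      · simp
        rintro rfl; rfl)
    (fun x y a => by
      have key : (Sum.elim (fun i => y.mulVec (Sum.elim (fun i => a (Sum.inl i)) (fun _ => a (Sum.inr u0))) (Sum.inl i))
        (fun _ => y.mulVec (Sum.elim (fun i => a (Sum.inl i)) (fun _ => a (Sum.inr u0))) (Sum.inr ()))) =
        y.mulVec (Sum.elim (fun i => a (Sum.inl i)) (fun _ => a (Sum.inr u0))) := by
        ext i; rcases i with i | i <;> rfl
      ext i; rcases i with i | i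
      · simp [key]
      · simp [key]
        split_ifs <;> rfl)

section C
variable [DecidableEq U] (u0 : U) [Fintype I] [DecidableEq I]

theorem rowM_emb (o : I → SignType) (w : Multiplicative (I ⊕ U → F)) :
    ((rowM F I u0).f (emb F I Unit (dg F I o)) w).toAdd =
      Sum.elim (fun i => sc F (o i) * w.toAdd (Sum.inl i)) (fun u => w.toAdd (Sum.inr u)) := by
  ext i
  rcases i with i | i
  · simp [rowM, addAct, emb, dg_apply, Matrix.mulVec, dotProduct, Matrix.diagonal_apply, Matrix.fromBlocks]
  · simp [rowM, addAct, emb, dg_apply, Matrix.mulVec, dotProduct, Matrix.diagonal_apply, Matrix.fromBlocks]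
    intro h; rw [h]

theorem rowM_dg (o : I ⊕ Unit → SignType) (w : Multiplicative (I ⊕ U → F)) :
    ((rowM F I u0).f (dg F (I ⊕ Unit) o) w).toAdd =
      Sum.elim (fun i => sc F (o (Sum.inl i)) * w.toAdd (Sum.inl i))
        (fun u => (if u = u0 then sc F (o (Sum.inr ())) else 1) * w.toAdd (Sum.inr u)) := by
  ext i
  rcases i with i | i
  · simp [rowM, addAct, dg_apply, Matrix.mulVec, dotProduct, Matrix.diagonal_apply]
  · simp [rowM, addAct, dg_apply, Matrix.mulVec, dotProduct, Matrix.diagonal_apply]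
    split_ifs with h
    · rw [h]
    · rfl

theorem rowM_shr (v : I → F) (w : Multiplicative (I ⊕ U → F)) :
    ((rowM F I u0).f (shr v) w).toAdd =
      Sum.elim (fun i => w.toAdd (Sum.inl i) + v i * w.toAdd (Sum.inr u0)) (fun u => w.toAdd (Sum.inr u)) := by
  ext i
  rcases i with i | i
  · simp [rowM, addAct, shr, Matrix.mulVec, dotProduct, Matrix.one_apply, Matrix.fromBlocks]
  · simp [rowM, addAct, shr, Matrix.mulVec, dotProduct, Matrix.one_apply, Matrix.fromBlocks]
    intro h; rw [h]

theorem nconj_toAdd (y : NN B I) (w : Multiplicative (I ⊕ U → F)) :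
    ((nconj B I).f y w).toAdd = Sum.elim (fun i => w.toAdd (Sum.inl i) + B.b (y.T i) (fun u => w.toAdd (Sum.inr u)))
      (fun u => w.toAdd (Sum.inr u)) := rfl

theorem vact_sc {J K : Type} [Fintype K] [DecidableEq K] (a : K) (o : K → SignType) (w : Multiplicative (J → F)) :
    ((vact F (fun _ x => if x = a then 1 else 0)).f o w).toAdd = fun i => sc F (o a) * w.toAdd i := by
  ext i
  change sc F (sg _ o) * w.toAdd i = _
  rw [sc_sg, chi_one]

theorem emb_conj (o : I → SignType) (y : NN B I) :
    ((rowM F I u0).f (emb F I Unit (dg F I o))).comp ((nconj B I).f y) =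
    ((nconj B I).f ((sact B id).f o y)).comp ((rowM F I u0).f (emb F I Unit (dg F I o))) := by
  refine MonoidHom.ext fun w => Multiplicative.toAdd.injective ?_
  rw [MonoidHom.comp_apply, MonoidHom.comp_apply, rowM_emb, nconj_toAdd, nconj_toAdd, rowM_emb]
  ext i
  rcases i with i | i
  · simp [sact_T, mul_add]
  · simp

theorem sc_conj {K : Type} [Fintype K] [DecidableEq K] (a : K) (o : K → SignType) (y : NN B I) :
    ((vact F (fun _ x => if x = a then 1 else 0)).f o).comp ((nconj B I).f y) =
    ((nconj B I).f y).comp ((vact F (fun _ x => if x = a then 1 else 0)).f o) := by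
  refine MonoidHom.ext fun w => Multiplicative.toAdd.injective ?_
  rw [MonoidHom.comp_apply, MonoidHom.comp_apply, vact_sc, nconj_toAdd, nconj_toAdd, vact_sc]
  ext i
  have e : (fun u => sc F (o a) * w.toAdd (Sum.inr u)) = sc F (o a) • (fun u => w.toAdd (Sum.inr u)) := rfl
  rcases i with i | i
  · simp [e, mul_add]
  · simp

/-- element realizing a shear -/
noncomputable def shrN (B : SB F U) (h2' : (2 : F) ≠ 0) (r : U → F) (v : I → F) : NN B I :=
  ⟨fun i => v i • r, fun i j => -(v i * v j * B.b r r) / 2, fun i j => by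
    simp only [map_smul, LinearMap.smul_apply, smul_eq_mul]; field_simp; ring⟩

theorem shr_conj (h2' : (2 : F) ≠ 0) (r : U → F) (hr : ∀ t, B.b r t = t u0) (v : I → F) :
    (rowM F I u0).f (shr v) = (nconj B I).f (shrN B h2' r v) := by
  refine MonoidHom.ext fun w => Multiplicative.toAdd.injective ?_
  rw [rowM_shr, nconj_toAdd]
  ext i
  rcases i with i | i
  · simp [shrN, hr]
  · simp

theorem row_split {K : Type} [Fintype K] [DecidableEq K] (e : I ⊕ Unit → K) (o : K → SignType) :
    (vact F (Crow e U)).f o = ((rowM F I u0).f (emb F I Unit (dg F I (fun i => o (e (Sum.inl i)))))).comp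
      ((vact F (fun _ x => if x = e (Sum.inr ()) then 1 else 0)).f o) := by
  refine MonoidHom.ext fun w => Multiplicative.toAdd.injective ?_
  rw [MonoidHom.comp_apply, vact_row, rowM_emb, vact_sc]
  ext i
  rcases i with i | i
  · simp [mul_assoc]
  · simp

theorem row_comm {K : Type} [Fintype K] [DecidableEq K] (a : K) (o : K → SignType) (o' : I → SignType) :
    ((rowM F I u0).f (emb F I Unit (dg F I o'))).comp
      ((vact F (fun _ x => if x = a then 1 else 0)).f o) =
      ((vact F (fun _ x => if x = a then 1 else 0)).f o).comp ((rowM F I u0).f (emb F I Unit (dg F I o'))) := by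
  refine MonoidHom.ext fun w => Multiplicative.toAdd.injective ?_
  rw [MonoidHom.comp_apply, MonoidHom.comp_apply, vact_sc, rowM_emb, rowM_emb, vact_sc]
  ext i
  rcases i with i | i
  · simp; ring
  · simp

theorem rowM_good (h2 : (2 : k) ≠ 0) (p : ℕ) [Fact p.Prime] [CharP k p] [Finite k]
    [CharP F p] [Finite F] [Finite U] : Good k 1 ((rowM F I u0).comp (dg F (I ⊕ Unit))) := by
  refine Good.iso h2 p (Good.vec (F := F) h2 p 1 (I ⊕ U) (Sum.elim
    (fun i x => if x = Sum.inl i then 1 else 0)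
    (fun u x => if u = u0 then (if x = Sum.inr () then 1 else 0) else 0)) ?_)
    (MulEquiv.refl _) fun o n => Multiplicative.toAdd.injective ?_
  · rintro (i | i)
    · simp
    · by_cases h : i = u0 <;> simp [h]
  · refine (rowM_dg u0 o n).trans ?_
    ext i
    rcases i with i | i
    · change _ = sc F (sg _ o) * n.toAdd _
      rw [sc_sg]
      simp only [Sum.elim_inl, chi_one]
    · change _ = sc F (sg _ o) * n.toAdd _
      rw [sc_sg]
      by_cases h : i = u0
      · simp only [Sum.elim_inr, h, if_true, chi_one]
      · simp [h, chi]
end C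

theorem wp_row (h2 : (2 : k) ≠ 0) (h2' : (2 : F) ≠ 0) (p : ℕ) [Fact p.Prime] [CharP k p] [Finite k]
    [CharP F p] [Finite F] [Finite U] [DecidableEq U] (B : SB F U) (K : Type) [Fintype K] [DecidableEq K]
    (u0 : U) (r : U → F) (hr : ∀ t, B.b r t = t u0) (I : Type) [Fintype I] [DecidableEq I] (e : I ⊕ Unit → K)
    {M : Type} [AddCommGroup M] [Module k M] (c : CRep k (sact B e) M) (ht : ∀ g m, c.n g m = m)
    (b : ℕ) (hb : Wt b c.q) (j : ℕ) :
    Wt (b + 2 * j + 1) (D ((nExt B h2' e).EH (c : CRep k (nExt B h2' e).aX M) (j + 1)) 0) := by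
  set E := nExt B h2' e with hE
  let c0 : CRep k E.aX M := c
  let nX : Representation k (NN B I) (H (j + 1) (c0.n.comp E.ι)) := (E.EH c0 (j + 1)).n
  let cM : CRep k (rowM F I u0) M := ⟨c0.n.comp E.ι, 1, fun x g m => by
    change c0.n _ m = c0.n _ m
    exact (ht _ _).trans (ht _ _).symm⟩
  let c' : CRep k (vact (J := I ⊕ U) F (fun _ x => if x = e (Sum.inr ()) then 1 else 0)) M :=
    ⟨c0.n.comp E.ι, c0.q, fun x g m => by
      change c0.q x (c0.n _ m) = c0.n _ (c0.q x m)
      have h3 : ∀ g m, c0.n g m = m := ht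
      rw [h3, h3]⟩
  let EHa : CRep k (sact B (id : I → I)) (H (j + 1) (c0.n.comp E.ι)) :=
    ⟨nX, (D cM (j + 1)).comp ((emb F I Unit).comp (dg F I)), fun x g v => by
      refine Hmap_sq (cM.comm (emb F I Unit (dg F I x))) ((E.resN c0).comm g) ((E.resN c0).comm ((sact B id).f x g))
        (cM.comm (emb F I Unit (dg F I x))) ?_ ?_ (j + 1) v
      · exact emb_conj u0 x g
      · ext m
        have h3 : ∀ g m, c0.n g m = m := ht
        change c0.n _ m = c0.n _ m
        rw [h3, h3]⟩
  let EHb : CRep k (GAct.triv (K → SignType) (NN B I)) (H (j + 1) (c0.n.comp E.ι)) :=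
    ⟨nX, D c' (j + 1), fun x g v => by
      refine Hmap_sq (c'.comm x) ((E.resN c0).comm g) ((E.resN c0).comm g) (c'.comm x) ?_ ?_ (j + 1) v
      · exact sc_conj _ x g
      · ext m
        have h3 : ∀ g m, c0.n g m = m := ht
        change c0.q x (c0.n _ m) = c0.n _ (c0.q x m)
        rw [h3, h3]⟩
  have wa : Wt j (D EHa 0) := by
    refine R0 h2 (D cM (j + 1)) _ (h0 nX) (h0_surj _) (fun v m => ?_) (fun o m => ?_) j ?_
    · have h3 : ∀ g m, c0.n g m = m := ht
      refine Eq.trans (congrArg (h0 nX) ?_) (h0_rho (ρ := nX) (shrN B h2' r v) m)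
      refine congrArg (fun t : _ →ₗ[k] _ => t m) (Hmap_congr (cM.comm (shr v)) ((E.resN c0).comm _)
        (shr_conj u0 h2' r hr v) ?_ (j + 1))
      ext m
      exact (h3 _ m).symm
    · exact (D_h0 EHa o m).symm
    · have h4 := rowM_good u0 h2 p M (cM.comp (dg F (I ⊕ Unit))) 0 (j + 1) (wt_one h2 _)
      have h5 := h4.mono (b' := j + 1) (by omega)
      exact h5
  have wb : Wt (b + 1 * (j + 1)) (D EHb 0) := by
    have h3 := Good.vec (k := k) (F := F) h2 p 1 (I ⊕ U) (fun _ x => if x = e (Sum.inr ()) then 1 else 0) (by simp)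
      M c' b (j + 1) hb
    exact h3.of_surj (h0 nX) (fun o m => (D_h0 EHb o m).symm) (h0_surj _)
  have wa' : Wt j ((D EHa 0).comp ({ toFun := fun o i => o (e (Sum.inl i)), map_one' := rfl, map_mul' := fun _ _ => rfl } :
    (K → SignType) →* (I → SignType))) := wa.push h2 (fun i => e (Sum.inl i)) (fun o => rfl)
  refine (Wt.twist h2 (fun o x => ?_) (fun o q x => ?_) wa' wb).mono (by omega)
  · obtain ⟨x, rfl⟩ := h0_surj _ x
    refine (D_h0 (E.EH c0 (j + 1)) o x).trans ?_
    refine Eq.trans ?_ (congrArg _ (D_h0 EHb o x)).symm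
    refine Eq.trans ?_ (D_h0 EHa _ _).symm
    refine congrArg (h0 nX) ?_
    refine Eq.trans ?_ (Hmap_comp_apply (cM.comm _) (c'.comm o) (j + 1) x).symm
    exact congrArg (fun t : _ →ₗ[k] _ => t x) (Hmap_congr ((E.resQ c0).comm o) _
        (row_split u0 e o) rfl (j + 1))
  · obtain ⟨x, rfl⟩ := h0_surj _ x
    refine (congrArg _ (D_h0 EHb o x)).trans ?_
    refine (D_h0 EHa _ _).trans ?_
    refine Eq.trans ?_ (congrArg _ (D_h0 EHa _ x)).symm
    refine Eq.trans ?_ (D_h0 EHb _ _).symm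
    refine congrArg (h0 nX) ?_
    exact Hmap_sq (cM.comm _) (c'.comm o) (c'.comm o) (cM.comm _) (row_comm u0 _ o _) rfl (j + 1) x


theorem wp_all (h2 : (2 : k) ≠ 0) (h2' : (2 : F) ≠ 0) (p : ℕ) [Fact p.Prime] [CharP k p] [Finite k]
    [CharP F p] [Finite F] [Finite U] [DecidableEq U] (B : SB F U) (K : Type) [Fintype K] [DecidableEq K]
    (u0 : U) (r : U → F) (hr : ∀ t, B.b r t = t u0) (n : ℕ) :
    ∀ (I : Type) [Fintype I], Fintype.card I = n → ∀ e : I → K, WP k (sact B e) := by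
  induction n with
  | zero =>
    intro I _ hI e M _ _ c b j hb
    have : IsEmpty I := Fintype.card_eq_zero_iff.1 hI
    have : Subsingleton (NN B I) := ⟨fun a b => by ext i; exact isEmptyElim i; exact isEmptyElim i⟩
    have := H_succ_of_subsingleton c.n j
    refine Wt.of_span h2 fun x => ?_
    rw [Subsingleton.elim x 0]
    exact Submodule.zero_mem _
  | succ n ih =>
    intro I _ hI e
    obtain ⟨ε⟩ : Nonempty (Fin n ⊕ Unit ≃ I) := ⟨Fintype.equivOfCardEq (by simp [hI])⟩
    have hg : WP k (sact B (fun i => e (ε i))) := by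
      intro M _ _ c b j
      revert j
      refine devissage p (NN.pgroup p) (fun M _ _ c => ∀ j, Wt b c.q → Wt (b + 2 * j + 1) (D c (j + 1))) ?_ ?_ M c
      · intro M _ _ c ht a hb
        refine (nExt B h2' (fun i => e (ε i))).wt h2 (a + 1) _ c fun i j hij => ?_
        rcases i with _ | i
        · obtain rfl : j = a + 1 := by omega
          exact wp_row h2 h2' p B K u0 r hr (Fin n) _ c ht b hb a
        · have h1 : Wt (b + 2 * j) ((nExt B h2' (fun i => e (ε i))).EH c j).q := by
            refine Good.vec h2 p 2 _ _ ?_ M ((nExt B h2' (fun i => e (ε i))).resQ c) b j hb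
            rintro (j | j)
            · simp [Crow, Finset.sum_add_distrib]
            · simp [Crow]
          refine (ih (Fin n) (by simp) _ _ ((nExt B h2' (fun i => e (ε i))).EH c j) _ i h1).mono (by omega)
      · intro M _ _ c W hn hq h1 h3 j hb
        have S := subquot_SES c.n W hn
        refine Wt.of_exact h2 (h1 j (hb.of_inj W.subtype (fun _ _ => rfl) Subtype.val_injective))
          (h3 j (hb.of_surj W.mkQ (fun _ _ => rfl) (Submodule.mkQ_surjective W)))
          (Hmap S.hf (j + 1)) (Hmap S.hg (j + 1)) ?_ ?_ (S.exact₂ (j + 1))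
        · exact Hmap_D (c.sub W hn hq) c S.hf (fun _ _ => rfl) (j + 1)
        · exact Hmap_D c (c.quot W hn hq) S.hg (fun _ _ => rfl) (j + 1)
    refine hg.iso (nre B ε) fun o n => ?_
    ext i j
    · simp [sact_T, nre]
    · simp [sact_Z, nre]

end B
end GH

end

/-! ## Part N -/

section
set_option linter.unusedSectionVars false
set_option linter.unusedVariables false
set_option linter.unusedSimpArgs false

namespace GH
variable {k : Type} [Field k] {M : Type} [AddCommGroup M] [Module k M]
variable {F U : Type} [Field F] {B : SB F U} {I : Type} [Fintype I] [DecidableEq I]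

/-- the parabolic group -/
abbrev Gam (B : SB F U) (I : Type) [Fintype I] [DecidableEq I] := Semi ((nact B I).comp (co F I))

theorem nact_comp_dg : (nact B I).comp (dg F I) = sact B id := by
  have h : ∀ a b : GAct (I → SignType) (NN B I), a.f = b.f → a = b := by
    rintro ⟨f, _, _⟩ ⟨g, _, _⟩ h; cases h; rfl
  exact h _ _ (funext fun o => nact_dg o)

theorem nact_red (cr : CRep k (nact B I) M) (l : ℕ) : D cr (l + 1) 0 = 0 := by
  ext x
  refine Hmap_triv _ (fun g => ?_) l x
  ext i j <;> simp [nact]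

theorem nact_good (h2 : (2 : k) ≠ 0) (h2' : (2 : F) ≠ 0) (p : ℕ) [Fact p.Prime] [CharP k p] [Finite k]
    [CharP F p] [Finite F] [Finite U] : Good k 2 ((nact B I).comp (dg F I)) := by
  rw [nact_comp_dg]; exact nn_good h2 h2' p B I _ I rfl id

theorem nact_wp (h2 : (2 : k) ≠ 0) (h2' : (2 : F) ≠ 0) (p : ℕ) [Fact p.Prime] [CharP k p] [Finite k]
    [CharP F p] [Finite F] [Finite U] (u0 : U) (r : U → F) (hr : ∀ t, B.b r t = t u0) :
    WP k ((nact B I).comp (dg F I)) := by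
  classical
  rw [nact_comp_dg]; exact wp_all h2 h2' p B I u0 r hr _ I rfl id

theorem gam_edge1 (h2 : (2 : k) ≠ 0) (h2' : (2 : F) ≠ 0) (p : ℕ) [Fact p.Prime] [CharP k p] [Finite k]
    [CharP F p] [Fintype F] [Finite U] (d : ℕ) (hd : d < Fintype.card I)
    (x : H d (1 : Representation k (Gam B I) M)) :
    Hmap (tc k M ((SemidirectProduct.inr : _ →* Gam B I).comp SemidirectProduct.rightHom)) d x = x := by
  refine semi_edge (nact B I) (co F I) (cr1 k M (nact B I)) (fun _ => rfl) (fun _ => rfl) d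
    (fun i l hil => TT_all h2 p d I i (l + 1) (by omega) (by omega) _ (D (cr1 k M (nact B I)) (l + 1))
      (nact_red _ l) ?_) _ x
  have h5 := nact_good (B := B) (I := I) h2 h2' p M ((cr1 k M (nact B I)).comp (dg F I)) 0 (l + 1) (wt_one h2 _)
  have h6 := h5.mono (b' := 2 * (l + 1) + 1) (by omega)
  exact h6

theorem gam_edge2 (h2 : (2 : k) ≠ 0) (h2' : (2 : F) ≠ 0) (p : ℕ) [Fact p.Prime] [CharP k p] [Finite k]
    [CharP F p] [Fintype F] [Finite U] (u0 : U) (r : U → F) (hr : ∀ t, B.b r t = t u0)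
    (d : ℕ) (hd : d ≤ Fintype.card I)
    (x : H d (1 : Representation k (Gam B I) M)) :
    Hmap (tc k M ((SemidirectProduct.inr : _ →* Gam B I).comp SemidirectProduct.rightHom)) d x = x := by
  refine semi_edge (nact B I) (co F I) (cr1 k M (nact B I)) (fun _ => rfl) (fun _ => rfl) d
    (fun i l hil => TT_all h2 p d I i l (by omega) (by omega) _ (D (cr1 k M (nact B I)) (l + 1))
      (nact_red _ l) ?_) _ x
  have h5 := nact_wp (B := B) (I := I) h2 h2' p u0 r hr M ((cr1 k M (nact B I)).comp (dg F I)) 0 l (wt_one h2 _)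
  have h6 := h5.mono (b' := 2 * l + 1) (by omega)
  exact h6

theorem gam_vanish (h2 : (2 : k) ≠ 0) (h2' : (2 : F) ≠ 0) (p : ℕ) [Fact p.Prime] [CharP k p] [Finite k]
    [CharP F p] [Fintype F] [Finite U] (d : ℕ) (hd0 : 0 < d) (hd : d < Fintype.card I) :
    Subsingleton (H d (1 : Representation k (Gam B I) M)) := by
  obtain ⟨a, rfl⟩ : ∃ a, d = a + 1 := ⟨d - 1, by omega⟩
  have := C_thm (M := M) (I := I) h2 p a (TT_all (F := F) h2 p a) hd
  refine subsingleton_of_forall_eq 0 fun x => ?_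
  rw [← gam_edge1 h2 h2' p (a + 1) hd x, tc_comp, Subsingleton.elim (Hmap _ _ x) 0, map_zero]

/-- skew element -/
def zz (B : SB F U) (f : I) (v : I → F) : NN B I :=
  ⟨0, fun i j => v i * (if j = f then 1 else 0) - (if i = f then 1 else 0) * v j, fun i j => by simp⟩

theorem zz_add (f : I) (v w : I → F) : zz B f (v + w) = zz B f v * zz B f w := by
  ext i j
  · simp [zz]
  · simp [zz]; split_ifs <;> ring

/-- fixing a coordinate -/
def Fx (f : I) (y : Matrix I I F) : Prop := ∀ i, y i f = (if i = f then 1 else 0) ∧ y f i = if i = f then 1 else 0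

theorem zz_nact (f : I) (v : I → F) (y : Matrix I I F) (hy : Fx f y) :
    (nact B I).f y (zz B f v) = zz B f (y.mulVec v) := by
  ext i j
  · simp [nact, zz]
  · have h1 : ∀ i, y i f = if i = f then 1 else 0 := fun i => (hy i).1
    simp only [nact, zz, MonoidHom.coe_mk, OneHom.coe_mk, Matrix.mulVec, dotProduct]
    have : ∀ a b, y i a * y j b * (v a * (if b = f then 1 else 0) - (if a = f then 1 else 0) * v b) =
      (if b = f then y i a * y j b * v a else 0) - (if a = f then y i a * y j b * v b else 0) := by
      intro a b; split_ifs <;> ring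
    simp only [this, Finset.sum_sub_distrib, Finset.sum_ite_eq', Finset.mem_univ, if_true]
    rw [Finset.sum_comm]
    simp only [Finset.sum_ite_eq', Finset.mem_univ, if_true, h1, Finset.sum_mul, Finset.mul_sum]
    congr 1
    · refine Finset.sum_congr rfl fun a _ => by ring
    · refine Finset.sum_congr rfl fun a _ => by ring

section swap
variable {A R : Type} [Fintype A] [DecidableEq A] [Fintype R] [DecidableEq R]

/-- extension by zero -/
def exz (β : (A ⊕ Unit) ⊕ R ≃ I) : Multiplicative (A → F) →* NN B I where
  toFun v := zz B (β (Sum.inl (Sum.inr ()))) (fun i => Sum.elim (Sum.elim v.toAdd 0) 0 (β.symm i))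
  map_one' := by
    ext i j
    · rfl
    · have : ∀ i, (Sum.elim (Sum.elim (Multiplicative.toAdd (1 : Multiplicative (A → F))) (0 : Unit → F)) (0 : R → F) (β.symm i)) = 0 := by
        intro i; rcases β.symm i with (a | a) | a <;> simp
      simp only [zz, this]; simp
  map_mul' a b := by
    rw [← zz_add]; congr 1
    ext i
    simp only [Pi.add_apply]
    rcases β.symm i with (a | a) | a <;> simp

theorem swap_abs (h2 : (2 : k) ≠ 0) (h2' : (2 : F) ≠ 0) (p : ℕ) [Fact p.Prime] [CharP k p] [Finite k]
    [CharP F p] [Fintype F] [Finite U] (u0 : U) (r : U → F) (hr : ∀ t, B.b r t = t u0)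
    {O : Type} [Group O] [Finite O] (Φ : Gam B I →* O)
    (hsw : ∀ f : I, ∃ σ : O,
      (∀ v : I → F, v f = 0 → ∀ y : GLu F I, (∀ i j, y.1 i j = (if i = j then 1 else 0) + v i * if j = f then 1 else 0) →
        σ * Φ (SemidirectProduct.inr y) * σ⁻¹ = Φ (SemidirectProduct.inl (zz B f v))) ∧
      (∀ y : GLu F I, Fx f y.1 → Fx f y⁻¹.1 → σ * Φ (SemidirectProduct.inr y) * σ⁻¹ = Φ (SemidirectProduct.inr y)))
    (d : ℕ) (hd0 : 0 < d) (hd : d ≤ Fintype.card I) (n : ℕ) :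
    ∀ (A R : Type) [Fintype A] [DecidableEq A] [Fintype R] [DecidableEq R] (β : A ⊕ R ≃ I), Fintype.card A = n →
    Zr k M d (((Φ.comp SemidirectProduct.inr).comp (Units.map (rx F β))).comp (Units.map (emb F A R))) := by
  obtain ⟨a, rfl⟩ : ∃ a, d = a + 1 := ⟨d - 1, by omega⟩
  induction n with
  | zero =>
    intro A R _ _ _ _ β hA
    have : IsEmpty A := Fintype.card_eq_zero_iff.1 hA
    have : Subsingleton (GLu F A) := ⟨fun x y => Units.ext (Subsingleton.elim _ _)⟩
    have := H_succ_of_subsingleton (1 : Representation k (GLu F A) M) a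
    intro x
    rw [Subsingleton.elim x 0, map_zero]
  | succ j ih =>
    intro A R _ _ _ _ β' hA
    obtain ⟨e⟩ : Nonempty (Fin j ⊕ Unit ≃ A) := ⟨Fintype.equivOfCardEq (by simp [hA])⟩
    refine Zr.of_surj (tc_surj_bij _ (units_bij _ (rx_bij e)) _)
      (Zr.of_surj (tc_surj _ affGL_inj (affGL_index p) _) ?_)
    let β : (Fin j ⊕ Unit) ⊕ R ≃ I := (Equiv.sumCongr e (Equiv.refl R)).trans β'
    let γ : Fin j ⊕ (Unit ⊕ R) ≃ I := (Equiv.sumAssoc _ _ _).symm.trans β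
    set f : I := β (Sum.inl (Sum.inr ())) with hf
    obtain ⟨σ, hσ1, hσ2⟩ := hsw f
    let χ : GLu F (Fin j) →* GLu F I := (Units.map (rx F γ)).comp (Units.map (emb F (Fin j) (Unit ⊕ R)))
    have hχ : ∀ x, Fx f (χ x).1 := by
      intro x i
      change rx F γ (emb F _ _ (Units.val x)) i f = _ ∧ rx F γ (emb F _ _ (Units.val x)) f i = _
      have : f = γ (Sum.inr (Sum.inl ())) := rfl
      rw [this]
      obtain ⟨i, rfl⟩ := γ.surjective i
      rcases i with i | (i | i) <;> simp [rx, emb, Matrix.one_apply]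
    have hχe : ∀ (x : GLu F (Fin j)) (v : Fin j → F), (fun i => Sum.elim (Sum.elim (x.1.mulVec v) 0) 0 (β.symm i)) =
        (χ x).1.mulVec (fun i => Sum.elim (Sum.elim v (0 : Unit → F)) (0 : R → F) (β.symm i)) := by
      intro x v
      ext i
      change _ = (rx F γ (emb F _ _ (Units.val x))).mulVec _ i
      obtain ⟨i, rfl⟩ := β.surjective i
      rw [Matrix.mulVec, dotProduct, ← Equiv.sum_comp β]
      rcases i with (i | i) | i <;> simp [rx, emb, γ, Matrix.mulVec, dotProduct]
    let θ : AffG F (Fin j) →* Gam B I := Semi.lift (SemidirectProduct.inl.comp (exz β)) (SemidirectProduct.inr.comp χ)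
      (fun y n => by
        have h3 := SemidirectProduct.inl_aut (φ := ((nact B I).comp (co F I)).aut) (χ y) (exz β n)
        have h4 : ((nact B I).comp (co F I)).aut (χ y) (exz β n) = exz β (((amat F (Fin j)).comp (co F (Fin j))).f y n) := by
          refine (zz_nact (B := B) f _ (χ y).1 (hχ y)).trans ?_
          rw [← hχe]
          rfl
        rw [h4] at h3
        change SemidirectProduct.inr (χ y) * SemidirectProduct.inl (exz β n) = SemidirectProduct.inl _ * SemidirectProduct.inr (χ y)
        rw [h3]; simp)
    let μ := (((Φ.comp SemidirectProduct.inr).comp (Units.map (rx F β'))).comp (Units.map (emb F A R))).comp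
      ((Units.map (rx F e)).comp (affGL F (Fin j)))
    have e1 : ∀ x, σ * μ x * σ⁻¹ = Φ (θ x) := by
      intro x
      let y1 : GLu F I := Units.map (rx F β') (Units.map (emb F A R) (Units.map (rx F e) (affGL F (Fin j) (SemidirectProduct.inl x.left))))
      let y2 : GLu F I := Units.map (rx F β') (Units.map (emb F A R) (Units.map (rx F e) (affGL F (Fin j) (SemidirectProduct.inr x.right))))
      have h3 : μ x = Φ (SemidirectProduct.inr y1) * Φ (SemidirectProduct.inr y2) := by
        conv_lhs => rw [← SemidirectProduct.inl_left_mul_inr_right x, map_mul]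
        rfl
      have h4 : y2 = χ x.right := by
        refine Units.ext ?_
        change rx F β' (emb F A R (rx F e (Units.val (affGL F _ _)))) = rx F γ (emb F _ _ (Units.val x.right))
        rw [affGL_coe]
        ext a b
        obtain ⟨a, rfl⟩ := β.surjective a
        obtain ⟨b, rfl⟩ := β.surjective b
        rcases a with (a | a) | a <;> rcases b with (b | b) | b <;>
          simp [β, γ, rx, emb, Matrix.one_apply]
      have h5 : σ * Φ (SemidirectProduct.inr y1) * σ⁻¹ = Φ (SemidirectProduct.inl (exz β x.left)) := by
        refine hσ1 _ ?_ y1 ?_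
        · simp [hf]
        · intro a b
          change rx F β' (emb F A R (rx F e (Units.val (affGL F _ _)))) a b = _
          rw [affGL_coe, hf]
          obtain ⟨a, rfl⟩ := β.surjective a
          obtain ⟨b, rfl⟩ := β.surjective b
          rcases a with (a | a) | a <;> rcases b with (b | b) | b <;>
            simp [β, γ, rx, emb, Matrix.one_apply]
      have h6 := hσ2 (χ x.right) (hχ _) (by rw [← map_inv]; exact hχ _)
      have h7 : Φ (θ x) = Φ (SemidirectProduct.inl (exz β x.left)) * Φ (SemidirectProduct.inr (χ x.right)) := map_mul Φ _ _
      rw [h7, ← h5, ← h6, h3, h4]; group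
    intro x
    have key := Hmap_conj σ (a + 1) (tc k M (MulAut.conj σ).toMonoidHom) (fun x => rfl) rfl
      (Hmap (tc k M μ) (a + 1) x)
    rw [← tc_comp] at key
    have e2 : (MulAut.conj σ).toMonoidHom.comp μ = Φ.comp θ := MonoidHom.ext e1
    rw [e2] at key
    refine Eq.trans ?_ (key.symm.trans ?_)
    · rfl
    rw [tc_comp, ← gam_edge2 h2 h2' p u0 r hr (a + 1) hd (Hmap (tc k M θ) _ x), ← tc_comp, ← tc_comp]
    have e3 : (Φ.comp (SemidirectProduct.inr.comp SemidirectProduct.rightHom)).comp θ =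
      (((Φ.comp SemidirectProduct.inr).comp (Units.map (rx F γ))).comp (Units.map (emb F (Fin j) (Unit ⊕ R)))).comp
        SemidirectProduct.rightHom := by
      refine MonoidHom.ext fun x => ?_
      change Φ (SemidirectProduct.inr (1 * χ x.right)) = Φ (SemidirectProduct.inr (χ x.right))
      rw [one_mul]
    rw [e3]
    exact (ih (Fin j) (Unit ⊕ R) γ (by simp)).right _ x

theorem swap_vanish (h2 : (2 : k) ≠ 0) (h2' : (2 : F) ≠ 0) (p : ℕ) [Fact p.Prime] [CharP k p] [Finite k]
    [CharP F p] [Fintype F] [Finite U] (u0 : U) (r : U → F) (hr : ∀ t, B.b r t = t u0)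
    {O : Type} [Group O] [Finite O] (Φ : Gam B I →* O) (hΦ : Function.Injective Φ) (hi : (Φ.range.index : k) ≠ 0)
    (hsw : ∀ f : I, ∃ σ : O,
      (∀ v : I → F, v f = 0 → ∀ y : GLu F I, (∀ i j, y.1 i j = (if i = j then 1 else 0) + v i * if j = f then 1 else 0) →
        σ * Φ (SemidirectProduct.inr y) * σ⁻¹ = Φ (SemidirectProduct.inl (zz B f v))) ∧
      (∀ y : GLu F I, Fx f y.1 → Fx f y⁻¹.1 → σ * Φ (SemidirectProduct.inr y) * σ⁻¹ = Φ (SemidirectProduct.inr y)))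
    (d : ℕ) (hd0 : 0 < d) (hd : d ≤ Fintype.card I) : Subsingleton (H d (1 : Representation k O M)) := by
  have h := swap_abs (M := M) h2 h2' p u0 r hr Φ hsw d hd0 hd _ I Empty (Equiv.sumEmpty I Empty) rfl
  refine subsingleton_of_forall_eq 0 fun x => ?_
  obtain ⟨x, rfl⟩ := tc_surj (M := M) Φ hΦ hi d x
  rw [← gam_edge2 h2 h2' p u0 r hr d hd x, ← tc_comp]
  refine Zr.right (φ := Φ.comp SemidirectProduct.inr) (fun x => ?_) SemidirectProduct.rightHom x
  have e : (((Φ.comp SemidirectProduct.inr).comp (Units.map (rx F (Equiv.sumEmpty I Empty)))).comp (Units.map (emb F I Empty))) =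
    Φ.comp SemidirectProduct.inr := by
    refine MonoidHom.ext fun x => ?_
    refine congrArg (fun t => Φ (SemidirectProduct.inr t)) (Units.ext ?_)
    change rx F _ (emb F I Empty (Units.val x)) = Units.val x
    ext i j
    simp [rx, emb]
  rw [e] at h
  exact h x

end swap
end GH

end

/-! ## Part O -/

section
set_option linter.unusedSectionVars false
set_option linter.unusedVariables false
set_option linter.unusedSimpArgs false

namespace GH

/-- isometry group of a function -/
def OG {F V : Type} [Field F] [AddCommGroup V] [Module F V] (q : V → F) : Subgroup (V ≃ₗ[F] V) where
  carrier := {g | ∀ v, q (g v) = q v}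
  one_mem' := fun v => rfl
  mul_mem' := fun {a b} ha hb v => (ha (b v)).trans (hb v)
  inv_mem' := fun {a} ha v => by
    have := ha (a⁻¹ v)
    rw [← this]
    exact congrArg q (a.apply_symm_apply v)

variable {F U : Type} [Field F] {B : SB F U} {I : Type} [Fintype I] [DecidableEq I]

abbrev EE' (F U I : Type) := (I → F) × (I → F) × (U → F)

def bm (B : SB F U) (v w : EE' F U I) : F := ∑ i, v.1 i * w.2.1 i + ∑ i, w.1 i * v.2.1 i + B.b v.2.2 w.2.2

noncomputable def qm (B : SB F U) (v : EE' F U I) : F := ∑ i, v.1 i * v.2.1 i + B.b v.2.2 v.2.2 / 2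

theorem qm_add (h2 : (2 : F) ≠ 0) (v w : EE' F U I) : qm B (v + w) = qm B v + qm B w + bm B v w := by
  simp only [qm, bm, Prod.fst_add, Prod.snd_add, Pi.add_apply, mul_add, add_mul, Finset.sum_add_distrib, map_add,
    LinearMap.add_apply, B.symm w.2.2 v.2.2]
  have : ∑ x, v.2.1 x * w.1 x = ∑ x, w.1 x * v.2.1 x := Finset.sum_congr rfl fun _ _ => mul_comm _ _
  field_simp
  ring

theorem bm_iso (h2 : (2 : F) ≠ 0) (g : OG (qm (I := I) B)) (v w : EE' F U I) : bm B (g.1 v) (g.1 w) = bm B v w := by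
  have h1 := qm_add (B := B) h2 (g.1 v) (g.1 w)
  rw [← map_add, g.2, g.2, g.2, qm_add h2] at h1
  linear_combination -h1

/-- unipotent action -/
def nE (B : SB F U) (I : Type) [Fintype I] [DecidableEq I] : NN B I →* Module.End F (EE' F U I) where
  toFun n :=
    { toFun := fun v => (fun i => v.1 i - B.b (n.T i) v.2.2 + ∑ j, n.Z i j * v.2.1 j, v.2.1, v.2.2 + ∑ i, v.2.1 i • n.T i)
      map_add' := fun v w => by
        ext i
        · simp [mul_add, Finset.sum_add_distrib]; ring
        · simp
        · simp [add_mul, Finset.sum_add_distrib]; ring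
      map_smul' := fun c v => by
        ext i
        · simp [mul_add, mul_sub, Finset.mul_sum, mul_left_comm]
        · simp
        · simp [mul_add, Finset.mul_sum, mul_assoc] }
  map_one' := by
    ext v i <;> simp
  map_mul' a b := by
    refine LinearMap.ext fun v => ?_
    ext i
    · simp only [NN.mul_T, NN.mul_Z, LinearMap.coe_mk, AddHom.coe_mk, Module.End.mul_apply, Pi.add_apply, map_add,
        LinearMap.add_apply, add_mul, sub_mul, Finset.sum_add_distrib, Finset.sum_sub_distrib, map_sum, map_smul, smul_eq_mul]
      have : ∑ x, v.2.1 x * B.b (a.T i) (b.T x) = ∑ x, B.b (a.T i) (b.T x) * v.2.1 x :=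
        Finset.sum_congr rfl fun _ _ => mul_comm _ _
      rw [this]; ring
    · simp
    · simp [mul_add, Finset.sum_add_distrib]; ring

theorem nE_apply (n : NN B I) (v : EE' F U I) : nE B I n v =
   (fun i => v.1 i - B.b (n.T i) v.2.2 + ∑ j, n.Z i j * v.2.1 j, v.2.1, v.2.2 + ∑ i, v.2.1 i • n.T i) := rfl

/-- linear action -/
def gE (F U I : Type) [Field F] [Fintype I] [DecidableEq I] : GLu F I →* Module.End F (EE' F U I) where
  toFun x :=
    { toFun := fun v => (x.1.mulVec v.1, (x⁻¹).1.transpose.mulVec v.2.1, v.2.2)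
      map_add' := fun v w => by simp [Matrix.mulVec_add]
      map_smul' := fun c v => by simp [Matrix.mulVec_smul] }
  map_one' := by ext v i <;> simp
  map_mul' a b := by
    refine LinearMap.ext fun v => ?_
    simp [Matrix.mulVec_mulVec, Matrix.transpose_mul]

theorem gE_apply (x : GLu F I) (v : EE' F U I) : gE F U I x v =
  (x.1.mulVec v.1, (x⁻¹).1.transpose.mulVec v.2.1, v.2.2) := rfl

theorem sum_inv (x : GLu F I) (b : I → F) (f : I → F) :
    ∑ i, (x⁻¹).1.transpose.mulVec b i * (∑ a, x.1 i a * f a) = ∑ i, b i * f i := by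
  change (x⁻¹).1.transpose.mulVec b ⬝ᵥ x.1.mulVec f = b ⬝ᵥ f
  rw [Matrix.mulVec_transpose, ← Matrix.dotProduct_mulVec, Matrix.mulVec_mulVec, ← Units.val_mul, inv_mul_cancel]
  simp

def gamE (B : SB F U) (I : Type) [Fintype I] [DecidableEq I] : Gam B I →* Module.End F (EE' F U I) :=
  Semi.lift (nE B I) (gE F U I) (fun y n => by
    refine LinearMap.ext fun v => ?_
    rw [Module.End.mul_apply, Module.End.mul_apply, nE_apply, gE_apply, gE_apply, nE_apply]
    have hT : ∀ i, ((((nact B I).comp (co F I)).f y) n).T i = ∑ a, y.1 i a • n.T a := fun i => rfl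
    have hZ : ∀ i j, ((((nact B I).comp (co F I)).f y) n).Z i j = ∑ a, ∑ b, y.1 i a * y.1 j b * n.Z a b := fun i j => rfl
    simp only [hT, hZ]
    refine Prod.ext (funext fun i => ?_) (Prod.ext rfl (funext fun u => ?_))
    · have h3 : ∑ j, (∑ a, ∑ b, y.1 i a * y.1 j b * n.Z a b) * (y⁻¹).1.transpose.mulVec v.2.1 j =
          ∑ a, y.1 i a * ∑ j, n.Z a j * v.2.1 j := by
        have h4 : ∀ a, ∑ j, n.Z a j * v.2.1 j = ∑ j, (y⁻¹).1.transpose.mulVec v.2.1 j * (∑ b, y.1 j b * n.Z a b) := by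
          intro a; rw [sum_inv]; exact Finset.sum_congr rfl fun _ _ => mul_comm _ _
        simp only [h4, Finset.mul_sum, Finset.sum_mul]
        rw [Finset.sum_comm]
        refine Finset.sum_congr rfl fun a _ => Finset.sum_congr rfl fun j _ => Finset.sum_congr rfl fun b _ => ?_
        ring
      dsimp only
      rw [h3]
      simp only [Matrix.mulVec, dotProduct, mul_add, mul_sub, Finset.sum_add_distrib, Finset.sum_sub_distrib, map_sum,
        LinearMap.sum_apply, map_smul, LinearMap.smul_apply, smul_eq_mul]
    · simp only [Pi.add_apply, Finset.sum_apply, Pi.smul_apply, smul_eq_mul]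
      rw [sum_inv y v.2.1 (fun i => n.T i u)])

theorem gamE_apply (g : Gam B I) (v) : gamE B I g v = nE B I g.left (gE F U I g.right v) := rfl

theorem nE_iso (h2 : (2 : F) ≠ 0) (n : NN B I) (v : EE' F U I) : qm B (nE B I n v) = qm B v := by
  rw [nE_apply]
  have h1 : ∑ i, ∑ j, v.2.1 i * v.2.1 j * (n.Z i j + n.Z j i + B.b (n.T i) (n.T j)) = 0 :=
    Finset.sum_eq_zero fun i _ => Finset.sum_eq_zero fun j _ => by rw [n.h, mul_zero]
  simp only [mul_add, Finset.sum_add_distrib] at h1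
  have h3 : ∑ i, ∑ j, v.2.1 i * v.2.1 j * n.Z j i = ∑ i, ∑ j, v.2.1 i * v.2.1 j * n.Z i j := by
    rw [Finset.sum_comm]
    exact Finset.sum_congr rfl fun _ _ => Finset.sum_congr rfl fun _ _ => by ring
  rw [h3] at h1
  have h4 : ∑ i, (∑ j, n.Z i j * v.2.1 j) * v.2.1 i = ∑ i, ∑ j, v.2.1 i * v.2.1 j * n.Z i j := by
    simp only [Finset.sum_mul]
    exact Finset.sum_congr rfl fun _ _ => Finset.sum_congr rfl fun _ _ => by ring
  have h5 : ∑ i, B.b (n.T i) v.2.2 * v.2.1 i = B.b v.2.2 (∑ i, v.2.1 i • n.T i) := by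
    rw [map_sum]
    exact Finset.sum_congr rfl fun _ _ => by rw [map_smul, B.symm, smul_eq_mul, mul_comm]
  have h6 : B.b (∑ i, v.2.1 i • n.T i) (∑ i, v.2.1 i • n.T i) = ∑ i, ∑ j, v.2.1 i * v.2.1 j * B.b (n.T i) (n.T j) := by
    rw [map_sum B.b, LinearMap.sum_apply]
    refine Finset.sum_congr rfl fun _ _ => ?_
    rw [map_sum]
    refine Finset.sum_congr rfl fun _ _ => ?_
    simp [mul_assoc]; ring
  simp only [qm, add_mul, sub_mul, Finset.sum_add_distrib, Finset.sum_sub_distrib, map_add, LinearMap.add_apply, h4, h5, h6,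
    B.symm (∑ i, v.2.1 i • n.T i) v.2.2]
  field_simp
  linear_combination h1

theorem gE_iso (x : GLu F I) (v : EE' F U I) : qm B (gE F U I x v) = qm B v := by
  rw [gE_apply, qm, qm]
  congr 1
  have := sum_inv x v.2.1 v.1
  refine Eq.trans (Finset.sum_congr rfl fun i _ => ?_) (this.trans (Finset.sum_congr rfl fun i _ => mul_comm _ _))
  exact mul_comm _ _

/-- the parabolic inside the isometry group -/
noncomputable def Phi (h2 : (2 : F) ≠ 0) (B : SB F U) (I : Type) [Fintype I] [DecidableEq I] : Gam B I →* OG (qm (I := I) B) :=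
  ((LinearMap.GeneralLinearGroup.generalLinearEquiv F (EE' F U I)).toMonoidHom.comp (gamE B I).toHomUnits).codRestrict _
    (fun g v => (nE_iso h2 _ _).trans (gE_iso _ _))

theorem Phi_apply (h2 : (2 : F) ≠ 0) (g : Gam B I) (v) : (Phi h2 B I g).1 v = nE B I g.left (gE F U I g.right v) := rfl

theorem Phi_inj (h2 : (2 : F) ≠ 0) : Function.Injective (Phi h2 B I) := by
  rw [injective_iff_map_eq_one]
  intro g hg
  have h : ∀ v, nE B I g.left (gE F U I g.right v) = v := fun v => by rw [← Phi_apply h2, hg]; rfl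
  have hx : g.right = 1 := by
    refine Units.ext (Matrix.ext fun a i => ?_)
    have := congrFun (congrArg Prod.fst (h (Pi.single i 1, 0, 0))) a
    simpa [nE_apply, gE_apply, Matrix.one_apply, Pi.single_apply] using this
  have hn : g.left = 1 := by
    have h' : ∀ j, nE B I g.left (0, Pi.single j 1, 0) = (0, Pi.single j 1, 0) := fun j => by
      have := h (0, Pi.single j 1, 0)
      rwa [hx, map_one] at this
    ext i j
    · have := congrFun (congrArg (fun t => t.2.2) (h' i)) j
      simpa [nE_apply, Pi.single_apply] using this
    · have := congrFun (congrArg (fun t => t.1) (h' j)) i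
      simpa [nE_apply, Pi.single_apply] using this
  ext1
  · exact hn
  · exact hx

/-- swap of a hyperbolic pair -/
def swE (F U : Type) [Field F] {I : Type} [Fintype I] [DecidableEq I] (f : I) : EE' F U I ≃ₗ[F] EE' F U I :=
  LinearEquiv.ofInvolutive
    { toFun := fun v => (Function.update v.1 f (v.2.1 f), Function.update v.2.1 f (v.1 f), v.2.2)
      map_add' := fun v w => by
        ext i
        · by_cases h : i = f
          · subst h; simp
          · simp [h]
        · by_cases h : i = f
          · subst h; simp
          · simp [h]
        · simp
      map_smul' := fun c v => by
        ext i
        · by_cases h : i = f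
          · subst h; simp
          · simp [h]
        · by_cases h : i = f
          · subst h; simp
          · simp [h]
        · simp }
    (fun v => by
        ext i
        · by_cases h : i = f
          · subst h; simp
          · simp [h]
        · by_cases h : i = f
          · subst h; simp
          · simp [h]
        · simp)

theorem swE_apply (f : I) (v : EE' F U I) :
    swE F U f v = (Function.update v.1 f (v.2.1 f), Function.update v.2.1 f (v.1 f), v.2.2) := rfl

theorem swE_iso (f : I) (v : EE' F U I) : qm B (swE F U f v) = qm B v := by
  rw [swE_apply, qm, qm]
  congr 1
  refine Finset.sum_congr rfl fun i _ => ?_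
  by_cases h : i = f
  · subst h; simp [mul_comm]
  · simp [h]

theorem Fx.transpose {f : I} {y : Matrix I I F} (h : Fx f y) : Fx f y.transpose := fun i => ⟨(h i).2, (h i).1⟩

theorem Fx.update {f : I} {y : Matrix I I F} (h : Fx f y) (a : I → F) (c : F) :
    y.mulVec (Function.update a f c) = Function.update (y.mulVec a) f c := by
  ext i
  simp only [Matrix.mulVec, dotProduct]
  by_cases hi : i = f
  · subst hi
    simp [fun j => (h j).2]
  · rw [Function.update_of_ne hi]
    refine Finset.sum_congr rfl fun j _ => ?_
    by_cases hj : j = f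
    · subst hj; simp [(h i).1, hi]
    · rw [Function.update_of_ne hj]

theorem Fx.at {f : I} {y : Matrix I I F} (h : Fx f y) (a : I → F) : y.mulVec a f = a f := by
  simp [Matrix.mulVec, dotProduct, fun j => (h j).2]

theorem hsw (h2 : (2 : F) ≠ 0) (f : I) : ∃ σ : OG (qm (I := I) B),
      (∀ v : I → F, v f = 0 → ∀ y : GLu F I, (∀ i j, y.1 i j = (if i = j then 1 else 0) + v i * if j = f then 1 else 0) →
        σ * Phi h2 B I (SemidirectProduct.inr y) * σ⁻¹ = Phi h2 B I (SemidirectProduct.inl (zz B f v))) ∧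
      (∀ y : GLu F I, Fx f y.1 → Fx f y⁻¹.1 → σ * Phi h2 B I (SemidirectProduct.inr y) * σ⁻¹ =
        Phi h2 B I (SemidirectProduct.inr y)) := by
  refine ⟨⟨swE F U f, swE_iso f⟩, fun v hv y hy => ?_, fun y h1 h3 => ?_⟩
  · rw [mul_inv_eq_iff_eq_mul]
    refine Subtype.ext (LinearEquiv.ext fun w => ?_)
    change swE F U f (nE B I 1 (gE F U I y w)) = nE B I (zz B f v) (gE F U I 1 (swE F U f w))
    have hy' : (y⁻¹).1 = Matrix.of fun i j => (if i = j then 1 else 0) - v i * if j = f then 1 else 0 := by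
      apply Units.inv_eq_of_mul_eq_one_right
      ext i j
      simp only [Matrix.mul_apply, hy, Matrix.of_apply, Matrix.one_apply]
      simp [add_mul, mul_sub, Finset.sum_add_distrib, Finset.sum_sub_distrib, hv]
    rw [map_one, map_one, Module.End.one_apply, Module.End.one_apply, swE_apply, gE_apply, nE_apply, swE_apply]
    refine Prod.ext (funext fun i => ?_) (Prod.ext (funext fun i => ?_) ?_)
    · by_cases hi : i = f
      · subst hi
        simp [zz, hy', Matrix.mulVec, dotProduct, hv, sub_mul, Finset.sum_sub_distrib]
        rw [sub_eq_add_neg]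
        congr 2
        refine Finset.sum_congr rfl fun x _ => ?_
        by_cases hx : x = i
        · subst hx; simp [hv]
        · rw [Function.update_of_ne hx]
      · simp [zz, hi, hy, Matrix.mulVec, dotProduct, add_mul, Finset.sum_add_distrib]
    · by_cases hi : i = f
      · subst hi
        simp [hy, Matrix.mulVec, dotProduct, hv, add_mul, Finset.sum_add_distrib]
      · simp [hi, hy', Matrix.mulVec, dotProduct, sub_mul, Finset.sum_sub_distrib]
    · simp [zz]
  · rw [mul_inv_eq_iff_eq_mul]
    refine Subtype.ext (LinearEquiv.ext fun w => ?_)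
    change swE F U f (nE B I 1 (gE F U I y w)) = nE B I 1 (gE F U I y (swE F U f w))
    rw [map_one, Module.End.one_apply, Module.End.one_apply, swE_apply, gE_apply, gE_apply, swE_apply]
    simp only [h1.update, h3.transpose.update, h1.at, h3.transpose.at]

theorem Phi_range (h2 : (2 : F) ≠ 0) (g : OG (qm (I := I) B)) (hg1 : ∀ a, (g.1 (a, 0, 0)).2 = 0)
    (hg2 : ∀ c, (g.1 (0, 0, c)).2 = (0, c)) : g ∈ (Phi h2 B I).range := by
  let X : (I → F) →ₗ[F] (I → F) := (LinearMap.fst F _ _).comp (g.1.toLinearMap.comp (LinearMap.inl F _ _))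
  have hX : ∀ a, g.1 (a, 0, 0) = (X a, 0, 0) := fun a => Prod.ext rfl (hg1 a)
  have hXi : Function.Injective X := by
    intro a b h
    have : g.1 (a, 0, 0) = g.1 (b, 0, 0) := by rw [hX, hX, h]
    exact congrArg Prod.fst (g.1.injective this)
  let Xe : (I → F) ≃ₗ[F] (I → F) := LinearEquiv.ofInjectiveEndo X hXi
  have hXu : IsUnit (LinearMap.toMatrix' X) := by
    have h3 : X ∘ₗ Xe.symm.toLinearMap = LinearMap.id := by
      ext1; exact LinearMap.ext fun v => Xe.apply_symm_apply _
    have h4 : Xe.symm.toLinearMap ∘ₗ X = LinearMap.id := by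
      ext1; exact LinearMap.ext fun v => Xe.symm_apply_apply _
    exact ⟨⟨LinearMap.toMatrix' X, LinearMap.toMatrix' Xe.symm.toLinearMap, by
      rw [← LinearMap.toMatrix'_comp, h3, LinearMap.toMatrix'_id], by
      rw [← LinearMap.toMatrix'_comp, h4, LinearMap.toMatrix'_id]⟩, rfl⟩
  obtain ⟨x, hx⟩ := hXu
  have hx' : ∀ a, x.1.mulVec a = X a := fun a => by rw [hx, LinearMap.toMatrix'_mulVec]
  set h : OG (qm (I := I) B) := g * (Phi h2 B I (SemidirectProduct.inr x))⁻¹ with hh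
  have hgx : ∀ v, h.1 ((Phi h2 B I (SemidirectProduct.inr x)).1 v) = g.1 v := by
    intro v
    have : h * Phi h2 B I (SemidirectProduct.inr x) = g := by rw [hh]; group
    exact congrArg (fun t : OG (qm (I := I) B) => t.1 v) this
  have hP : ∀ v, (Phi h2 B I (SemidirectProduct.inr x)).1 v = gE F U I x v := by
    intro v
    change nE B I 1 _ = _
    rw [map_one]; rfl
  have k1 : ∀ a, h.1 (a, 0, 0) = (a, 0, 0) := by
    intro a
    have h3 := hgx (Xe.symm a, 0, 0)
    have h4 : X (Xe.symm a) = a := Xe.apply_symm_apply a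
    rw [hP, hX, gE_apply] at h3
    simpa [hx', h4] using h3
  have k2 : ∀ c, (h.1 (0, 0, c)).2 = (0, c) := by
    intro c
    have h3 := hgx (0, 0, c)
    rw [hP, gE_apply] at h3
    have h4 : h.1 (0, 0, c) = g.1 (0, 0, c) := by simpa using h3
    rw [h4, hg2]
  let T : I → U → F := fun i => (h.1 (0, Pi.single i 1, 0)).2.2
  let Z : I → I → F := fun i j => (h.1 (0, Pi.single j 1, 0)).1 i
  have k3 : ∀ j, (h.1 (0, Pi.single j 1, 0)).2.1 = Pi.single j 1 := by
    intro j
    ext i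
    have h3 := bm_iso h2 h (Pi.single i 1, 0, 0) (0, Pi.single j 1, 0)
    rw [k1] at h3
    simp [bm, Pi.single_apply] at h3
    rw [h3, Pi.single_apply]; simp [eq_comm]
  let n : NN B I := ⟨T, Z, fun i j => by
    have h3 := bm_iso h2 h (0, Pi.single i 1, 0) (0, Pi.single j 1, 0)
    simp only [bm, k3] at h3
    simp [Pi.single_apply] at h3
    rw [← h3]; simp only [Z, T]; ring⟩
  have key : h = Phi h2 B I (SemidirectProduct.inl n) := by
    refine Subtype.ext (LinearEquiv.toLinearMap_injective ?_)
    refine LinearMap.prod_ext (LinearMap.ext fun a => ?_) (LinearMap.prod_ext (LinearMap.pi_ext' fun j => LinearMap.ext_ring ?_) (LinearMap.ext fun c => ?_))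
    · change h.1 (a, 0, 0) = nE B I n (gE F U I 1 (a, 0, 0))
      rw [k1, map_one, Module.End.one_apply, nE_apply]
      simp
    · change h.1 (0, Pi.single j 1, 0) = nE B I n (gE F U I 1 (0, Pi.single j 1, 0))
      rw [map_one, Module.End.one_apply, nE_apply]
      refine Prod.ext (funext fun i => ?_) (Prod.ext (k3 j) (funext fun u => ?_))
      · simp [n, Z, Pi.single_apply]
      · simp [n, T, Pi.single_apply]
    · change h.1 (0, 0, c) = nE B I n (gE F U I 1 (0, 0, c))
      rw [map_one, Module.End.one_apply, nE_apply]
      refine Prod.ext (funext fun i => ?_) ?_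
      · have h3 := bm_iso h2 h (0, 0, c) (0, Pi.single i 1, 0)
        simp only [bm, k3, k2] at h3
        simp [Pi.single_apply] at h3
        simp [n]
        rw [B.symm]
        linear_combination h3
      · rw [k2]; simp
  refine ⟨SemidirectProduct.inl n * SemidirectProduct.inr x, ?_⟩
  rw [map_mul, ← key, hh]; group

end GH

end

/-! ## Part P -/

section
set_option linter.unusedSectionVars false
set_option linter.unusedVariables false
set_option linter.unusedSimpArgs false

namespace GH

theorem fix_set {F V S : Type} [Field F] [AddCommGroup V] [Module F V] [Group S] [Finite V] (p : ℕ) [Fact p.Prime]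
    (hS : IsPGroup p S) (ρ : Representation F S V) (X : Set V) (h0 : (0 : V) ∈ X) (hX : ∀ s, ∀ x ∈ X, ρ s x ∈ X)
    (hp : p ∣ Nat.card X) : ∃ x ∈ X, x ≠ 0 ∧ ∀ s, ρ s x = x := by
  let _ : MulAction S X :=
    { smul := fun s x => ⟨ρ s x.1, hX s x.1 x.2⟩
      one_smul := fun x => Subtype.ext (by change ρ 1 x.1 = x.1; simp)
      mul_smul := fun s t x => Subtype.ext (by change ρ (s * t) x.1 = ρ s (ρ t x.1); simp) }
  have hsm : ∀ (s : S) (x : X), (s • x).1 = ρ s x.1 := fun s x => rfl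
  obtain ⟨x, hx, hne⟩ := hS.exists_fixed_point_of_prime_dvd_card_of_fixed_point X hp (a := ⟨0, h0⟩)
    (fun s => Subtype.ext (by rw [hsm]; simp))
  refine ⟨x.1, x.2, fun h => hne (Subtype.ext h.symm), fun s => ?_⟩
  rw [← hsm, hx s]

theorem sub_dvd {F V : Type} [Field F] [AddCommGroup V] [Module F V] [Finite V] (p : ℕ) [Fact p.Prime] [CharP F p]
    (K : Submodule F V) (hK : K ≠ ⊥) : p ∣ Nat.card (K : Set V) := by
  obtain ⟨x, hx, hne⟩ := K.ne_bot_iff.1 hK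
  have h1 : addOrderOf (⟨x, hx⟩ : K) = p := by
    apply addOrderOf_eq_prime
    · rw [← Nat.cast_smul_eq_nsmul F, CharP.cast_eq_zero, zero_smul]
    · exact fun h => hne (congrArg Subtype.val h)
  rw [← h1]
  exact addOrderOf_dvd_natCard _

theorem iso_dvd {F V : Type} [Field F] [AddCommGroup V] [Module F V] [Fintype F] [Finite V] (p : ℕ) [Fact p.Prime] [CharP F p]
    (b : V →ₗ[F] V →ₗ[F] F) (h3 : 3 ≤ Module.finrank F V) : p ∣ Nat.card {v : V | b v v = 0} := by
  classical
  have : Module.Finite F V := Module.Finite.of_finite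
  let bs := Module.finBasis F V
  let f : MvPolynomial (Fin (Module.finrank F V)) F :=
    ∑ i, ∑ j, MvPolynomial.C (b (bs i) (bs j)) * (MvPolynomial.X i * MvPolynomial.X j)
  have hdeg : f.totalDegree < Fintype.card (Fin (Module.finrank F V)) := by
    rw [Fintype.card_fin]
    refine lt_of_le_of_lt ?_ (show 2 < _ from h3)
    refine MvPolynomial.totalDegree_finsetSum_le fun i _ => MvPolynomial.totalDegree_finsetSum_le fun j _ => ?_
    refine (MvPolynomial.totalDegree_mul _ _).trans ?_
    rw [MvPolynomial.totalDegree_C, zero_add]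
    refine (MvPolynomial.totalDegree_mul _ _).trans ?_
    simp
  have := char_dvd_card_solutions p hdeg
  rw [← Nat.card_eq_fintype_card] at this
  refine (Nat.card_congr ?_).symm ▸ this
  refine (bs.equivFun.toEquiv).subtypeEquiv fun v => ?_
  have hv : b v v = MvPolynomial.eval (bs.equivFun v) f := by
    conv_lhs => rw [← bs.sum_equivFun v]
    simp only [f, map_sum, LinearMap.sum_apply, map_smul, LinearMap.smul_apply, map_mul, MvPolynomial.eval_C, MvPolynomial.eval_X, smul_eq_mul]
    rw [Finset.sum_comm]
    refine Finset.sum_congr rfl fun i _ => ?_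
    rw [Finset.mul_sum]
    refine Finset.sum_congr rfl fun j _ => ?_
    ring
  change b v v = 0 ↔ _
  rw [hv]; rfl

/-- if no fixed isotropic vector exists then the action is trivial -/
theorem triv_of_aniso {F V S : Type} [Field F] [AddCommGroup V] [Module F V] [Fintype F] [Finite V] [Group S] (p : ℕ)
    [Fact p.Prime] [CharP F p] (b : V →ₗ[F] V →ₗ[F] F) (hs : ∀ v w, b v w = b w v) (hn : ∀ v, (∀ w, b v w = 0) → v = 0)
    (hS : IsPGroup p S) (ρ : Representation F S V) (hρ : ∀ s v w, b (ρ s v) (ρ s w) = b v w)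
    (hno : ∀ v, b v v = 0 → (∀ s, ρ s v = v) → v = 0) : ∀ s v, ρ s v = v := by
  have : Module.Finite F V := Module.Finite.of_finite
  let Fix : Submodule F V :=
    { carrier := {v | ∀ s, ρ s v = v}
      add_mem' := fun {x y} hx hy s => by rw [map_add, hx, hy]
      zero_mem' := fun s => map_zero _
      smul_mem' := fun c x hx s => by rw [map_smul, hx] }
  let R : V →ₗ[F] Module.Dual F Fix := (LinearMap.lcomp F F Fix.subtype).comp b
  have hR : LinearMap.ker R = ⊥ := by
    by_contra hK
    obtain ⟨x, hx, hne, hf⟩ := fix_set p hS ρ (LinearMap.ker R : Set V) (zero_mem _) (fun s x hx => by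
      have hx' : R x = 0 := hx
      change R (ρ s x) = 0
      ext f
      have h1 : b x f.1 = 0 := LinearMap.congr_fun hx' f
      change b (ρ s x) f.1 = 0
      rw [← h1, ← hρ s x f.1, f.2 s]) (sub_dvd p _ hK)
    have hx' : R x = 0 := hx
    exact hne (hno x (LinearMap.congr_fun hx' ⟨x, hf⟩) hf)
  have hfr := LinearMap.finrank_le_finrank_of_injective (LinearMap.ker_eq_bot.1 hR)
  rw [Subspace.dual_finrank_eq] at hfr
  have : Fix = ⊤ := Submodule.eq_top_of_finrank_eq (le_antisymm (Submodule.finrank_le _) hfr)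
  intro s v
  have hv : v ∈ Fix := this ▸ Submodule.mem_top
  exact hv s


theorem witt {F S : Type} [Field F] [Fintype F] [Group S] (h2 : (2 : F) ≠ 0) (p : ℕ) [Fact p.Prime] [CharP F p]
    (hS : IsPGroup p S) (N : ℕ) : ∀ (V : Type) [AddCommGroup V] [Module F V] [Finite V] (hN : Module.finrank F V < N)
    (b : V →ₗ[F] V →ₗ[F] F) (hs : ∀ v w, b v w = b w v) (hn : ∀ v, (∀ w, b v w = 0) → v = 0)
    (ρ : Representation F S V) (hρ : ∀ s v w, b (ρ s v) (ρ s w) = b v w),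
    ∃ (I U : Type) (_ : Fintype I) (_ : DecidableEq I) (_ : Fintype U) (B : SB F U) (e : V ≃ₗ[F] EE' F U I),
      Fintype.card U ≤ 2 ∧ (∀ v w, b v w = bm B (e v) (e w)) ∧
      ∀ s a c, (e (ρ s (e.symm (a, 0, c)))).2 = (0, c) := by
  induction N with
  | zero =>
    intro V _ _ _ hN b hs hn ρ hρ
    exact absurd hN (Nat.not_lt_zero _)
  | succ N ih =>
  intro V _ _ _ hN b hs hn ρ hρ
  have : Module.Finite F V := Module.Finite.of_finite
  by_cases hno : ∀ v, b v v = 0 → (∀ s, ρ s v = v) → v = 0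
  · have htr := triv_of_aniso p b hs hn hS ρ hρ hno
    have hfr : Module.finrank F V ≤ 2 := by
      by_contra h
      obtain ⟨x, hx, hne, hf⟩ := fix_set p hS ρ {v : V | b v v = 0} (by simp) (fun s x hx => by
        change b _ _ = 0
        rw [hρ]; exact hx) (iso_dvd p b (by omega))
      exact hne (hno x hx hf)
    let bs := Module.finBasis F V
    let e0 := bs.equivFun
    let e : V ≃ₗ[F] EE' F (Fin (Module.finrank F V)) (Fin 0) :=
      { toFun := fun v => (0, 0, e0 v)
        map_add' := fun v w => by simp
        map_smul' := fun c v => by simp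
        invFun := fun x => e0.symm x.2.2
        left_inv := fun v => by simp
        right_inv := fun x => by
          refine Prod.ext (Subsingleton.elim _ _) (Prod.ext (Subsingleton.elim _ _) ?_)
          simp }
    refine ⟨Fin 0, Fin (Module.finrank F V), inferInstance, inferInstance, inferInstance,
      ⟨b.compl₁₂ e0.symm.toLinearMap e0.symm.toLinearMap, fun x y => hs _ _⟩, e, by simpa using hfr, fun v w => ?_, fun s a c => ?_⟩
    · simp [bm, e]
    · rw [htr, LinearEquiv.apply_symm_apply]
  · push Not at hno
    obtain ⟨v, hvv, hvf, hv0⟩ := hno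
    obtain ⟨v', hv1, hv2⟩ : ∃ v', b v v' = 1 ∧ b v' v' = 0 := by
      obtain ⟨w, hw⟩ : ∃ w, b v w ≠ 0 := by
        by_contra h; push Not at h; exact hv0 (hn v h)
      have hu : b v ((b v w)⁻¹ • w) = 1 := by simp [hw]
      set u := (b v w)⁻¹ • w
      refine ⟨u - (b u u / 2) • v, by simp [hu, hvv], ?_⟩
      simp [hs u v, hu, hvv]
      field_simp
      ring
    have hv3 : b v' v = 1 := by rw [hs, hv1]
    let W : Submodule F V := LinearMap.ker (b v) ⊓ LinearMap.ker (b v')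
    have hW : ∀ w : W, b v w.1 = 0 ∧ b v' w.1 = 0 := fun w => ⟨w.2.1, w.2.2⟩
    let π : V →ₗ[F] W := LinearMap.codRestrict W (LinearMap.id - (b v').smulRight v - (b v).smulRight v') (fun x => by
      refine ⟨?_, ?_⟩
      · simp [hvv, hv1]
      · simp [hv2, hv3])
    have hπ : ∀ x, (π x).1 = x - b v' x • v - b v x • v' := fun x => rfl
    have hπW : ∀ w : W, π w.1 = w := fun w => Subtype.ext (by rw [hπ, (hW w).1, (hW w).2]; simp)
    have hπv : π v = 0 := Subtype.ext (by rw [hπ, hvv, hv3]; simp)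
    have hπv' : π v' = 0 := Subtype.ext (by rw [hπ, hv1, hv2]; simp)
    have hvρ : ∀ s x, b v (ρ s x) = b v x := fun s x => by
      conv_lhs => rw [← hvf s]
      exact hρ s v x
    have hdec : ∀ s (w : W), ρ s w.1 = (π (ρ s w.1)).1 + b v' (ρ s w.1) • v := fun s w => by
      rw [hπ, hvρ, (hW w).1]; simp
    let ρ' : Representation F S W :=
      { toFun := fun s => π ∘ₗ ρ s ∘ₗ W.subtype
        map_one' := by
          refine LinearMap.ext fun w => ?_
          simp [hπW]
        map_mul' := fun s t => by
          refine LinearMap.ext fun w => ?_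
          change π (ρ (s * t) w.1) = π (ρ s (π (ρ t w.1)).1)
          rw [map_mul, Module.End.mul_apply, hdec t w, map_add (ρ s), map_smul, hvf, map_add, map_smul, hπv, smul_zero, add_zero]
          rw [← hdec t w] }
    have hρ' : ∀ s w, ρ' s w = π (ρ s w.1) := fun s w => rfl
    let b' : W →ₗ[F] W →ₗ[F] F := b.compl₁₂ W.subtype W.subtype
    have hb' : ∀ x y, b' x y = b x.1 y.1 := fun x y => rfl
    have hbπ : ∀ x y, b x y = b' (π x) (π y) + b v' x * b v y + b v x * b v' y := fun x y => by
      rw [hb', hπ, hπ]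
      simp only [map_sub, map_smul, LinearMap.sub_apply, LinearMap.smul_apply, smul_eq_mul, hvv, hv1, hv2, hv3, hs x v, hs x v']
      ring
    have hlt : Module.finrank F W < Module.finrank F V := by
      apply Submodule.finrank_lt
      intro h
      have h1 : v ∈ W := h ▸ Submodule.mem_top
      have h4 : b v' v = 0 := h1.2
      rw [hv3] at h4
      exact one_ne_zero h4
    obtain ⟨I, U, _, _, _, B, e, hU, hB, hcr⟩ := ih W (by omega) b' (fun x y => hs _ _) (fun w hw => by
        refine Subtype.ext (hn w.1 fun x => ?_)
        rw [hbπ, hπW, hw, (hW w).1, (hW w).2]; simp) ρ' (fun s x y => by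
        have h5 := hbπ (ρ s x.1) (ρ s y.1)
        rw [hvρ, hvρ, (hW x).1, (hW y).1, mul_zero, zero_mul, add_zero, add_zero, hρ] at h5
        rw [hρ', hρ', ← h5, hb'])
    let e' : V ≃ₗ[F] EE' F U (Option I) :=
      { toFun := fun x => (fun i => i.elim (b v' x) (e (π x)).1, fun i => i.elim (b v x) (e (π x)).2.1, (e (π x)).2.2)
        map_add' := fun x y => by
          refine Prod.ext (funext fun i => ?_) (Prod.ext (funext fun i => ?_) ?_)
          · cases i <;> simp
          · cases i <;> simp
          · simp
        map_smul' := fun c x => by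
          refine Prod.ext (funext fun i => ?_) (Prod.ext (funext fun i => ?_) ?_)
          · cases i <;> simp
          · cases i <;> simp
          · simp
        invFun := fun y => (e.symm (fun i => y.1 (some i), fun i => y.2.1 (some i), y.2.2)).1 + y.1 none • v + y.2.1 none • v'
        left_inv := fun x => by
          change (e.symm (e (π x))).1 + b v' x • v + b v x • v' = x
          rw [e.symm_apply_apply, hπ]; abel
        right_inv := fun y => by
          have h6 := hW (e.symm (fun i => y.1 (some i), fun i => y.2.1 (some i), y.2.2))
          refine Prod.ext (funext fun i => ?_) (Prod.ext (funext fun i => ?_) ?_)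
          · cases i <;> simp [h6, hv1, hv2, hv3, hvv, hπv, hπv', hπW]
          · cases i <;> simp [h6, hv1, hv2, hv3, hvv, hπv, hπv', hπW]
          · simp [h6, hv1, hv2, hv3, hvv, hπv, hπv', hπW] }
    have he' : ∀ x, e' x = (fun i => i.elim (b v' x) (e (π x)).1, fun i => i.elim (b v x) (e (π x)).2.1, (e (π x)).2.2) :=
      fun x => rfl
    have hes : ∀ y, e'.symm y = (e.symm (fun i => y.1 (some i), fun i => y.2.1 (some i), y.2.2)).1 + y.1 none • v + y.2.1 none • v' :=
      fun y => rfl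
    refine ⟨Option I, U, inferInstance, inferInstance, inferInstance, B, e', hU, fun x y => ?_, fun s a c => ?_⟩
    · rw [hbπ, hB, he', he']
      simp only [bm, Fintype.sum_option, Option.elim]
      ring
    · have h7 := hcr s (fun i => a (some i)) c
      rw [hes, he']
      set w := e.symm (fun i => a (some i), 0, c)
      have h8 : e.symm (fun i => a (some i), fun i => (0 : Option I → F) (some i), c) = w := rfl
      dsimp only
      rw [h8, Pi.zero_apply, zero_smul, add_zero, map_add, map_smul, hvf]
      rw [map_add π, map_smul π, hπv, smul_zero, add_zero, ← hρ', map_add (b v), map_smul, hvv, hvρ, (hW w).1, h7]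
      refine Prod.ext (funext fun i => ?_) rfl
      cases i <;> simp

end GH

end

/-! ## Part Q -/

section
set_option linter.unusedSectionVars false
set_option linter.unusedVariables false
set_option linter.unusedSimpArgs false

namespace GH

theorem og_vanish {k : Type} [Field k] {M : Type} [AddCommGroup M] [Module k M] {F V : Type} [Field F] [Fintype F]
    [AddCommGroup V] [Module F V] [Finite V] (h2 : (2 : k) ≠ 0) (h2' : (2 : F) ≠ 0) (p : ℕ) [Fact p.Prime] [CharP k p]
    [Finite k] [CharP F p] (b : V →ₗ[F] V →ₗ[F] F) (hs : ∀ v w, b v w = b w v) (hn : ∀ v, (∀ w, b v w = 0) → v = 0)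
    (q : V → F) (hq : ∀ v, q v = b v v / 2) (d : ℕ) (hd0 : 0 < d) (hd : 2 * d < Module.finrank F V - 1) :
    Subsingleton (H d (1 : Representation k (OG q) M)) := by
  have : Finite (V ≃ₗ[F] V) := Finite.of_injective (fun g : V ≃ₗ[F] V => (g : V → V)) DFunLike.coe_injective
  let S : Sylow p (OG q) := default
  let ρ : Representation F S V :=
    { toFun := fun s => s.1.1.toLinearMap
      map_one' := rfl
      map_mul' := fun _ _ => rfl }
  have hqa : ∀ v w, b v w = q (v + w) - q v - q w := fun v w => by
    rw [hq, hq, hq]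
    simp only [map_add, LinearMap.add_apply, hs w v]
    field_simp
    ring
  obtain ⟨I, U, _, _, _, B, e, hU, hB, hcr⟩ := witt h2' p S.isPGroup' (Module.finrank F V + 1) V (Nat.lt_succ_self _) b hs hn ρ
    (fun s v w => by
      have h1 : ∀ x, q (ρ s x) = q x := fun x => s.1.2 x
      rw [hqa, hqa, ← map_add, h1, h1, h1])
  have hqm : ∀ v, qm B (e v) = q v := fun v => by
    rw [hq, hB, qm, bm]
    field_simp
    ring
  have : Finite (EE' F U I) := inferInstance
  have : Finite (EE' F U I ≃ₗ[F] EE' F U I) :=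
    Finite.of_injective (fun g : EE' F U I ≃ₗ[F] EE' F U I => (g : EE' F U I → EE' F U I)) DFunLike.coe_injective
  let θ : OG q →* OG (qm (I := I) B) :=
    { toFun := fun g => ⟨e.symm.trans (g.1.trans e), fun v => by
        change qm B (e (g.1 (e.symm v))) = qm B v
        rw [hqm, g.2, ← hqm, e.apply_symm_apply]⟩
      map_one' := Subtype.ext (LinearEquiv.ext fun v => e.apply_symm_apply v)
      map_mul' := fun g h => Subtype.ext (LinearEquiv.ext fun v => by
        change e (g.1 (h.1 (e.symm v))) = e (g.1 (e.symm (e (h.1 (e.symm v)))))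
        rw [e.symm_apply_apply]) }
  have hθ : ∀ g v, (θ g).1 v = e (g.1 (e.symm v)) := fun g v => rfl
  let θ' : OG (qm (I := I) B) →* OG q :=
    { toFun := fun g => ⟨e.trans (g.1.trans e.symm), fun v => by
        change q (e.symm (g.1 (e v))) = q v
        rw [← hqm, e.apply_symm_apply, g.2, hqm]⟩
      map_one' := Subtype.ext (LinearEquiv.ext fun v => e.symm_apply_apply v)
      map_mul' := fun g h => Subtype.ext (LinearEquiv.ext fun v => by
        change e.symm (g.1 (h.1 (e v))) = e.symm (g.1 (e (e.symm (h.1 (e v)))))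
        rw [e.apply_symm_apply]) }
  have hθ' : ∀ g v, (θ' g).1 v = e.symm (g.1 (e v)) := fun g v => rfl
  have l1 : ∀ g, θ (θ' g) = g := fun g => Subtype.ext (LinearEquiv.ext fun v => by
    rw [hθ, hθ', e.apply_symm_apply, e.apply_symm_apply])
  have l2 : ∀ g, θ' (θ g) = g := fun g => Subtype.ext (LinearEquiv.ext fun v => by
    rw [hθ', hθ, e.symm_apply_apply, e.symm_apply_apply])
  have bij : Function.Bijective θ' := ⟨fun x y h => by rw [← l1 x, h, l1], fun y => ⟨θ y, l2 y⟩⟩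
  have hle : S.1.map θ ≤ (Phi h2' B I).range := by
    rintro _ ⟨s, hs', rfl⟩
    apply Phi_range h2'
    · intro a
      exact hcr ⟨s, hs'⟩ a 0
    · intro c
      exact hcr ⟨s, hs'⟩ 0 c
  have hidx : ((Phi h2' B I).range.index : k) ≠ 0 := by
    rw [Ne, CharP.cast_eq_zero_iff k p]
    intro h
    have h3 := h.trans (Subgroup.index_dvd_of_le hle)
    have h4 : (S.1.map θ).index = S.1.index :=
      Subgroup.index_map_of_bijective (f := θ) ⟨fun x y h => by rw [← l2 x, h, l2], fun y => ⟨θ' y, l1 y⟩⟩ S.1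
    rw [h4] at h3
    exact S.not_dvd_index h3
  have hfr : Module.finrank F V = 2 * Fintype.card I + Fintype.card U := by
    rw [e.finrank_eq]; simp; ring
  apply H_iso θ' bij
  change Subsingleton (H d (1 : Representation k (OG (qm (I := I) B)) M))
  by_cases hc : Fintype.card U = 2
  · have hBn : Function.Injective B.b := by
      rw [injective_iff_map_eq_zero]
      intro c hc'
      have h6 : e.symm (0, 0, c) = 0 := hn _ fun w => by
        rw [hB, e.apply_symm_apply, bm, hc']; simp
      have h7 : ((0, 0, c) : EE' F U I) = 0 := by rw [← e.apply_symm_apply (0, 0, c), h6, map_zero]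
      exact congrArg (fun t => t.2.2) h7
    have hBs : Function.Surjective B.b :=
      (LinearMap.injective_iff_surjective_of_finrank_eq_finrank (f := B.b) (Subspace.dual_finrank_eq (K := F) (V := U → F)).symm).1 hBn
    have : Nonempty U := Fintype.card_pos_iff.1 (by omega)
    let u0 : U := Classical.arbitrary U
    obtain ⟨r, hr⟩ := hBs (LinearMap.proj u0)
    exact swap_vanish h2 h2' p u0 r (fun t => by rw [hr]; rfl) (Phi h2' B I) (Phi_inj h2') hidx (hsw h2') d hd0 (by omega)
  · have := gam_vanish (M := M) (B := B) (I := I) h2 h2' p d hd0 (by omega)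
    exact (tc_surj (M := M) (Phi h2' B I) (Phi_inj h2') hidx d).subsingleton

theorem exact_of_H {k : Type} [Field k] {G : Type} [Group G] (d : ℕ) (h : Subsingleton (H (d + 1) (1 : Representation k G k)))
    (x : (Fin (d + 1) → G) →₀ k) (hx : groupHomology.inhomogeneousChains.d (Rep.of (1 : Representation k G k)) d x = 0) :
    ∃ y, groupHomology.inhomogeneousChains.d (Rep.of (1 : Representation k G k)) (d + 1) y = x := by
  let A := Rep.of (1 : Representation k G k)
  have hz : Limits.IsZero ((groupHomology.inhomogeneousChains A).homology (d + 1)) :=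
    ModuleCat.isZero_of_iff_subsingleton.2 h
  have he := ((groupHomology.inhomogeneousChains A).exactAt_iff_isZero_homology (d + 1)).2 hz
  rw [HomologicalComplex.exactAt_iff' _ (d + 2) (d + 1) d (by simp) (by simp)] at he
  have he' := (ShortComplex.moduleCat_exact_iff _).1 he
  obtain ⟨y, hy⟩ := he' x (by
    change (groupHomology.inhomogeneousChains A).d (d + 1) d x = 0
    rw [groupHomology.inhomogeneousChains.d_def]
    exact hx)
  refine ⟨y, ?_⟩
  rw [← hy]
  change _ = (groupHomology.inhomogeneousChains A).d (d + 2) (d + 1) y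
  rw [groupHomology.inhomogeneousChains.d_def]

end GH

end

set_option linter.unusedSectionVars false
set_option linter.unusedVariables false
set_option linter.unusedSimpArgs false

namespace GH

theorem frozen_d {p : ℕ} [Fact p.Prime] {G : Type} [Group G] (n : ℕ) (x : (Fin (n + 1) → G) →₀ ZMod p) :
    GroupHomologyBar.d G (ZMod p) n x =
      groupHomology.inhomogeneousChains.d (Rep.of (1 : Representation (ZMod p) G (ZMod p))) n x := by
  induction x using Finsupp.induction_linear with
  | zero => rw [map_zero, map_zero]
  | add x y hx hy => rw [map_add, hx, hy, map_add]
  | single g a =>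
    rw [GroupHomologyBar.d_single]
    erw [groupHomology.inhomogeneousChains.d_single]
    refine congrArg₂ (· + ·) rfl (Finset.sum_congr rfl fun j _ => ?_)
    rcases Nat.even_or_odd ((j : ℕ) + 1) with h | h
    · rw [h.neg_one_pow, h.neg_one_pow, one_smul, one_smul]
    · rw [h.neg_one_pow, h.neg_one_pow, neg_smul, neg_smul, one_smul, one_smul]

theorem frozen_vanish {p : ℕ} [Fact p.Prime] {G : Type} [Group G] (d : ℕ) (hd : 0 < d)
    (h : Subsingleton (H d (1 : Representation (ZMod p) G (ZMod p)))) :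
    Subsingleton (GroupHomologyBar.Homology G (ZMod p) d) := by
  obtain ⟨d, rfl⟩ : ∃ a, d = a + 1 := ⟨d - 1, by omega⟩
  rw [Submodule.Quotient.subsingleton_iff, eq_top_iff]
  rintro ⟨x, hx⟩ -
  have hx' : GroupHomologyBar.d G (ZMod p) d x = 0 := hx
  rw [frozen_d] at hx'
  obtain ⟨y, hy⟩ := exact_of_H d h x hx'
  refine ⟨y, ?_⟩
  rw [frozen_d]
  exact hy

end GH

open GroupHomologyBar in
/-- Vanishing of the homology of the orthogonal group of any nondegenerate quadratic form
`Q` on `𝔽_{ℓ^r}ⁿ`, with `ℓ` an odd prime, at the characteristic: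
`H_d(O(Q); 𝔽_ℓ) = 0` for `0 < 2d < n - 1`.  Here `O(Q)` is realized as the group
`quadIsoms F Q` of linear automorphisms of `Fⁿ` preserving `Q`. -/
theorem O_quadratic_homology_vanishing (ℓ r : ℕ) (hℓ : ℓ.Prime) (hodd : Odd ℓ) (hr : 1 ≤ r)
    (F : Type) [Field F] [Fintype F] (hcard : Fintype.card F = ℓ ^ r) (n : ℕ)
    (Q : QuadraticForm F (Fin n → F))
    (hQ : ∀ v : Fin n → F, (∀ w : Fin n → F, QuadraticMap.polar Q w v = 0) → v = 0)
    (d : ℕ) (hd0 : 0 < d) (hdn : 2 * d < n - 1) :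
    Subsingleton (Homology (↥(quadIsoms F (⇑Q))) (ZMod ℓ) d) := by
  have hp : Fact ℓ.Prime := ⟨hℓ⟩
  have hch : CharP F ℓ := by
    obtain ⟨c, hc⟩ := CharP.exists F
    obtain ⟨m, hcp, hm⟩ := FiniteField.card F c
    rw [hcard] at hm
    have : ℓ = c := (Nat.prime_dvd_prime_iff_eq hℓ hcp).1
      (hℓ.dvd_of_dvd_pow (hm ▸ dvd_pow_self ℓ (by omega)))
    rw [this]; exact hc
  have hl2 : ℓ ≠ 2 := by rintro rfl; exact absurd hodd (by decide)
  have h2 : (2 : ZMod ℓ) ≠ 0 := Ring.two_ne_zero (by rwa [ZMod.ringChar_zmod_n])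
  have h2' : (2 : F) ≠ 0 := Ring.two_ne_zero (by rwa [ringChar.eq F ℓ])
  have h := GH.og_vanish (k := ZMod ℓ) (M := ZMod ℓ) h2 h2' ℓ (QuadraticMap.polarBilin Q)
    (fun v w => QuadraticMap.polar_comm Q v w)
    (fun v hv => hQ v fun w => by rw [QuadraticMap.polar_comm]; exact hv w)
    (⇑Q) (fun v => by
      rw [QuadraticMap.polarBilin_apply_apply, QuadraticMap.polar_self, nsmul_eq_mul]
      push_cast
      field_simp) d hd0 (by simpa using hdn)
  exact GH.frozen_vanish d hd0 h
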